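/- Let g be the finite-dimensional simple Lie algebra of type E₇ over ℂ. Every nilpotent element e of g with dim g_e = 79 satisfies dim [g_e,g_e] = 78 and e ∉ [g_e,g_e]. (The unique nilpotent orbit of E₇ with centralizer dimension 79 is (3A₁)″, whose abelianized centralizer g_e/[g_e,g_e] is one-dimensional and which is not reachable.) -/

import Mathlib

/-- The centralizer `g_e` of `e`, i.e. the kernel of `ad e`. -/
noncomputable def centralizer (e : LieAlgebra.e₇ ℂ) : Submodule ℂ (LieAlgebra.e₇ ℂ) :=
  LinearMap.ker (LieAlgebra.ad ℂ (LieAlgebra.e₇ ℂ) e)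

/-- The derived subalgebra `[g_e, g_e]` of the centralizer, as the linear span of all
brackets of pairs of elements of `g_e`. -/
noncomputable def derived (e : LieAlgebra.e₇ ℂ) : Submodule ℂ (LieAlgebra.e₇ ℂ) :=
  Submodule.span ℂ
    {z : LieAlgebra.e₇ ℂ | ∃ x ∈ centralizer e, ∃ y ∈ centralizer e, ⁅x, y⁆ = z}

section TypeE₇Structure

open Module

section Eigen

variable {V : Type*} [AddCommGroup V] [Module ℂ V] [FiniteDimensional ℂ V]

/-- An eigenvector of `ad H` with nonzero eigenvalue is nilpotent. -/
theorem isNilpotent_of_commutator_eq_smul (H F : End ℂ V) (c : ℂ) (hc : c ≠ 0)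
    (h : H * F - F * H = c • F) : IsNilpotent F := by
  have key : ∀ n : ℕ, H * F ^ n - F ^ n * H = (n * c) • F ^ n := by
    intro n
    induction n with
    | zero => simp
    | succ n ih =>
      have h1 : H * F ^ (n + 1) - F ^ (n + 1) * H
          = (H * F ^ n - F ^ n * H) * F + F ^ n * (H * F - F * H) := by
        rw [pow_succ]; noncomm_ring
      rw [h1, ih, h, smul_mul_assoc, mul_smul_comm, ← pow_succ, ← add_smul]
      push_cast; ring_nf
  by_contra hn
  have hF : ∀ n, F ^ n ≠ 0 := fun n hn' => hn ⟨n, hn'⟩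
  let D : End ℂ (End ℂ V) := LinearMap.mulLeft ℂ H - LinearMap.mulRight ℂ H
  have hD : ∀ n : ℕ, D.HasEigenvalue (n * c) := fun n =>
    End.hasEigenvalue_of_hasEigenvector (x := F ^ n)
      ⟨by simp [D, key], hF n⟩
  have hinj : Function.Injective (fun n : ℕ => (n : ℂ) * c) := fun a b hab => by
    simpa [hc] using hab
  exact (Set.infinite_range_of_injective hinj)
    ((End.finite_hasEigenvalue D).subset (by rintro _ ⟨n, rfl⟩; exact hD n))

variable (H : End ℂ V)

/-- The finite set of integers that are eigenvalues of `H`. -/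
theorem finite_int_eigenvalue : {i : ℤ | H.eigenspace (i : ℂ) ≠ ⊥}.Finite := by
  have := (End.finite_hasEigenvalue H).preimage (f := fun i : ℤ => (i : ℂ))
    (Int.cast_injective.injOn)
  refine this.subset fun i hi => ?_
  simpa [End.hasEigenvalue_iff] using hi

omit [FiniteDimensional ℂ V] in
theorem iSupIndep_int_eigenspace : iSupIndep fun i : ℤ => H.eigenspace (i : ℂ) :=
  (End.eigenspaces_iSupIndep H).comp Int.cast_injective

variable {H}

theorem isInternal_int_eigenspace (hH : ⨆ i : ℤ, H.eigenspace (i : ℂ) = ⊤) (N : ℕ)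
    (hN : ∀ i : ℤ, H.eigenspace (i : ℂ) ≠ ⊥ → |i| ≤ N) :
    DirectSum.IsInternal fun i : Finset.Icc (-N : ℤ) N => H.eigenspace ((i : ℤ) : ℂ) := by
  rw [DirectSum.isInternal_submodule_iff_iSupIndep_and_iSup_eq_top]
  refine ⟨(iSupIndep_int_eigenspace H).comp Subtype.val_injective, ?_⟩
  rw [eq_top_iff, ← hH]
  refine iSup_le fun i => ?_
  by_cases hi : H.eigenspace (i : ℂ) = ⊥
  · rw [hi]; exact bot_le
  · have := abs_le.1 (hN i hi)
    exact le_iSup (fun i : Finset.Icc (-N : ℤ) N => H.eigenspace ((i : ℤ) : ℂ))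
      ⟨i, Finset.mem_Icc.2 this⟩

theorem trace_pow_eq_sum (hH : ⨆ i : ℤ, H.eigenspace (i : ℂ) = ⊤) (N : ℕ)
    (hN : ∀ i : ℤ, H.eigenspace (i : ℂ) ≠ ⊥ → |i| ≤ N) (k : ℕ) :
    LinearMap.trace ℂ V (H ^ k)
      = ∑ i ∈ Finset.Icc (-N : ℤ) N, (i : ℂ) ^ k * finrank ℂ (H.eigenspace (i : ℂ)) := by
  have hpow : ∀ (μ : ℂ) (x : V), x ∈ H.eigenspace μ → (H ^ k) x = μ ^ k • x := by
    intro μ x hx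
    rw [End.mem_eigenspace_iff] at hx
    induction k with
    | zero => simp
    | succ k ih => rw [pow_succ', Module.End.mul_apply, ih, map_smul, hx, smul_smul, ← pow_succ]
  have hmaps : ∀ i : Finset.Icc (-N : ℤ) N, Set.MapsTo (H ^ k)
      (H.eigenspace ((i : ℤ) : ℂ)) (H.eigenspace ((i : ℤ) : ℂ)) := fun i x hx => by
    rw [hpow _ x hx]; exact Submodule.smul_mem _ _ hx
  rw [LinearMap.trace_eq_sum_trace_restrict (isInternal_int_eigenspace hH N hN) hmaps,
    ← Finset.sum_coe_sort (Finset.Icc (-N : ℤ) N)]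
  refine Finset.sum_congr rfl fun i _ => ?_
  have : (H ^ k).restrict (hmaps i) = (((i : ℤ) : ℂ) ^ k) • LinearMap.id := by
    exact LinearMap.ext fun x => Subtype.ext (hpow _ x x.2)
  rw [this]
  simp

theorem finrank_eq_sum (hH : ⨆ i : ℤ, H.eigenspace (i : ℂ) = ⊤) (N : ℕ)
    (hN : ∀ i : ℤ, H.eigenspace (i : ℂ) ≠ ⊥ → |i| ≤ N) :
    finrank ℂ V = ∑ i ∈ Finset.Icc (-N : ℤ) N, finrank ℂ (H.eigenspace (i : ℂ)) := by
  have := trace_pow_eq_sum hH N hN 0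
  simp only [pow_zero, LinearMap.trace_one, one_mul] at this
  exact_mod_cast this

end Eigen

/-- Three endomorphisms satisfying the commutation relations of `sl₂`. -/
structure SlTwoRep {V : Type*} [AddCommGroup V] [Module ℂ V] (E F H : End ℂ V) : Prop where
  lie_h_e : ∀ v, H (E v) = E (H v) + (2 : ℂ) • E v
  lie_h_f : ∀ v, H (F v) = F (H v) - (2 : ℂ) • F v
  lie_e_f : ∀ v, E (F v) = F (E v) + H v
  nil_e : IsNilpotent E
  nil_f : IsNilpotent F

namespace SlTwoRep

variable {V : Type*} [AddCommGroup V] [Module ℂ V] {E F H : End ℂ V}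

theorem exists_last {T : End ℂ V} (hT : IsNilpotent T) {v : V} (hv : v ≠ 0) :
    ∃ k : ℕ, (T ^ k) v ≠ 0 ∧ (T ^ (k + 1)) v = 0 := by
  obtain ⟨n, hn⟩ := hT
  exact Nat.exists_not_and_succ_of_not_zero_of_exists (p := fun k => (T ^ k) v = 0)
    (by simpa using hv) ⟨n, by simp [hn]⟩

theorem h_f_pow (t : SlTwoRep E F H) (n : ℕ) (v : V) :
    H ((F ^ n) v) = (F ^ n) (H v) - (2 * n : ℂ) • (F ^ n) v := by
  induction n with
  | zero => simp
  | succ n ih =>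
    rw [pow_succ', Module.End.mul_apply, t.lie_h_f, ih, map_sub, map_smul, Module.End.mul_apply]
    push_cast
    module

theorem h_e_pow (t : SlTwoRep E F H) (n : ℕ) (v : V) :
    H ((E ^ n) v) = (E ^ n) (H v) + (2 * n : ℂ) • (E ^ n) v := by
  induction n with
  | zero => simp
  | succ n ih =>
    rw [pow_succ', Module.End.mul_apply, t.lie_h_e, ih, map_add, map_smul, Module.End.mul_apply]
    push_cast
    module

theorem e_f_pow (t : SlTwoRep E F H) (n : ℕ) (v : V) :
    E ((F ^ (n + 1)) v)
      = (F ^ (n + 1)) (E v) + (n + 1 : ℂ) • (F ^ n) (H v - (n : ℂ) • v) := by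
  induction n with
  | zero => simp [t.lie_e_f]
  | succ n ih =>
    rw [pow_succ', Module.End.mul_apply, t.lie_e_f, ih, t.h_f_pow (n + 1), map_add, map_smul,
      ← Module.End.mul_apply F, ← Module.End.mul_apply F, ← pow_succ', ← pow_succ', map_sub,
          map_smul,
      map_sub, map_smul]
    push_cast
    module

theorem primitive (t : SlTwoRep E F H) {v : V} {μ : ℂ} (hv : v ≠ 0) (he : E v = 0)
    (hh : H v = μ • v) : ∃ k : ℕ, μ = k ∧ (F ^ k) v ≠ 0 ∧ (F ^ (k + 1)) v = 0 := by
  obtain ⟨k, hk, hk'⟩ := exists_last t.nil_f hv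
  refine ⟨k, ?_, hk, hk'⟩
  have := t.e_f_pow k v
  rw [hk', he, hh, ← sub_smul, map_smul] at this
  simp only [map_zero, zero_add] at this
  rw [eq_comm, smul_smul, smul_eq_zero] at this
  have h2 := this.resolve_right hk
  have : (k + 1 : ℂ) ≠ 0 := by exact_mod_cast k.succ_ne_zero
  simpa [this, sub_eq_zero] using h2

theorem eigenvalue_int (t : SlTwoRep E F H) {v : V} {μ : ℂ} (hv : v ≠ 0)
    (hh : H v = μ • v) : ∃ i : ℤ, μ = i := by
  obtain ⟨k, hk, hk'⟩ := exists_last t.nil_e hv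
  have := t.h_e_pow k v
  rw [hh, map_smul, ← add_smul] at this
  obtain ⟨m, hm, -⟩ := t.primitive hk (by rw [← Module.End.mul_apply, ← pow_succ', hk']) this
  refine ⟨m - 2 * k, ?_⟩
  push_cast
  rw [← hm]; ring

theorem e_injective (t : SlTwoRep E F H) {v : V} {i : ℤ} (hi : i < 0) (he : E v = 0)
    (hh : H v = (i : ℂ) • v) : v = 0 := by
  by_contra hv
  obtain ⟨k, hk, -⟩ := t.primitive hv he hh
  have : i = k := by exact_mod_cast hk
  omega

theorem e_f_injective (t : SlTwoRep E F H) {v : V} {n c : ℕ}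
    (hh : H v = (n + 1 : ℂ) • v) (hef : E (F v) = -(c : ℂ) • v) : v = 0 := by
  obtain ⟨k, hk⟩ := t.nil_e
  replace hk : (E ^ k) v = 0 := by simp [hk]
  induction k generalizing v n c with
  | zero => simpa using hk
  | succ k ih =>
    have h1 : E v = 0 := by
      refine ih (n := n + 2) (c := c + n + 1) ?_ ?_ ?_
      · rw [t.lie_h_e, hh, map_smul]; push_cast; module
      · have : F (E v) = E (F v) - H v := by rw [t.lie_e_f]; abel
        rw [this, hef, hh, ← sub_smul, map_smul]; push_cast; module
      · rwa [← Module.End.mul_apply, ← pow_succ]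
    rw [t.lie_e_f, h1, map_zero, zero_add, hh] at hef
    have h2 : ((n + 1 + c : ℕ) : ℂ) • v = 0 := by
      push_cast
      rw [add_smul, hef]; simp
    rw [smul_eq_zero] at h2
    refine h2.resolve_left ?_
    exact_mod_cast (by omega)

theorem e_f_surjective [FiniteDimensional ℂ V] (t : SlTwoRep E F H) {w : V} (n : ℕ)
    (hh : H w = (n + 1 : ℂ) • w) : ∃ u, H u = (n + 1 : ℂ) • u ∧ E (F u) = w := by
  have hmaps : ∀ x ∈ H.eigenspace (n + 1 : ℂ), (E * F) x ∈ H.eigenspace (n + 1 : ℂ) := by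
    intro x hx
    rw [End.mem_eigenspace_iff] at hx ⊢
    rw [Module.End.mul_apply, t.lie_h_e, t.lie_h_f, hx, ← map_smul, map_sub]
    simp
  have hinj : Function.Injective ((E * F).restrict hmaps) := by
    rw [← LinearMap.ker_eq_bot, LinearMap.ker_eq_bot']
    rintro ⟨x, hx⟩ h0
    have h1 : E (F x) = 0 := by simpa using congrArg Subtype.val h0
    have : x = 0 := t.e_f_injective (n := n) (c := 0) (End.mem_eigenspace_iff.1 hx) (by simpa
        using h1)
    simpa using this
  obtain ⟨⟨u, hu⟩, hu'⟩ := LinearMap.injective_iff_surjective.1 hinj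
    ⟨w, End.mem_eigenspace_iff.2 hh⟩
  exact ⟨u, End.mem_eigenspace_iff.1 hu, by simpa using congrArg Subtype.val hu'⟩

theorem e_surjective [FiniteDimensional ℂ V] (t : SlTwoRep E F H) {w : V} {i : ℤ} (hi : -1 ≤ i)
    (hh : H w = ((i + 2 : ℤ) : ℂ) • w) : ∃ u, H u = (i : ℂ) • u ∧ E u = w := by
  obtain ⟨n, rfl⟩ : ∃ n : ℕ, i = n - 1 := ⟨(i + 1).toNat, by omega⟩
  have h1 : (((n - 1 + 2 : ℤ) : ℤ) : ℂ) = n + 1 := by push_cast; ring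
  rw [h1] at hh
  obtain ⟨u, hu, rfl⟩ := t.e_f_surjective n hh
  refine ⟨F u, ?_, rfl⟩
  rw [t.lie_h_f, hu, map_smul]
  push_cast
  module

theorem semisimple_of_e_eq_zero (t : SlTwoRep E F H) {v : V} {μ : ℂ} (he : E v = 0)
    (h2 : H (H v - μ • v) = μ • (H v - μ • v)) : H v = μ • v := by
  by_contra hne
  set w := H v - μ • v with hw
  have hw0 : w ≠ 0 := sub_ne_zero.2 hne
  have hEw : E w = 0 := by
    have := t.lie_h_e v
    rw [he] at this
    simp only [map_zero, smul_zero, add_zero] at this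
    rw [hw, map_sub, map_smul, he, ← this]; simp
  obtain ⟨i, rfl, hi1, hi2⟩ := t.primitive hw0 hEw h2
  have hv0 : v ≠ 0 := by rintro rfl; simp [hw] at hw0
  have hHv : H v = (i : ℂ) • v + w := by rw [hw]; abel
  clear_value w
  obtain ⟨k, hk, hk'⟩ := exists_last t.nil_f hv0
  have key := t.e_f_pow k v
  rw [hk', he, hHv] at key
  simp only [map_zero, zero_add] at key
  have hk1 : (k + 1 : ℂ) ≠ 0 := by exact_mod_cast k.succ_ne_zero
  have key2 := (smul_eq_zero.1 key.symm).resolve_left hk1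
  have key3 : ((i : ℂ) - k) • (F ^ k) v + (F ^ k) w = 0 := by
    rw [← key2, map_sub, map_add, map_smul, map_smul]; module
  have hFw : ∀ m, i < m → (F ^ m) w = 0 := by
    intro m hm
    obtain ⟨r, rfl⟩ : ∃ r, m = r + (i + 1) := ⟨m - (i + 1), by omega⟩
    rw [pow_add, Module.End.mul_apply, hi2, map_zero]
  rcases lt_trichotomy i k with h | rfl | h
  · rw [hFw k h, add_zero, smul_eq_zero, sub_eq_zero] at key3
    have := key3.resolve_right hk
    norm_cast at this
    omega
  · simp [hi1] at key3
  · have key4 : (F ^ (i - k)) (((i : ℂ) - k) • (F ^ k) v + (F ^ k) w) = 0 := by rw [key3, map_zero]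
    rw [map_add, map_smul, ← Module.End.mul_apply, ← Module.End.mul_apply, ← pow_add] at key4
    have e1 : i - k + k = i := by omega
    have e2 : (F ^ i) v = 0 := by
      obtain ⟨r, hr⟩ : ∃ r, i = r + (k + 1) := ⟨i - (k + 1), by omega⟩
      rw [hr, pow_add, Module.End.mul_apply, hk', map_zero]
    rw [e1, e2] at key4
    simp [hi1] at key4

theorem semisimple_step [FiniteDimensional ℂ V] (t : SlTwoRep E F H) (μ : ℂ)
    (ih : ∀ v, H (H v - (μ + 2) • v) = (μ + 2) • (H v - (μ + 2) • v) → H v = (μ + 2) • v)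
    (v : V) (h2 : H (H v - μ • v) = μ • (H v - μ • v)) : H v = μ • v := by
  have hEv : H (E v) = (μ + 2) • E v := by
    apply ih
    have h3 := t.lie_h_e v
    have h4 : H (E v) - (μ + 2) • E v = E (H v - μ • v) := by
      rw [h3, map_sub, map_smul]; module
    rw [h4, t.lie_h_e, h2, map_smul]; module
  by_cases hμ : ∃ n : ℕ, μ = n
  · obtain ⟨n, rfl⟩ := hμ
    obtain ⟨u, hu, hu'⟩ := t.e_f_surjective (w := E v) (n + 1)
      (by rw [hEv]; push_cast; module)
    have hFu : H (F u) = (n : ℂ) • F u := by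
      rw [t.lie_h_f, hu, map_smul]; push_cast; module
    have h5 : H (v - F u) - (n : ℂ) • (v - F u) = H v - (n : ℂ) • v := by
      rw [map_sub, hFu, smul_sub]; abel
    have h6 := t.semisimple_of_e_eq_zero (v := v - F u) (μ := n) (by rw [map_sub, hu', sub_self])
      (by rw [h5, h2])
    rw [← sub_eq_zero, h5, sub_eq_zero] at h6
    exact h6
  · by_contra hne
    have hE : E (H v - μ • v) = 0 := by
      have h3 := t.lie_h_e v
      rw [hEv] at h3
      rw [map_sub, map_smul]
      rw [add_smul, add_left_inj] at h3
      rw [h3, sub_self]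
    obtain ⟨k, hk, -⟩ := t.primitive (sub_ne_zero.2 hne) hE h2
    exact hμ ⟨k, hk⟩

theorem semisimple [FiniteDimensional ℂ V] (t : SlTwoRep E F H) (μ : ℂ)
    (v : V) (h2 : H (H v - μ • v) = μ • (H v - μ • v)) : H v = μ • v := by
  by_contra hne
  have hS : ∀ n : ℕ, ¬ ∀ v, H (H v - (μ + 2 * n) • v) = (μ + 2 * n) • (H v - (μ + 2 * n) • v) →
      H v = (μ + 2 * n) • v := by
    intro n
    induction n with
    | zero => intro h; apply hne; simpa using h v (by simpa using h2)
    | succ n ih =>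
      intro h
      refine ih (t.semisimple_step _ ?_)
      have : μ + 2 * n + 2 = μ + 2 * (n + 1 : ℕ) := by push_cast; ring
      rw [this]; exact h
  have hD : ∀ n : ℕ, H.HasEigenvalue (μ + 2 * n) := fun n => by
    have := hS n
    push Not at this
    obtain ⟨v, hv, hv'⟩ := this
    exact End.hasEigenvalue_of_hasEigenvector ⟨End.mem_eigenspace_iff.2 hv, sub_ne_zero.2 hv'⟩
  have hinj : Function.Injective (fun n : ℕ => μ + 2 * (n : ℂ)) := fun a b hab => by
    simpa using hab
  exact (Set.infinite_range_of_injective hinj)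
    ((End.finite_hasEigenvalue H).subset (by rintro _ ⟨n, rfl⟩; exact hD n))

theorem iSup_eigenspace_complex [FiniteDimensional ℂ V] (t : SlTwoRep E F H) :
    ⨆ μ : ℂ, H.eigenspace μ = ⊤ := by
  rw [eq_top_iff, ← End.iSup_maxGenEigenspace_eq_top H]
  refine iSup_mono fun μ => ?_
  intro v hv
  obtain ⟨k, hk⟩ := (End.mem_maxGenEigenspace H μ v).1 hv
  rw [End.mem_eigenspace_iff]
  have hT : ∀ x, (H - μ • 1) x = H x - μ • x := fun x => by simp
  induction k with
  | zero =>
    have : v = 0 := by simpa using hk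
    simp [this]
  | succ k ih =>
    rcases k with _ | k
    · simpa [sub_eq_zero] using hk
    · apply ih
      rw [pow_succ', Module.End.mul_apply, pow_succ', Module.End.mul_apply] at hk
      rw [pow_succ', Module.End.mul_apply]
      rw [hT, hT, sub_eq_zero] at hk
      rw [hT, sub_eq_zero]
      exact t.semisimple μ _ hk

theorem iSup_eigenspace [FiniteDimensional ℂ V] (t : SlTwoRep E F H) :
    ⨆ i : ℤ, H.eigenspace (i : ℂ) = ⊤ := by
  rw [eq_top_iff, ← t.iSup_eigenspace_complex]
  refine iSup_le fun μ => ?_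
  by_cases h : H.eigenspace μ = ⊥
  · rw [h]; exact bot_le
  · obtain ⟨v, hv, hv0⟩ := Submodule.exists_mem_ne_zero_of_ne_bot h
    obtain ⟨i, rfl⟩ := t.eigenvalue_int hv0 (End.mem_eigenspace_iff.1 hv)
    exact le_iSup (fun i : ℤ => H.eigenspace (i : ℂ)) i

end SlTwoRep

theorem sum_Icc_neg_eq {M : Type*} [AddCommMonoid M] (f : ℤ → M) (N : ℕ) :
    ∑ i ∈ Finset.Icc (-N : ℤ) N, f i
      = f 0 + ∑ n ∈ Finset.range N, (f ((n : ℤ) + 1) + f (-((n : ℤ) + 1))) := by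
  induction N with
  | zero => simp
  | succ N ih =>
    have h1 : Finset.Icc (-((N + 1 : ℕ) : ℤ)) ((N + 1 : ℕ) : ℤ)
        = insert ((N : ℤ) + 1) (insert (-((N : ℤ) + 1)) (Finset.Icc (-N : ℤ) N)) := by
      ext x; simp only [Finset.mem_Icc, Finset.mem_insert]; omega
    rw [h1, Finset.sum_insert, Finset.sum_insert, ih, Finset.sum_range_succ]
    · abel
    · simp
    · simp; omega

theorem finrank_eigenspace_restrict {V : Type*} [AddCommGroup V] [Module ℂ V]
    (p : Submodule ℂ V) (T : End ℂ V) (h : ∀ x ∈ p, T x ∈ p) (μ : ℂ) :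
    finrank ℂ (End.eigenspace (T.restrict h) μ) = finrank ℂ (p ⊓ T.eigenspace μ : Submodule ℂ V)
        := by
  rw [← Submodule.finrank_map_subtype_eq, End.eigenspace, End.genEigenspace_restrict,
    Submodule.map_comap_subtype]

namespace SlTwoRep

variable {V : Type*} [AddCommGroup V] [Module ℂ V] {E F H : End ℂ V} [FiniteDimensional ℂ V]

theorem finrank_ker_inf_eigenspace (t : SlTwoRep E F H) {i : ℤ} (hi : -1 ≤ i) :
    finrank ℂ (LinearMap.ker E ⊓ H.eigenspace (i : ℂ) : Submodule ℂ V)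
      + finrank ℂ (H.eigenspace ((i + 2 : ℤ) : ℂ)) = finrank ℂ (H.eigenspace (i : ℂ)) := by
  have h1 := LinearMap.finrank_range_add_finrank_ker (E.domRestrict (H.eigenspace (i : ℂ)))
  have h2 : LinearMap.range (E.domRestrict (H.eigenspace (i : ℂ)))
      = H.eigenspace ((i + 2 : ℤ) : ℂ) := by
    ext w
    rw [LinearMap.mem_range]
    constructor
    · rintro ⟨⟨u, hu⟩, rfl⟩
      rw [End.mem_eigenspace_iff] at hu ⊢
      rw [LinearMap.domRestrict_apply, t.lie_h_e, hu, map_smul]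
      push_cast
      module
    · intro hw
      obtain ⟨u, hu, rfl⟩ := t.e_surjective hi (End.mem_eigenspace_iff.1 hw)
      exact ⟨⟨u, End.mem_eigenspace_iff.2 hu⟩, rfl⟩
  rw [h2, LinearMap.ker_domRestrict, ← Submodule.finrank_map_subtype_eq _ (Submodule.comap _ _),
    Submodule.map_comap_subtype, inf_comm] at h1
  omega

theorem finrank_ker (t : SlTwoRep E F H) :
    finrank ℂ (LinearMap.ker E)
      = finrank ℂ (H.eigenspace 0) + finrank ℂ (H.eigenspace 1) := by
  have hst : ∀ x ∈ LinearMap.ker E, H x ∈ LinearMap.ker E := by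
    intro x hx
    rw [LinearMap.mem_ker] at hx ⊢
    have := t.lie_h_e x
    rw [hx] at this
    simpa using this.symm
  have htop : ⨆ i : ℤ, End.eigenspace (H.restrict hst) (i : ℂ) = ⊤ := by
    have h1 : ⨆ μ : ℂ, End.eigenspace (H.restrict hst) μ = ⊤ :=
      Module.End.genEigenspace_restrict_eq_top hst t.iSup_eigenspace_complex
    rw [eq_top_iff, ← h1]
    refine iSup_le fun μ => ?_
    by_cases h : End.eigenspace (H.restrict hst) μ = ⊥
    · rw [h]; exact bot_le
    · obtain ⟨v, hv, hv0⟩ := Submodule.exists_mem_ne_zero_of_ne_bot h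
      obtain ⟨i, rfl⟩ := t.eigenvalue_int (v := v) (by simpa using hv0)
        (congrArg Subtype.val (End.mem_eigenspace_iff.1 hv))
      exact le_iSup (fun i : ℤ => End.eigenspace (H.restrict hst) (i : ℂ)) i
  obtain ⟨N, hN⟩ : ∃ N : ℕ, ∀ i : ℤ, H.eigenspace (i : ℂ) ≠ ⊥ → |i| ≤ N := by
    obtain ⟨N, hN⟩ := ((finite_int_eigenvalue H).image (fun i : ℤ => i.natAbs)).bddAbove
    refine ⟨N, fun i hi => ?_⟩
    have : i.natAbs ≤ N := hN ⟨i, hi, rfl⟩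
    rw [Int.abs_eq_natAbs]
    exact_mod_cast this
  have hN' : ∀ i : ℤ, End.eigenspace (H.restrict hst) (i : ℂ) ≠ ⊥ → |i| ≤ N := by
    intro i hi
    apply hN
    intro hb
    apply hi
    rw [← Submodule.finrank_eq_zero (R := ℂ), finrank_eigenspace_restrict, hb]
    simp
  rw [finrank_eq_sum htop N hN', sum_Icc_neg_eq]
  simp only [finrank_eigenspace_restrict]
  have hneg : ∀ n : ℕ, finrank ℂ (LinearMap.ker E ⊓ H.eigenspace (((-((n : ℤ) + 1) : ℤ)) : ℂ) :
      Submodule ℂ V) = 0 := by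
    intro n
    rw [Submodule.finrank_eq_zero, eq_bot_iff]
    rintro x ⟨hx, hx'⟩
    exact t.e_injective (by omega) hx (End.mem_eigenspace_iff.1 hx')
  simp only [hneg, add_zero]
  have hd : ∀ i : ℤ, N < i → finrank ℂ (H.eigenspace (i : ℂ)) = 0 := by
    intro i hi
    by_contra h
    have := hN i (fun hb => h (by rw [hb]; simp))
    have := abs_le.1 this
    omega
  have hsum : ∀ m : ℕ, finrank ℂ (LinearMap.ker E ⊓ H.eigenspace ((0 : ℤ) : ℂ) : Submodule ℂ V)
      + ∑ n ∈ Finset.range m,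
        finrank ℂ (LinearMap.ker E ⊓ H.eigenspace (((n : ℤ) + 1 : ℤ) : ℂ) : Submodule ℂ V)
      + finrank ℂ (H.eigenspace (((m : ℤ) + 1 : ℤ) : ℂ))
      + finrank ℂ (H.eigenspace (((m : ℤ) + 2 : ℤ) : ℂ))
      = finrank ℂ (H.eigenspace 0) + finrank ℂ (H.eigenspace 1) := by
    intro m
    induction m with
    | zero =>
      have := t.finrank_ker_inf_eigenspace (i := 0) (by norm_num)
      rw [zero_add, Int.cast_zero] at this
      rw [Nat.cast_zero, zero_add, zero_add, Int.cast_one, Int.cast_zero, Finset.range_zero,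
        Finset.sum_empty]
      omega
    | succ m ih =>
      have := t.finrank_ker_inf_eigenspace (i := (m : ℤ) + 1) (by omega)
      rw [Finset.sum_range_succ, ← ih]
      have e1 : ((m + 1 : ℕ) : ℤ) + 1 = m + 2 := by push_cast; ring
      have e2 : ((m + 1 : ℕ) : ℤ) + 2 = m + 1 + 2 := by push_cast; ring
      rw [e1, e2]
      omega
  have h3 := hsum N
  rw [hd (N + 1) (by omega), hd (N + 2) (by omega)] at h3
  simpa using h3

end SlTwoRep

section Nilpotent

variable {V : Type*} [AddCommGroup V] [Module ℂ V]

theorem isNilpotent_commutator {E Z : End ℂ V} (hE : IsNilpotent E)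
    (hZ : E * (E * Z - Z * E) = (E * Z - Z * E) * E) : IsNilpotent (E * Z - Z * E) := by
  set C := E * Z - Z * E with hC
  let D : End ℂ (End ℂ V) := LinearMap.mulLeft ℂ E - LinearMap.mulRight ℂ E
  have hD : IsNilpotent D := by
    refine Commute.isNilpotent_sub ?_ ?_ ?_
    · exact LinearMap.ext fun X => by simp [mul_assoc]
    · exact (LinearMap.isNilpotent_mulLeft_iff ℂ E).2 hE
    · exact (LinearMap.isNilpotent_mulRight_iff ℂ E).2 hE
  have hDa : ∀ X, D X = E * X - X * E := fun X => rfl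
  have hDZ : D Z = C := rfl
  have hDC : D C = 0 := by rw [hDa, hZ, sub_self]
  have hmul : ∀ X Y, D (X * Y) = D X * Y + X * D Y := fun X Y => by
    simp only [hDa]; noncomm_ring
  have hpowC : ∀ (m : ℕ) X, (D ^ m) (X * C) = (D ^ m) X * C := by
    intro m X
    induction m with
    | zero => simp
    | succ m ih => rw [pow_succ', Module.End.mul_apply, ih, hmul, hDC, mul_zero, add_zero,
        Module.End.mul_apply]
  have hpow : ∀ (m : ℕ) X, (D ^ (m + 1)) (X * Z)
      = (D ^ (m + 1)) X * Z + (m + 1 : ℂ) • ((D ^ m) X * C) := by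
    intro m X
    induction m with
    | zero => simp [hmul, hDZ]
    | succ m ih =>
      rw [pow_succ', Module.End.mul_apply, ih, map_add, map_smul, hmul, hDZ, hmul, hDC,
        ← Module.End.mul_apply D, ← Module.End.mul_apply D, ← pow_succ', ← pow_succ', mul_zero]
      push_cast
      module
  have key : ∀ n : ℕ, (D ^ n) (Z ^ n) = (n.factorial : ℂ) • C ^ n ∧ (D ^ (n + 1)) (Z ^ n) = 0 := by
    intro n
    induction n with
    | zero => simp [hDa]
    | succ n ih =>
      constructor
      · rw [pow_succ Z, hpow, ih.1, ih.2, zero_mul, zero_add, smul_mul_assoc, ← pow_succ, smul_smul,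
          Nat.factorial_succ]
        push_cast
        rfl
      · rw [pow_succ Z, hpow, ih.2, pow_succ', Module.End.mul_apply, ih.2]
        simp
  obtain ⟨n, hn⟩ := hD
  refine ⟨n, ?_⟩
  have := (key n).1
  rw [hn, LinearMap.zero_apply, eq_comm, smul_eq_zero] at this
  exact this.resolve_left (by exact_mod_cast n.factorial_ne_zero)

theorem isNilpotent_mul_of_commutator {E Z : End ℂ V} (hE : IsNilpotent E)
    (hZ : E * (E * Z - Z * E) = (E * Z - Z * E) * E) : IsNilpotent (E * Z) := by
  obtain ⟨M, hM⟩ := isNilpotent_commutator hE hZ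
  set C := E * Z - Z * E with hC
  have hpow : ∀ k : ℕ, E ^ (k + 1) * Z = Z * E ^ (k + 1) + (k + 1 : ℂ) • (C * E ^ k) := by
    intro k
    induction k with
    | zero => simp [hC]
    | succ k ih =>
      have h1 : ∀ X, E * (Z * X) = Z * (E * X) + C * X := fun X => by rw [hC]; noncomm_ring
      have h2 : ∀ X, E * (C * X) = C * (E * X) := fun X => by rw [← mul_assoc, hZ, mul_assoc]
      rw [pow_succ', mul_assoc, ih, mul_add, h1, mul_smul_comm, h2, ← pow_succ', ← pow_succ']
      push_cast
      module
  have step : ∀ (k : ℕ) (v : V), (E ^ (k + 1)) v = 0 → ∀ j : ℕ,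
      (E ^ (k + 1)) (((E * Z) ^ j) v) = 0 ∧
      (E ^ k) (((E * Z) ^ j) v) = ((k + 1 : ℂ) ^ j) • (C ^ j) ((E ^ k) v) := by
    intro k v hv j
    induction j with
    | zero => simp [hv]
    | succ j ih =>
      have e1 : ∀ (m : ℕ) x, (E ^ m) ((E * Z) x)
          = Z ((E ^ (m + 1)) x) + (m + 1 : ℂ) • C ((E ^ m) x) := by
        intro m x
        have := congrArg (fun T : End ℂ V => T x) (hpow m)
        simp only [Module.End.mul_apply, LinearMap.add_apply, LinearMap.smul_apply] at this
        rw [← this, pow_succ, Module.End.mul_apply, Module.End.mul_apply]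
      rw [pow_succ' (E * Z), Module.End.mul_apply]
      constructor
      · rw [e1, pow_succ' E, Module.End.mul_apply, ih.1]; simp
      · rw [e1, ih.1, ih.2, map_zero, zero_add, map_smul, smul_smul, pow_succ' C,
          Module.End.mul_apply, pow_succ']
  have hker : ∀ (k : ℕ) (v : V), (E ^ k) v = 0 → ((E * Z) ^ (M * k)) v = 0 := by
    intro k
    induction k with
    | zero => intro v hv; simpa using hv
    | succ k ih =>
      intro v hv
      rw [mul_add, mul_one, pow_add, Module.End.mul_apply]
      apply ih
      rw [(step k v hv M).2, hM]
      simp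
  obtain ⟨n, hn⟩ := hE
  exact ⟨M * n, LinearMap.ext fun v => hker n v (by simp [hn])⟩

theorem eq_zero_of_eigenvalue_neg_two {E H F : End ℂ V} (hE : IsNilpotent E)
    (hHE : ∀ v, H (E v) = E (H v) + (2 : ℂ) • E v) (hEF : ∀ v, E (F v) = F (E v) + H v)
    {v : V} (hv : E v = 0) (hHv : H v = -(2 : ℂ) • v) : v = 0 := by
  have hHEn : ∀ (n : ℕ) v, H ((E ^ n) v) = (E ^ n) (H v) + (2 * n : ℂ) • (E ^ n) v := by
    intro n v
    induction n with
    | zero => simp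
    | succ n ih =>
      rw [pow_succ', Module.End.mul_apply, hHE, ih, map_add, map_smul, Module.End.mul_apply]
      push_cast
      module
  have hpow : ∀ (n : ℕ) u, (E ^ (n + 1)) (F u)
      = F ((E ^ (n + 1)) u) + (n + 1 : ℂ) • (H ((E ^ n) u) - (n : ℂ) • (E ^ n) u) := by
    intro n u
    induction n with
    | zero => simp [hEF]
    | succ n ih =>
      have h3 := hHE ((E ^ n) u)
      have h4 : ∀ (m : ℕ) x, (E ^ (m + 1)) x = E ((E ^ m) x) := fun m x => by
        rw [pow_succ', Module.End.mul_apply]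
      rw [h4, ih, map_add, hEF, map_smul, map_sub, map_smul, ← h4, h4 n, h3]
      push_cast
      module
  by_contra hv0
  have hmem : ∀ k : ℕ, v ∈ LinearMap.range (E ^ k) := by
    intro k
    induction k with
    | zero => exact ⟨v, by simp⟩
    | succ k ih =>
      obtain ⟨u, rfl⟩ := ih
      have := hpow k u
      rw [pow_succ', Module.End.mul_apply, Module.End.mul_apply, hv, map_zero, zero_add, hHv,
        ← sub_smul, smul_smul] at this
      have hne : ((k : ℂ) + 1) * (-2 - k) ≠ 0 := by
        have : ((k : ℂ) + 1) * (-2 - k) = -(((k + 1) * (k + 2) : ℕ) : ℂ) := by push_cast; ring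
        rw [this, neg_ne_zero]
        exact_mod_cast (by positivity : (k + 1) * (k + 2) ≠ 0)
      rw [← Module.End.mul_apply, ← pow_succ'] at this
      refine ⟨(((k : ℂ) + 1) * (-2 - k))⁻¹ • F u, ?_⟩
      rw [map_smul, this, smul_smul, inv_mul_cancel₀ hne, one_smul]
  obtain ⟨n, hn⟩ := hE
  obtain ⟨u, hu⟩ := hmem n
  rw [hn] at hu
  exact hv0 (by simpa using hu.symm)

end Nilpotent

section Killing

variable {L : Type*} [LieRing L] [LieAlgebra ℂ L]

theorem ad_lie_eq (x y : L) : LieAlgebra.ad ℂ L ⁅x, y⁆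
    = LieAlgebra.ad ℂ L x * LieAlgebra.ad ℂ L y - LieAlgebra.ad ℂ L y * LieAlgebra.ad ℂ L x :=
  LinearMap.ext fun z => lie_lie x y z

local notation "κ" => killingForm ℂ L

theorem killing_lie (x y z : L) : κ ⁅x, y⁆ z = κ x ⁅y, z⁆ :=
  LieModule.traceForm_apply_lie_apply ℂ L L x y z

theorem killing_comm (x y : L) : κ x y = κ y x := LieModule.traceForm_comm ℂ L L x y

theorem killing_lie' (x y z : L) : κ ⁅x, y⁆ z = -κ y ⁅x, z⁆ := by
  rw [← lie_skew, map_neg, LinearMap.neg_apply, killing_lie]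

variable [LieAlgebra.IsKilling ℂ L]

theorem eq_zero_of_killing {x : L} (h : ∀ y, κ x y = 0) : x = 0 :=
  (LieAlgebra.IsKilling.killingForm_nondegenerate ℂ L).1 x h

variable [FiniteDimensional ℂ L]

theorem mem_of_killing (p : Submodule ℂ L) (w : L)
    (h : ∀ z, (∀ x ∈ p, κ z x = 0) → κ z w = 0) : w ∈ p := by
  by_contra hw
  obtain ⟨φ, hφ, hp⟩ := Submodule.exists_dual_map_eq_bot_of_notMem hw inferInstance
  obtain ⟨z, rfl⟩ : ∃ z, κ z = φ := by
    have hinj : Function.Injective (κ : L →ₗ[ℂ] Dual ℂ L) := by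
      rw [← LinearMap.ker_eq_bot, LinearMap.ker_eq_bot']
      intro x hx
      exact eq_zero_of_killing fun y => by rw [hx]; rfl
    have hdim : finrank ℂ L = finrank ℂ (Dual ℂ L) := (Subspace.dual_finrank_eq).symm
    exact (LinearMap.injective_iff_surjective_of_finrank_eq_finrank hdim).1 hinj φ
  refine hφ (h z fun x hx => ?_)
  have : κ z x ∈ p.map (κ z) := ⟨x, hx, rfl⟩
  rw [hp] at this
  simpa using this

theorem jacobson_morozov {e : L} (he : e ≠ 0) (hnil : IsNilpotent (LieAlgebra.ad ℂ L e)) :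
    ∃ h f : L, IsSl2Triple h e f := by
  obtain ⟨w, hw⟩ : e ∈ LinearMap.range (LieAlgebra.ad ℂ L e ^ 2) := by
    refine mem_of_killing _ _ fun z hz => ?_
    have hz0 : ⁅e, ⁅e, z⁆⁆ = 0 := eq_zero_of_killing fun y => by
      have := hz _ ⟨y, rfl⟩
      rw [pow_two, Module.End.mul_apply, LieAlgebra.ad_apply, LieAlgebra.ad_apply] at this
      rw [killing_lie', killing_lie', neg_neg, this]
    have hcomm : LieAlgebra.ad ℂ L e * LieAlgebra.ad ℂ L ⁅e, z⁆
        = LieAlgebra.ad ℂ L ⁅e, z⁆ * LieAlgebra.ad ℂ L e := by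
      rw [← sub_eq_zero]
      have : LieAlgebra.ad ℂ L ⁅e, ⁅e, z⁆⁆ = 0 := by rw [hz0, map_zero]
      rwa [ad_lie_eq e ⁅e, z⁆] at this
    rw [ad_lie_eq] at hcomm
    have h1 := isNilpotent_mul_of_commutator hnil hcomm
    have h2 := LinearMap.isNilpotent_trace_of_isNilpotent h1
    rw [killing_comm, killingForm_apply_apply]
    exact h2.eq_zero
  rw [pow_two, Module.End.mul_apply, LieAlgebra.ad_apply, LieAlgebra.ad_apply] at hw
  set h : L := -(2 : ℂ) • ⁅e, w⁆ with hh
  set f₀ : L := -(2 : ℂ) • w with hf₀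
  have hhe : ⁅h, e⁆ = (2 : ℂ) • e := by
    rw [hh, smul_lie, ← lie_skew, hw]; module
  have hef : ⁅e, f₀⁆ = h := by rw [hf₀, lie_smul]
  clear_value h f₀
  have hHE : ∀ v : L, ⁅h, ⁅e, v⁆⁆ = ⁅e, ⁅h, v⁆⁆ + (2 : ℂ) • ⁅e, v⁆ := fun v => by
    rw [leibniz_lie h, hhe, smul_lie, add_comm]
  have hEF : ∀ v : L, ⁅e, ⁅f₀, v⁆⁆ = ⁅f₀, ⁅e, v⁆⁆ + ⁅h, v⁆ := fun v => by
    rw [leibniz_lie e, hef, add_comm]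
  set g₀ := ⁅h, f₀⁆ + (2 : ℂ) • f₀ with hg₀
  have hg : ⁅e, g₀⁆ = 0 := by
    rw [hg₀, lie_add, lie_smul, hef, leibniz_lie e, hef, lie_self, ← lie_skew e h, hhe,
      neg_lie, smul_lie, hef]
    module
  let T : End ℂ L := LieAlgebra.ad ℂ L h + (2 : ℂ) • 1
  have hT : ∀ x ∈ LinearMap.ker (LieAlgebra.ad ℂ L e), T x ∈ LinearMap.ker (LieAlgebra.ad ℂ L e)
      := by
    intro x hx
    rw [LinearMap.mem_ker, LieAlgebra.ad_apply] at hx ⊢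
    have := hHE x
    rw [hx] at this
    simp only [T, LinearMap.add_apply, LieAlgebra.ad_apply, LinearMap.smul_apply,
      Module.End.one_apply, lie_add, lie_smul, hx]
    simpa using this.symm
  have hinj : Function.Injective (T.restrict hT) := by
    rw [← LinearMap.ker_eq_bot, LinearMap.ker_eq_bot']
    rintro ⟨x, hx⟩ h0
    have h1 : ⁅h, x⁆ + (2 : ℂ) • x = 0 := congrArg Subtype.val h0
    have : x = 0 := eq_zero_of_eigenvalue_neg_two (E := LieAlgebra.ad ℂ L e)
      (H := LieAlgebra.ad ℂ L h) (F := LieAlgebra.ad ℂ L f₀) hnil hHE hEF hx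
      (by rw [LieAlgebra.ad_apply, eq_neg_of_add_eq_zero_left h1]; module)
    simpa using this
  obtain ⟨⟨c, hc⟩, hc'⟩ := LinearMap.injective_iff_surjective.1 hinj ⟨g₀, hg⟩
  replace hc' : ⁅h, c⁆ + (2 : ℂ) • c = g₀ := congrArg Subtype.val hc'
  refine ⟨h, f₀ - c, ?_, ?_, ?_, ?_⟩
  · intro h0
    rw [h0, zero_lie, eq_comm, smul_eq_zero] at hhe
    exact he (hhe.resolve_left two_ne_zero)
  · rw [lie_sub, hef, show ⁅e, c⁆ = 0 from hc, sub_zero]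
  · rw [hhe, two_smul, two_nsmul]
  · rw [lie_sub, eq_sub_of_add_eq hc', eq_sub_of_add_eq hg₀.symm]
    rw [← Nat.cast_smul_eq_nsmul ℂ]
    push_cast
    module

end Killing

theorem weight_multiplicities_aux (a b : ℤ) (ha : 0 ≤ a) (ha' : a ≤ 26) (hb : 0 ≤ b) (hb' : b ≤ 1)
    (h : 27 * (54 - 2 * (a + b) + (16 * a + 81 * b)) = (54 - 2 * (a + b) + (4 * a + 9 * b)) ^ 2) :
    b = 1 ∧ a = 1 := by
  interval_cases b <;> interval_cases a <;> omega

theorem weight_multiplicities (N : ℕ) (d : ℕ → ℕ) (hbig : ∀ n, N < n → d n = 0)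
    (h1 : d 0 + d 1 = 79) (h2 : d 0 + ∑ n ∈ Finset.range N, 2 * d (n + 1) = 133)
    (h3 : 54 * ∑ n ∈ Finset.range N, 2 * ((n : ℤ) + 1) ^ 4 * d (n + 1)
      = (∑ n ∈ Finset.range N, 2 * ((n : ℤ) + 1) ^ 2 * d (n + 1)) ^ 2) (h4 : 1 ≤ d 2) :
    (d 0 = 79 ∧ d 1 = 0 ∧ d 2 = 27 ∧ ∀ n, 2 < n → d n = 0) ∨
      (d 0 = 29 ∧ d 1 = 50 ∧ d 2 = 1 ∧ d 3 = 1 ∧ ∀ n, 3 < n → d n = 0) := by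
  obtain ⟨M, rfl⟩ : ∃ M, N = M + 1 := ⟨N - 1, by
    have : ¬ N < 2 := fun h => by have := hbig 2 h; omega
    omega⟩
  rw [Finset.sum_range_succ'] at h2
  rw [Finset.sum_range_succ', Finset.sum_range_succ'] at h3
  set D : ℤ := ∑ n ∈ Finset.range M, (d (n + 2) : ℤ) with hD
  set B : ℤ := ∑ n ∈ Finset.range M, ((n : ℤ) + 2) ^ 2 * d (n + 2) with hB
  set Q : ℤ := ∑ n ∈ Finset.range M, ((n : ℤ) + 2) ^ 4 * d (n + 2) with hQ
  have e2 : (d 1 : ℤ) + 2 * D = 54 := by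
    have : (d 0 : ℤ) + (2 * D + 2 * d 1) = 133 := by
      rw [hD, Finset.mul_sum]
      exact_mod_cast h2
    have : (d 0 : ℤ) + d 1 = 79 := by exact_mod_cast h1
    linarith
  have e3 : 27 * ((d 1 : ℤ) + Q) = (d 1 + B) ^ 2 := by
    have hQ' : ∑ n ∈ Finset.range M, 2 * (((n + 1 : ℕ) : ℤ) + 1) ^ 4 * (d (n + 1 + 1) : ℤ) = 2 *
        Q := by
      rw [hQ, Finset.mul_sum]
      refine Finset.sum_congr rfl fun n _ => ?_
      push_cast; ring
    have hB' : ∑ n ∈ Finset.range M, 2 * (((n + 1 : ℕ) : ℤ) + 1) ^ 2 * (d (n + 1 + 1) : ℤ) = 2 *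
        B := by
      rw [hB, Finset.mul_sum]
      refine Finset.sum_congr rfl fun n _ => ?_
      push_cast; ring
    rw [hQ', hB'] at h3
    norm_num at h3
    linarith
  have hvar : ∑ n ∈ Finset.range M, (d (n + 2) : ℤ) * (D * ((n : ℤ) + 2) ^ 2 - B) ^ 2
      = D * (D * Q - B ^ 2) := by
    have : ∀ n : ℕ, (d (n + 2) : ℤ) * (D * ((n : ℤ) + 2) ^ 2 - B) ^ 2
        = D ^ 2 * (((n : ℤ) + 2) ^ 4 * d (n + 2)) - 2 * D * B * (((n : ℤ) + 2) ^ 2 * d (n + 2))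
          + B ^ 2 * d (n + 2) := fun n => by ring
    simp_rw [this]
    rw [Finset.sum_add_distrib, Finset.sum_sub_distrib, ← Finset.mul_sum, ← Finset.mul_sum,
      ← Finset.mul_sum, ← hD, ← hB, ← hQ]
    ring
  have hM : 0 < M := by
    by_contra h
    have := hbig 2 (by omega)
    omega
  have hDpos : 0 < D := by
    have : (d 2 : ℤ) ≤ D := by
      have := Finset.single_le_sum (f := fun n : ℕ => (d (n + 2) : ℤ)) (s := Finset.range M)
        (fun i _ => by positivity) (Finset.mem_range.2 hM)
      simpa using this
    omega
  have htail : ∀ n, M ≤ n → d (n + 2) = 0 := fun n hn => hbig _ (by omega)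
  rcases Nat.eq_zero_or_pos (d 1) with h0 | hpos
  · left
    have hD27 : D = 27 := by rw [h0] at e2; push_cast at e2; linarith
    have hz : ∑ n ∈ Finset.range M, (d (n + 2) : ℤ) * (D * ((n : ℤ) + 2) ^ 2 - B) ^ 2 = 0 := by
      rw [hvar, hD27]
      rw [h0] at e3
      push_cast at e3
      linarith
    rw [Finset.sum_eq_zero_iff_of_nonneg (fun i _ => by positivity)] at hz
    have hB2 : B = 108 := by
      have := hz 0 (Finset.mem_range.2 hM)
      rw [mul_eq_zero] at this
      rcases this with h | h
      · simp at h; omega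
      · rw [hD27] at h
        have := pow_eq_zero_iff (two_ne_zero) |>.1 h
        push_cast at this
        linarith
    have hrest : ∀ n, 0 < n → d (n + 2) = 0 := by
      intro n hn
      by_cases hnM : M ≤ n
      · exact htail n hnM
      have := hz n (Finset.mem_range.2 (by omega))
      rw [mul_eq_zero] at this
      rcases this with h | h
      · exact_mod_cast h
      · exfalso
        rw [hD27, hB2] at h
        have := pow_eq_zero_iff (two_ne_zero) |>.1 h
        have hn' : (1 : ℤ) ≤ n := by exact_mod_cast hn
        nlinarith
    have hD2 : D = d 2 := by
      rw [hD, Finset.sum_eq_single 0]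
      · intro b _ hb
        rw [hrest b (by omega)]; rfl
      · intro h; simp at h; omega
    refine ⟨by omega, h0, by omega, fun n hn => ?_⟩
    obtain ⟨m, rfl⟩ : ∃ m, n = m + 2 := ⟨n - 2, by omega⟩
    exact hrest m (by omega)
  · right
    have hCS : 0 ≤ D * Q - B ^ 2 := by
      have : 0 ≤ D * (D * Q - B ^ 2) := by
        rw [← hvar]
        exact Finset.sum_nonneg fun i _ => by positivity
      exact nonneg_of_mul_nonneg_right this hDpos
    have hpos' : (0 : ℤ) < d 1 := by exact_mod_cast hpos
    have key : Q - 4 * B ≤ 2 * d 1 - 54 := by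
      set a : ℤ := (d 1 : ℤ) with ha
      have hDe : 2 * D = 54 - a := by linarith
      have hQe : 27 * Q = (a + B) ^ 2 - 27 * a := by linarith
      have h5 : 0 ≤ a * (54 * (2 * B + a - 27) - (a + B) ^ 2 + 27 * a) := by
        have : 0 ≤ 54 * (D * Q - B ^ 2) := by positivity
        have e : 54 * (D * Q - B ^ 2) = (2 * D) * (27 * Q) - 54 * B ^ 2 := by ring
        rw [e, hDe, hQe] at this
        linarith
      have h6 := nonneg_of_mul_nonneg_right h5 hpos'
      nlinarith
    have hd1 : (d 1 : ℤ) ≤ 54 := by linarith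
    have hdiff : ∑ n ∈ Finset.range M,
        (((n : ℤ) + 2) ^ 2 * (((n : ℤ) + 2) ^ 2 - 4) * d (n + 2)) = Q - 4 * B := by
      rw [hQ, hB, Finset.mul_sum, ← Finset.sum_sub_distrib]
      exact Finset.sum_congr rfl fun n _ => by ring
    have hsingle : ∀ n, n < M → ((n : ℤ) + 2) ^ 2 * (((n : ℤ) + 2) ^ 2 - 4) * d (n + 2) ≤ 54 := by
      intro n hn
      have := Finset.single_le_sum
        (f := fun n : ℕ => ((n : ℤ) + 2) ^ 2 * (((n : ℤ) + 2) ^ 2 - 4) * d (n + 2))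
        (s := Finset.range M) (fun i _ => by
          have : (0 : ℤ) ≤ ((i : ℤ) + 2) ^ 2 - 4 := by nlinarith [Int.natCast_nonneg i]
          positivity) (Finset.mem_range.2 hn)
      rw [hdiff] at this
      linarith
    have hrest : ∀ n, 1 < n → d (n + 2) = 0 := by
      intro n hn
      by_cases hnM : M ≤ n
      · exact htail n hnM
      have h7 := hsingle n (by omega)
      by_contra hne
      have h8 : (1 : ℤ) ≤ d (n + 2) := by exact_mod_cast Nat.one_le_iff_ne_zero.2 hne
      have hn' : (2 : ℤ) ≤ n := by exact_mod_cast hn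
      have h9 : (192 : ℤ) ≤ ((n : ℤ) + 2) ^ 2 * (((n : ℤ) + 2) ^ 2 - 4) := by
        have : (16 : ℤ) ≤ ((n : ℤ) + 2) ^ 2 := by nlinarith only [hn']
        nlinarith only [this]
      nlinarith only [h7, h8, h9]
    have hd3 : d 3 ≤ 1 := by
      by_cases hM1 : 1 < M
      · have := hsingle 1 hM1
        have h45 : (45 : ℤ) * d 3 ≤ 54 := by
          have e : ((((1 : ℕ) : ℤ) + 2) ^ 2 * ((((1 : ℕ) : ℤ) + 2) ^ 2 - 4)) = 45 := by norm_num
          rw [e] at this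
          exact this
        omega
      · have : d 3 = 0 := htail 1 (by omega)
        omega
    have hsum : ∀ f : ℕ → ℤ, ∑ n ∈ Finset.range M, f n * d (n + 2) = f 0 * d 2 + f 1 * d 3 := by
      intro f
      have hsub : Finset.range M ⊆ Finset.range (M + 2) := by
        intro x; simp only [Finset.mem_range]; omega
      rw [Finset.sum_subset hsub, ← Finset.sum_subset (s₁ := Finset.range 2)]
      · simp [Finset.sum_range_succ]
      · intro x; simp only [Finset.mem_range]; omega
      · intro x _ hx
        rw [hrest x (by simp only [Finset.mem_range] at hx; omega)]; simp
      · intro x _ hx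
        rw [htail x (by simp only [Finset.mem_range] at hx; omega)]; simp
    have hD' : D = d 2 + d 3 := by simpa [hD] using hsum fun _ => 1
    have hB' : B = 4 * d 2 + 9 * d 3 := by
      have := hsum fun n => ((n : ℤ) + 2) ^ 2
      rw [hB, this]; norm_num
    have hQ' : Q = 16 * d 2 + 81 * d 3 := by
      have := hsum fun n => ((n : ℤ) + 2) ^ 4
      rw [hQ, this]; norm_num
    rw [hD'] at e2
    rw [hB', hQ'] at e3
    have hd2 : d 2 ≤ 26 := by omega
    have e1' : (d 1 : ℤ) = 54 - 2 * (d 2 + d 3) := by linarith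
    rw [e1'] at e3
    have : d 3 = 1 ∧ d 2 = 1 := by
      have := weight_multiplicities_aux (d 2) (d 3) (by omega) (by omega) (by omega) (by omega) e3
      omega
    refine ⟨by omega, by omega, this.2, this.1, fun n hn => ?_⟩
    obtain ⟨m, rfl⟩ : ∃ m, n = m + 2 := ⟨n - 2, by omega⟩
    exact hrest m (by omega)

section Grading

variable {L : Type*} [LieRing L] [LieAlgebra ℂ L] [FiniteDimensional ℂ L]

open LieAlgebra

local notation "κ" => killingForm ℂ L

theorem IsSl2Triple.slTwoRep {h e f : L} (t : IsSl2Triple h e f) :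
    SlTwoRep (ad ℂ L e) (ad ℂ L f) (ad ℂ L h) where
  lie_h_e v := by
    simp only [ad_apply]
    rw [leibniz_lie h, t.lie_h_e_smul ℂ, smul_lie, add_comm]
  lie_h_f v := by
    simp only [ad_apply]
    rw [leibniz_lie h, t.lie_lie_smul_f ℂ, neg_lie, smul_lie]
    abel
  lie_e_f v := by
    simp only [ad_apply]
    rw [leibniz_lie e, t.lie_e_f, add_comm]
  nil_e := isNilpotent_of_commutator_eq_smul (ad ℂ L h) _ 2 two_ne_zero (by
    rw [← ad_lie_eq, t.lie_h_e_smul ℂ, map_smul])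
  nil_f := isNilpotent_of_commutator_eq_smul (ad ℂ L h) _ (-2) (by norm_num) (by
    rw [← ad_lie_eq, t.lie_lie_smul_f ℂ, map_neg, map_smul, neg_smul])

omit [FiniteDimensional ℂ L] in
theorem killing_eq_zero_of_eigenvalue {h x y : L} {a b : ℂ} (hx : ⁅h, x⁆ = a • x)
    (hy : ⁅h, y⁆ = b • y) (hab : a + b ≠ 0) : κ x y = 0 := by
  have h1 := killing_lie' h x y
  rw [hx, hy, map_smul, map_smul, LinearMap.smul_apply, smul_eq_mul, smul_eq_mul] at h1
  have h2 : (a + b) * κ x y = 0 := by linear_combination h1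
  exact (mul_eq_zero.1 h2).resolve_left hab

omit [FiniteDimensional ℂ L] in
theorem eigenvalue_lie {h x y : L} {a b : ℂ} (hx : ⁅h, x⁆ = a • x)
    (hy : ⁅h, y⁆ = b • y) : ⁅h, ⁅x, y⁆⁆ = (a + b) • ⁅x, y⁆ := by
  rw [leibniz_lie h, hx, hy, smul_lie, lie_smul, add_smul]

omit [FiniteDimensional ℂ L] in
theorem killing_ext_eigenspace {h : L} (htop : ⨆ i : ℤ, (ad ℂ L h).eigenspace (i : ℂ) = ⊤)
    {x : L} {a : ℤ} (hx : ⁅h, x⁆ = (a : ℂ) • x) [IsKilling ℂ L]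
    (hy : ∀ y, ⁅h, y⁆ = -(a : ℂ) • y → κ x y = 0) : x = 0 := by
  refine eq_zero_of_killing fun y => ?_
  have hle : ⨆ i : ℤ, (ad ℂ L h).eigenspace (i : ℂ) ≤ LinearMap.ker (κ x) := by
    refine iSup_le fun i y hi => ?_
    rw [End.mem_eigenspace_iff, ad_apply] at hi
    by_cases hai : (a : ℂ) + i = 0
    · exact hy y (by rw [hi, eq_neg_of_add_eq_zero_right hai])
    · exact killing_eq_zero_of_eigenvalue hx hi hai
  rw [htop] at hle
  exact hle (Submodule.mem_top (x := y))

theorem finrank_eigenspace_neg_le [IsKilling ℂ L] {h : L}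
    (htop : ⨆ i : ℤ, (ad ℂ L h).eigenspace (i : ℂ) = ⊤) (a : ℤ) :
    finrank ℂ ((ad ℂ L h).eigenspace (a : ℂ)) ≤ finrank ℂ ((ad ℂ L h).eigenspace ((-a : ℤ) : ℂ))
        := by
  rw [← Subspace.dual_finrank_eq (V := ((ad ℂ L h).eigenspace ((-a : ℤ) : ℂ)))]
  let φ : (ad ℂ L h).eigenspace (a : ℂ) →ₗ[ℂ] Dual ℂ ((ad ℂ L h).eigenspace ((-a : ℤ) : ℂ)) :=
    (LinearMap.lcomp ℂ ℂ (Submodule.subtype _)) ∘ₗ κ ∘ₗ Submodule.subtype _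
  refine LinearMap.finrank_le_finrank_of_injective (f := φ) ?_
  rw [← LinearMap.ker_eq_bot, LinearMap.ker_eq_bot']
  rintro ⟨x, hx⟩ h0
  rw [End.mem_eigenspace_iff, ad_apply] at hx
  have : x = 0 := killing_ext_eigenspace htop hx fun y hy => by
    have hy' : y ∈ (ad ℂ L h).eigenspace ((-a : ℤ) : ℂ) := by
      rw [End.mem_eigenspace_iff, ad_apply, hy]; push_cast; rfl
    exact congrArg (fun ψ : Dual ℂ _ => ψ ⟨y, hy'⟩) h0
  simpa using this

theorem finrank_eigenspace_neg [IsKilling ℂ L] {h : L}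
    (htop : ⨆ i : ℤ, (ad ℂ L h).eigenspace (i : ℂ) = ⊤) (a : ℤ) :
    finrank ℂ ((ad ℂ L h).eigenspace ((-a : ℤ) : ℂ)) = finrank ℂ ((ad ℂ L h).eigenspace (a : ℂ))
        := by
  refine le_antisymm ?_ (finrank_eigenspace_neg_le htop a)
  have := finrank_eigenspace_neg_le htop (-a)
  rwa [neg_neg] at this

theorem exists_eigenvalue_bound (H : End ℂ L) :
    ∃ N : ℕ, ∀ i : ℤ, H.eigenspace (i : ℂ) ≠ ⊥ → |i| ≤ N := by
  obtain ⟨N, hN⟩ := ((finite_int_eigenvalue H).image (fun i : ℤ => i.natAbs)).bddAbove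
  refine ⟨N, fun i hi => ?_⟩
  have : i.natAbs ≤ N := hN ⟨i, hi, rfl⟩
  rw [Int.abs_eq_natAbs]
  exact_mod_cast this

theorem IsSl2Triple.exists_killing_eq {h e f : L} (t : IsSl2Triple h e f) :
    ∃ n : ℕ, κ h h = n := by
  obtain ⟨N, hN⟩ := exists_eigenvalue_bound (ad ℂ L h)
  have h1 := trace_pow_eq_sum t.slTwoRep.iSup_eigenspace N hN 2
  refine ⟨∑ i ∈ Finset.Icc (-N : ℤ) N,
    i.natAbs ^ 2 * finrank ℂ ((ad ℂ L h).eigenspace (i : ℂ)), ?_⟩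
  rw [killingForm_apply_apply, ← Module.End.mul_eq_comp, ← pow_two, h1]
  push_cast
  refine Finset.sum_congr rfl fun i _ => ?_
  congr 1
  rw [← Int.cast_natCast, ← Int.cast_pow, ← Int.cast_pow, Int.natAbs_sq]

theorem IsSl2Triple.trace_pow [IsKilling ℂ L] {h e f : L} (t : IsSl2Triple h e f) (N : ℕ)
    (hN : ∀ i : ℤ, (ad ℂ L h).eigenspace (i : ℂ) ≠ ⊥ → |i| ≤ N)
    (d : ℕ → ℕ) (hd : ∀ n, d n = finrank ℂ ((ad ℂ L h).eigenspace (n : ℂ)))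
    (k : ℕ) (hk : Even k) (hk0 : 0 < k) : LinearMap.trace ℂ L (ad ℂ L h ^ k)
      = ((∑ n ∈ Finset.range N, 2 * ((n : ℤ) + 1) ^ k * d (n + 1) : ℤ) : ℂ) := by
  have htop := t.slTwoRep.iSup_eigenspace
  have hpos : ∀ n : ℕ, finrank ℂ ((ad ℂ L h).eigenspace (((n : ℤ) + 1 : ℤ) : ℂ)) = d (n + 1) := by
    intro n; rw [hd]; rfl
  have hneg : ∀ n : ℕ,
      finrank ℂ ((ad ℂ L h).eigenspace ((-((n : ℤ) + 1) : ℤ) : ℂ)) = d (n + 1) := by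
    intro n; rw [finrank_eigenspace_neg htop, hpos]
  rw [trace_pow_eq_sum htop N hN, sum_Icc_neg_eq]
  simp only [hpos, hneg]
  push_cast
  rw [zero_pow hk0.ne', zero_mul, zero_add]
  refine Finset.sum_congr rfl fun n _ => ?_
  rw [hk.neg_pow]
  ring

theorem eigenvalue_bound [IsKilling ℂ L] {h : L}
    (htop : ⨆ i : ℤ, (ad ℂ L h).eigenspace (i : ℂ) = ⊤) (N : ℕ)
    (hN : ∀ n : ℕ, N < n → finrank ℂ ((ad ℂ L h).eigenspace (n : ℂ)) = 0) (i : ℤ)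
    (hi : (ad ℂ L h).eigenspace (i : ℂ) ≠ ⊥) : |i| ≤ N := by
  by_contra hlt
  rw [Int.abs_eq_natAbs] at hlt
  have := hN i.natAbs (by omega)
  apply hi
  rw [← Submodule.finrank_eq_zero (R := ℂ), ← this]
  rcases le_total 0 i with h0 | h0
  · rw [← Int.cast_natCast, Int.natAbs_of_nonneg h0]
  · rw [← Int.cast_natCast, Int.ofNat_natAbs_of_nonpos h0, finrank_eigenspace_neg htop]

theorem IsSl2Triple.killing_self [IsKilling ℂ L] {h e f : L} (t : IsSl2Triple h e f) (N : ℕ)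
    (d : ℕ → ℕ) (hd : ∀ n, d n = finrank ℂ ((ad ℂ L h).eigenspace (n : ℂ)))
    (hN : ∀ n, N < n → d n = 0) :
    κ h h = ((∑ n ∈ Finset.range N, 2 * ((n : ℤ) + 1) ^ 2 * d (n + 1) : ℤ) : ℂ) := by
  rw [killingForm_apply_apply, ← Module.End.mul_eq_comp, ← pow_two]
  exact t.trace_pow N (eigenvalue_bound t.slTwoRep.iSup_eigenspace N
    fun n hn => by rw [← hd, hN n hn]) d hd 2 (by decide) (by norm_num)

theorem IsSl2Triple.finrank_eigenspace [IsKilling ℂ L] {h e f : L} (t : IsSl2Triple h e f)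
    (hdim : finrank ℂ L = 133) (hker : finrank ℂ (LinearMap.ker (ad ℂ L e)) = 79)
    (hq : 54 * LinearMap.trace ℂ L (ad ℂ L h ^ 4) = (LinearMap.trace ℂ L (ad ℂ L h ^ 2)) ^ 2)
    (d : ℕ → ℕ) (hd : ∀ n, d n = finrank ℂ ((ad ℂ L h).eigenspace (n : ℂ))) :
    (d 0 = 79 ∧ d 1 = 0 ∧ d 2 = 27 ∧ ∀ n, 2 < n → d n = 0) ∨
      (d 0 = 29 ∧ d 1 = 50 ∧ d 2 = 1 ∧ d 3 = 1 ∧ ∀ n, 3 < n → d n = 0) := by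
  have htop := t.slTwoRep.iSup_eigenspace
  obtain ⟨N, hN⟩ := exists_eigenvalue_bound (ad ℂ L h)
  have hpos : ∀ n : ℕ, finrank ℂ ((ad ℂ L h).eigenspace (((n : ℤ) + 1 : ℤ) : ℂ)) = d (n + 1) := by
    intro n; rw [hd]; rfl
  have hneg : ∀ n : ℕ,
      finrank ℂ ((ad ℂ L h).eigenspace ((-((n : ℤ) + 1) : ℤ) : ℂ)) = d (n + 1) := by
    intro n; rw [finrank_eigenspace_neg htop, hpos]
  have htr := t.trace_pow N hN d hd
  refine weight_multiplicities N d ?_ ?_ ?_ ?_ ?_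
  · intro n hn
    rw [hd]
    by_contra h0
    have := hN n (fun hb => h0 (by
      rw [Int.cast_natCast] at hb
      rw [hb]; simp))
    rw [abs_of_nonneg (by positivity)] at this
    omega
  · rw [hd, hd, ← hker, t.slTwoRep.finrank_ker]
    rw [Nat.cast_zero, Nat.cast_one]
  · rw [← hdim, finrank_eq_sum htop N hN, sum_Icc_neg_eq]
    simp only [hpos, hneg]
    rw [hd 0, Nat.cast_zero, Int.cast_zero]
    simp only [two_mul]
  · rw [htr 4 (by decide) (by norm_num), htr 2 (by decide) (by norm_num)] at hq
    exact_mod_cast hq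
  · rw [hd, Nat.one_le_iff_ne_zero]
    intro h0
    rw [Submodule.finrank_eq_zero] at h0
    have : e ∈ (ad ℂ L h).eigenspace ((2 : ℕ) : ℂ) := by
      rw [End.mem_eigenspace_iff, ad_apply, t.lie_h_e_smul ℂ]; norm_num
    rw [h0] at this
    exact t.e_ne_zero (by simpa using this)

end Grading

section Quartic

variable {L : Type*} [LieRing L] [LieAlgebra ℂ L]

open LieAlgebra

local notation "κ" => killingForm ℂ L
local notation "tr" => LinearMap.trace ℂ L

/-- The symmetrised trace of a product of four adjoint endomorphisms, corrected by the Killing form;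
it vanishes identically in type `E₇`. -/
noncomputable def quarticDefect (a b c d : L) : ℂ :=
  27 * (tr (ad ℂ L a * ad ℂ L b * ad ℂ L c * ad ℂ L d) +
    tr (ad ℂ L a * ad ℂ L b * ad ℂ L d * ad ℂ L c) +
    tr (ad ℂ L a * ad ℂ L c * ad ℂ L b * ad ℂ L d) +
    tr (ad ℂ L a * ad ℂ L c * ad ℂ L d * ad ℂ L b) +
    tr (ad ℂ L a * ad ℂ L d * ad ℂ L b * ad ℂ L c) +
    tr (ad ℂ L a * ad ℂ L d * ad ℂ L c * ad ℂ L b)) -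
  (κ a b * κ c d + κ a c * κ b d + κ a d * κ b c)

theorem killing_eq_trace (a b : L) : κ a b = tr (ad ℂ L a * ad ℂ L b) := rfl

variable [FiniteDimensional ℂ L] [IsKilling ℂ L]

theorem trace_eq_of_killing_adjoint {M N : End ℂ L} (h : ∀ u v, κ (M u) v = κ u (N v)) :
    tr M = tr N := by
  have hinj : Function.Injective (κ : L →ₗ[ℂ] Dual ℂ L) := by
    rw [← LinearMap.ker_eq_bot, LinearMap.ker_eq_bot']
    intro x hx
    exact eq_zero_of_killing fun y => by rw [hx]; rfl
  let K : L ≃ₗ[ℂ] Dual ℂ L := LinearEquiv.ofInjectiveOfFinrankEq κ hinj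
      Subspace.dual_finrank_eq.symm
  have hK : ∀ u, K u = κ u := fun u => rfl
  have : K.conj M = Module.Dual.transpose (R := ℂ) N := by
    refine LinearMap.ext fun φ => ?_
    obtain ⟨u, rfl⟩ := K.surjective φ
    refine LinearMap.ext fun v => ?_
    rw [LinearEquiv.conj_apply_apply, LinearEquiv.symm_apply_apply, hK, hK, h]
    rfl
  rw [← LinearMap.trace_conj' M K, this, LinearMap.trace_transpose']

theorem trace_ad_rev₃ (a b c : L) : tr (ad ℂ L a * ad ℂ L b * ad ℂ L c)
    = -tr (ad ℂ L c * ad ℂ L b * ad ℂ L a) := by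
  rw [← map_neg]
  refine trace_eq_of_killing_adjoint fun u v => ?_
  simp only [Module.End.mul_apply, ad_apply, LinearMap.neg_apply, map_neg]
  rw [killing_lie', killing_lie', killing_lie', neg_neg]

theorem trace_ad_rev₅ (a b c d e : L) :
    tr (ad ℂ L a * ad ℂ L b * ad ℂ L c * ad ℂ L d * ad ℂ L e)
    = -tr (ad ℂ L e * ad ℂ L d * ad ℂ L c * ad ℂ L b * ad ℂ L a) := by
  rw [← map_neg]
  refine trace_eq_of_killing_adjoint fun u v => ?_
  simp only [Module.End.mul_apply, ad_apply, LinearMap.neg_apply, map_neg]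
  rw [killing_lie', killing_lie', killing_lie', killing_lie', killing_lie', neg_neg, neg_neg]

/-- In a grading by `h` with one-dimensional top degree `3`, the quartic identity determines the
norm of the bracket of the extremal vectors. -/
theorem IsSl2Triple.lie_lie_of_degree_three {h e f : L} (t : IsSl2Triple h e f)
    (hQ : ∀ a b c d : L, quarticDefect a b c d = 0) (hB : κ h h = 126)
    (hbound : ∀ i : ℤ, (ad ℂ L h).eigenspace (i : ℂ) ≠ ⊥ → |i| ≤ 3)
    {x y : L} (hx : ⁅h, x⁆ = (3 : ℂ) • x) (hy : ⁅h, y⁆ = -(3 : ℂ) • y) (hxy : κ x y = 1)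
    (h3 : ∀ z, ⁅h, z⁆ = (3 : ℂ) • z → ∃ c : ℂ, z = c • x) :
    ⁅⁅x, y⁆, x⁆ = (-1 / 18 : ℂ) • x := by
  set H := ad ℂ L h with hH
  set X := ad ℂ L x with hX
  set Y := ad ℂ L y with hY
  have hHX : H * X = X * H + (3 : ℂ) • X := by
    have := ad_lie_eq h x
    rw [hx, map_smul] at this
    exact (sub_eq_iff_eq_add'.1 this.symm)
  have hHHX : H * (H * X) = X * H * H + (6 : ℂ) • (X * H) + (9 : ℂ) • X := by
    rw [hHX, mul_add, mul_smul_comm, ← mul_assoc, hHX, add_mul, smul_mul_assoc]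
    module
  have hHHHX : H * (H * (H * X))
      = X * H * H * H + (9 : ℂ) • (X * H * H) + (27 : ℂ) • (X * H) + (27 : ℂ) • X := by
    rw [hHHX, mul_add, mul_add, mul_smul_comm, mul_smul_comm, ← mul_assoc, ← mul_assoc,
      hHX, add_mul, add_mul, smul_mul_assoc, smul_mul_assoc]
    module
  have cyc : ∀ S T : End ℂ L, tr (S * T) = tr (T * S) := fun S T => LinearMap.trace_mul_comm ℂ S T
  have hb0 : tr (Y * X) = 1 := by rw [← hxy, killing_comm]; rfl
  have e1 : tr (H * X * Y) = tr (Y * X * H) + 3 * tr (Y * X) := by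
    rw [cyc, hHX, mul_add, map_add, mul_smul_comm, map_smul, mul_assoc, smul_eq_mul]
  have e2 : tr (H * H * X * Y) = tr (Y * X * H * H) + 6 * tr (Y * X * H) + 9 * tr (Y * X) := by
    rw [cyc, mul_assoc H, hHHX]
    simp only [mul_add, map_add, mul_smul_comm, map_smul, mul_assoc, smul_eq_mul]
  have e3 : tr (H * H * H * X * Y) = tr (Y * X * H * H * H) + 9 * tr (Y * X * H * H)
      + 27 * tr (Y * X * H) + 27 * tr (Y * X) := by
    rw [cyc, mul_assoc (H * H), mul_assoc H, hHHHX]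
    simp only [mul_add, map_add, mul_smul_comm, map_smul, mul_assoc, smul_eq_mul]
  have e4 : tr (H * X * H * Y) = tr (Y * X * H * H) + 3 * tr (Y * X * H) := by
    rw [cyc, hHX]
    simp only [mul_add, add_mul, map_add, mul_smul_comm, map_smul, mul_assoc, smul_eq_mul,
      smul_mul_assoc]
  have a1 : tr (H * X * Y) = -tr (Y * X * H) := trace_ad_rev₃ h x y
  have a3 : tr (H * H * H * X * Y) = -tr (Y * X * H * H * H) := trace_ad_rev₅ h h h x y
  have hQ' : 27 * (tr (H * H * X * Y) + tr (H * H * Y * X) + tr (H * X * H * Y)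
      + tr (H * X * Y * H) + tr (H * Y * H * X) + tr (H * Y * X * H))
      - (κ h h * κ x y + κ h x * κ h y + κ h y * κ h x) = 0 := hQ h h x y
  have hhx : κ h x = 0 := killing_eq_zero_of_eigenvalue (h := h) (a := 0) (b := 3)
    (by simp) hx (by norm_num)
  rw [hB, hxy, hhx, cyc (H * X * Y) H, cyc (H * Y * X) H, ← mul_assoc, ← mul_assoc, ← mul_assoc,
    ← mul_assoc, cyc (H * Y * H) X, cyc (H * H * Y) X, ← mul_assoc, ← mul_assoc, ← mul_assoc,
    ← mul_assoc] at hQ'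
  have e5 : tr (X * H * H * Y) = tr (Y * X * H * H) := by rw [cyc]; simp only [mul_assoc]
  have e6 : tr (X * H * Y * H) = tr (H * X * H * Y) := by rw [cyc]; simp only [mul_assoc]
  rw [e5, e6, e4, e2] at hQ'
  rw [e1] at a1
  rw [e3] at a3
  rw [hb0] at e1 e2 e3 a1 a3 hQ'
  have hT1 : tr (Y * X * H) = -3 / 2 := by linear_combination a1 / 2
  have hT2 : tr (Y * X * H * H) = 41 / 18 := by linear_combination hQ' / 162 - 3 * hT1
  have hT3 : tr (Y * X * H * H * H) = -7 / 2 := by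
    linear_combination a3 / 2 - 9 / 2 * hT2 - 27 / 2 * hT1
  obtain ⟨l, hl⟩ := h3 ⁅⁅x, y⁆, x⁆ (by
    rw [eigenvalue_lie (a := 0) (b := 3) (by
      rw [eigenvalue_lie hx hy]; norm_num) hx]; norm_num)
  have htop := t.slTwoRep.iSup_eigenspace
  have hvan : ∀ i : ℤ, 3 < |i| → ∀ v : L, ⁅h, v⁆ = (i : ℂ) • v → v = 0 := by
    intro i hi v hv
    by_contra hv0
    refine absurd (hbound i fun hb => hv0 ?_) (not_le.2 hi)
    have : v ∈ (ad ℂ L h).eigenspace (i : ℂ) := End.mem_eigenspace_iff.2 hv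
    rw [hb] at this
    simpa using this
  have hop : ∀ w, H (H (H (X w))) - (3 : ℂ) • H (H (X w)) + (2 : ℂ) • H (X w)
      = ((6 : ℂ) * κ y (X w)) • x := by
    intro w
    let T : End ℂ L := H * H * H * X - (3 : ℂ) • (H * H * X) + (2 : ℂ) • (H * X)
      - (6 : ℂ) • ((κ y).smulRight x * X)
    have hle : ⨆ i : ℤ, (ad ℂ L h).eigenspace (i : ℂ) ≤ LinearMap.ker T := by
      refine iSup_le fun i w hi => ?_
      rw [End.mem_eigenspace_iff, ad_apply] at hi
      have hXw : ⁅h, ⁅x, w⁆⁆ = ((3 + i : ℤ) : ℂ) • ⁅x, w⁆ := by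
        rw [eigenvalue_lie hx hi]; push_cast; rfl
      have hHw : H ⁅x, w⁆ = ((3 + i : ℤ) : ℂ) • ⁅x, w⁆ := hXw
      have hT : T w = (((3 + i : ℤ) : ℂ) * (((3 + i : ℤ) : ℂ) - 1) * (((3 + i : ℤ) : ℂ) - 2)) •
          ⁅x, w⁆
          - (6 * κ y ⁅x, w⁆) • x := by
        simp only [T, LinearMap.sub_apply, LinearMap.add_apply, LinearMap.smul_apply,
          Module.End.mul_apply, LinearMap.smulRight_apply, hX, ad_apply, hHw, map_smul]
        module
      rw [LinearMap.mem_ker, hT]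
      by_cases h30 : i = 0
      · subst h30
        obtain ⟨c, hc⟩ := h3 ⁅x, w⁆ (by rw [hXw]; norm_num)
        rw [hc, map_smul, killing_comm, hxy]
        push_cast
        module
      have hy0 : κ y ⁅x, w⁆ = 0 := killing_eq_zero_of_eigenvalue hy hXw (by
        push_cast
        simpa using h30)
      rw [hy0, mul_zero, zero_smul, sub_zero]
      rcases lt_or_ge 3 |3 + i| with hbig | hsmall
      · rw [hvan _ hbig _ hXw, smul_zero]
      rcases lt_or_ge 3 |i| with hbig | hsmall'
      · rw [hvan _ hbig _ hi, lie_zero, smul_zero]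
      have : i = -1 ∨ i = -2 ∨ i = -3 := by
        rw [abs_le] at hsmall hsmall'
        omega
      rcases this with rfl | rfl | rfl <;> norm_num
    rw [htop] at hle
    have := hle (Submodule.mem_top (x := w))
    rw [LinearMap.mem_ker] at this
    simp only [T, LinearMap.sub_apply, LinearMap.add_apply, LinearMap.smul_apply,
      Module.End.mul_apply, LinearMap.smulRight_apply] at this
    rw [← sub_eq_zero, ← this, smul_smul]
  have hop' : H * H * H * X * Y - (3 : ℂ) • (H * H * X * Y) + (2 : ℂ) • (H * X * Y)
      = (6 : ℂ) • ((κ y) ∘ₗ (X * Y)).smulRight x := LinearMap.ext fun w => by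
    simp only [LinearMap.sub_apply, LinearMap.add_apply, LinearMap.smul_apply,
      Module.End.mul_apply, LinearMap.smulRight_apply, LinearMap.comp_apply]
    rw [hop, smul_smul]
  have hl' : κ y ⁅x, ⁅y, x⁆⁆ = l := by
    rw [← lie_skew, ← neg_lie, lie_skew, hl, map_smul, killing_comm, hxy, smul_eq_mul,
      mul_one]
  have htr := congrArg tr hop'
  simp only [map_add, map_sub, map_smul, smul_eq_mul, LinearMap.trace_smulRight,
    LinearMap.comp_apply, Module.End.mul_apply] at htr
  have hXY : X (Y x) = ⁅x, ⁅y, x⁆⁆ := rfl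
  rw [hXY, hl', e1, e2, e3, hT1, hT2, hT3] at htr
  rw [hl]
  congr 1
  linear_combination -htr / 6

omit [FiniteDimensional ℂ L] [IsKilling ℂ L] in
theorem exists_smul_of_finrank_eigenspace_eq_one {h x : L} {a : ℂ} (hx0 : x ≠ 0)
    (hx : ⁅h, x⁆ = a • x) (h1 : finrank ℂ ((ad ℂ L h).eigenspace a) = 1) (z : L)
    (hz : ⁅h, z⁆ = a • z) : ∃ c : ℂ, z = c • x := by
  obtain ⟨c, hc⟩ := (finrank_eq_one_iff_of_nonzero'
    (⟨x, End.mem_eigenspace_iff.2 hx⟩ : (ad ℂ L h).eigenspace a)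
    (by simpa using hx0)).1 h1 ⟨z, End.mem_eigenspace_iff.2 hz⟩
  exact ⟨c, (congrArg Subtype.val hc).symm⟩

theorem IsSl2Triple.not_finrank_eigenspace_three {h e f : L} (t : IsSl2Triple h e f)
    (hQ : ∀ a b c d : L, quarticDefect a b c d = 0)
    (d : ℕ → ℕ) (hd : ∀ n, d n = finrank ℂ ((ad ℂ L h).eigenspace (n : ℂ)))
    (h1 : d 1 = 50) (h2 : d 2 = 1) (h3 : d 3 = 1) (h4 : ∀ n, 3 < n → d n = 0) : False := by
  have htop := t.slTwoRep.iSup_eigenspace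
  have hB : κ h h = 126 := by
    rw [t.killing_self 3 d hd h4]
    simp only [Finset.sum_range_succ, Finset.sum_range_zero, h1, h2, h3, zero_add, Nat.reduceAdd]
    norm_num
  have hbound := eigenvalue_bound htop 3 fun n hn => by rw [← hd, h4 n hn]
  have h31 : finrank ℂ ((ad ℂ L h).eigenspace (3 : ℂ)) = 1 := by
    have := (hd 3).symm.trans h3
    rwa [Nat.cast_ofNat] at this
  have h31' : finrank ℂ ((ad ℂ L h).eigenspace (-3 : ℂ)) = 1 := by
    have := finrank_eigenspace_neg htop 3
    rw [Int.cast_neg, Int.cast_ofNat] at this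
    exact this.trans h31
  obtain ⟨x, hx0, -⟩ := finrank_eq_one_iff'.1 h31
  obtain ⟨x, hx⟩ := x
  replace hx0 : x ≠ 0 := by simpa using hx0
  rw [End.mem_eigenspace_iff, ad_apply] at hx
  obtain ⟨y, hy, hxy⟩ : ∃ y, ⁅h, y⁆ = -(3 : ℂ) • y ∧ κ x y = 1 := by
    by_contra hne
    push Not at hne
    refine hx0 (killing_ext_eigenspace (a := 3) htop (by exact_mod_cast hx) fun y hy => ?_)
    by_contra hk
    push_cast at hy
    refine hne ((κ x y)⁻¹ • y) (by rw [lie_smul, hy, smul_comm]) ?_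
    rw [map_smul, smul_eq_mul, inv_mul_cancel₀ hk]
  have hy0 : y ≠ 0 := by
    rintro rfl
    simp at hxy
  have hlx := t.lie_lie_of_degree_three hQ hB (by exact_mod_cast hbound) hx hy hxy
    (exists_smul_of_finrank_eigenspace_eq_one hx0 hx h31)
  have hw : ⁅h, ⁅x, y⁆⁆ = (0 : ℂ) • ⁅x, y⁆ := by rw [eigenvalue_lie hx hy]; norm_num
  obtain ⟨m, hm⟩ := exists_smul_of_finrank_eigenspace_eq_one hy0 hy h31' ⁅⁅x, y⁆, y⁆ (by
    rw [eigenvalue_lie hw hy, zero_add])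
  have hww : κ ⁅x, y⁆ ⁅x, y⁆ = -1 / 18 := by
    rw [← killing_lie, hlx, map_smul, LinearMap.smul_apply, hxy, smul_eq_mul, mul_one]
  have hm' : m = 1 / 18 := by
    have := killing_lie ⁅x, y⁆ y x
    rw [hm, ← lie_skew y x, map_neg, hww, map_smul, LinearMap.smul_apply, killing_comm, hxy] at this
    simpa [neg_div] using this
  have t' : IsSl2Triple ((-36 : ℂ) • ⁅x, y⁆) x ((-36 : ℂ) • y) := by
    refine ⟨?_, ?_, ?_, ?_⟩
    · intro h0
      have : ⁅x, y⁆ = 0 := (smul_eq_zero.1 h0).resolve_left (by norm_num)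
      rw [this] at hww
      norm_num at hww
    · rw [lie_smul]
    · rw [smul_lie, hlx, smul_smul, ← Nat.cast_smul_eq_nsmul ℂ]; norm_num
    · rw [lie_smul, smul_lie, hm, hm', ← Nat.cast_smul_eq_nsmul ℂ]; module
  obtain ⟨n, hn⟩ := t'.exists_killing_eq
  rw [map_smul, map_smul, LinearMap.smul_apply, hww] at hn
  have : ((n + 72 : ℕ) : ℂ) = 0 := by
    push_cast
    rw [← hn]
    norm_num
  exact absurd (Nat.cast_eq_zero.1 this) (by omega)

end Quartic

section Center

variable {V : Type*} [AddCommGroup V] [Module ℂ V] [FiniteDimensional ℂ V]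

theorem isNilpotent_of_forall_eigenvalue {C : End ℂ V}
    (h : ∀ μ : ℂ, C.eigenspace μ ≠ ⊥ → μ = 0) : IsNilpotent C := by
  have h0 : C.maxGenEigenspace 0 = ⊤ := by
    rw [eq_top_iff, ← End.iSup_maxGenEigenspace_eq_top C]
    refine iSup_le fun μ => ?_
    by_cases hμ : μ = 0
    · rw [hμ]
    have hb : C.eigenspace μ = ⊥ := by
      by_contra hb
      exact hμ (h μ hb)
    have : C.maxGenEigenspace μ = ⊥ := by
      by_contra hne
      exact End.HasUnifEigenvalue.lt (k := ⊤) (m := 1) zero_lt_one hne hb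
    rw [this]
    exact bot_le
  rw [Module.End.maxGenEigenspace_eq] at h0
  refine ⟨C.maxGenEigenspaceIndex 0, LinearMap.ext fun v => ?_⟩
  have := h0.ge (Submodule.mem_top (x := v))
  rw [End.mem_genEigenspace_nat] at this
  simpa using this

variable {L : Type*} [LieRing L] [LieAlgebra ℂ L] [FiniteDimensional ℂ L]

open LieAlgebra

local notation "κ" => killingForm ℂ L

theorem isNilpotent_ad_of_central_of_mem_span_lie (L₀ : Submodule ℂ L) {c : L}
    (hc : ∀ x ∈ L₀, ⁅c, x⁆ = 0)
    (hc' : c ∈ Submodule.span ℂ {z | ∃ x ∈ L₀, ∃ y ∈ L₀, ⁅x, y⁆ = z}) :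
    IsNilpotent (ad ℂ L c) := by
  refine isNilpotent_of_forall_eigenvalue fun μ hμ => ?_
  set W := (ad ℂ L c).eigenspace μ with hW
  have hWc : ∀ w ∈ W, ⁅c, w⁆ = μ • w := fun w hw => End.mem_eigenspace_iff.1 hw
  have hstab : ∀ x ∈ L₀, ∀ w ∈ W, ad ℂ L x w ∈ W := by
    intro x hx w hw
    rw [hW, End.mem_eigenspace_iff, ad_apply] at hw ⊢
    rw [ad_apply, leibniz_lie c, hc x hx, zero_lie, zero_add, hw, lie_smul]
  have key : ∃ M : End ℂ W, (∀ w, (M w : L) = ⁅c, (w : L)⁆) ∧ LinearMap.trace ℂ W M = 0 := by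
    clear_value W
    clear hc hμ hW hWc
    induction hc' using Submodule.span_induction with
    | mem z hz =>
      obtain ⟨x, hx, y, hy, rfl⟩ := hz
      let X := (ad ℂ L x).restrict (hstab x hx)
      let Y := (ad ℂ L y).restrict (hstab y hy)
      refine ⟨X * Y - Y * X, fun w => ?_, ?_⟩
      · rw [lie_lie]; rfl
      · rw [map_sub, LinearMap.trace_mul_comm, sub_self]
    | zero => exact ⟨0, by simp, by simp⟩
    | add a b _ _ iha ihb =>
      obtain ⟨M, hM, hM'⟩ := iha
      obtain ⟨N, hN, hN'⟩ := ihb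
      exact ⟨M + N, fun w => by rw [add_lie, ← hM, ← hN]; rfl, by rw [map_add, hM', hN', add_zero]⟩
    | smul r a _ iha =>
      obtain ⟨M, hM, hM'⟩ := iha
      exact ⟨r • M, fun w => by rw [smul_lie, ← hM]; rfl, by rw [map_smul, hM', smul_zero]⟩
  obtain ⟨M, hM, htr⟩ := key
  have : M = μ • 1 := LinearMap.ext fun w => Subtype.ext (by
    rw [hM]; exact hWc _ w.2)
  rw [this, map_smul, LinearMap.trace_one, smul_eq_mul, mul_eq_zero] at htr
  refine htr.resolve_right fun h0 => hμ ?_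
  exact Submodule.finrank_eq_zero.1 (by exact_mod_cast h0)

theorem exists_add_orthogonal (L₀ : Submodule ℂ L)
    (hnd : ∀ x ∈ L₀, (∀ y ∈ L₀, κ x y = 0) → x = 0) (z : L) :
    ∃ z₀ ∈ L₀, ∀ y ∈ L₀, κ z y = κ z₀ y := by
  let φ : L₀ →ₗ[ℂ] Dual ℂ L₀ := (LinearMap.lcomp ℂ ℂ L₀.subtype) ∘ₗ κ ∘ₗ L₀.subtype
  have hinj : Function.Injective φ := by
    rw [← LinearMap.ker_eq_bot, LinearMap.ker_eq_bot']
    rintro ⟨x, hx⟩ h0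
    have := hnd x hx fun y hy => congrArg (fun ψ : Dual ℂ L₀ => ψ ⟨y, hy⟩) h0
    simpa using this
  obtain ⟨z₀, hz₀⟩ := (LinearMap.injective_iff_surjective_of_finrank_eq_finrank
    Subspace.dual_finrank_eq.symm).1 hinj (κ z ∘ₗ L₀.subtype)
  exact ⟨z₀, z₀.2, fun y hy => (congrArg (fun ψ : Dual ℂ L₀ => ψ ⟨y, hy⟩) hz₀).symm⟩

/-- If the Killing form of `L` is non-degenerate on a subalgebra, then it has no non-zero central
element orthogonal to the whole centre. -/
theorem eq_zero_of_central_of_orthogonal [IsKilling ℂ L] (L₀ : Submodule ℂ L)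
    (hcl : ∀ x ∈ L₀, ∀ y ∈ L₀, ⁅x, y⁆ ∈ L₀)
    (hnd : ∀ x ∈ L₀, (∀ y ∈ L₀, κ x y = 0) → x = 0) {c : L} (hcL : c ∈ L₀)
    (hc : ∀ x ∈ L₀, ⁅c, x⁆ = 0)
    (horth : ∀ z ∈ L₀, (∀ x ∈ L₀, ⁅z, x⁆ = 0) → κ c z = 0) : c = 0 := by
  refine hnd c hcL fun y hy => ?_
  have hnil := isNilpotent_ad_of_central_of_mem_span_lie L₀ hc (by
    refine mem_of_killing _ _ fun z hz => ?_
    obtain ⟨z₀, hz₀, hzz⟩ := exists_add_orthogonal L₀ hnd z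
    rw [hzz c hcL, killing_comm]
    refine horth z₀ hz₀ fun x hx => hnd _ (hcl _ hz₀ _ hx) fun y hy => ?_
    rw [killing_lie, ← hzz _ (hcl _ hx _ hy)]
    exact hz _ (Submodule.subset_span ⟨x, hx, y, hy, rfl⟩))
  have hcomm : Commute (ad ℂ L c) (ad ℂ L y) := by
    have := ad_lie_eq c y
    rw [hc y hy, map_zero] at this
    exact (sub_eq_zero.1 this.symm)
  exact (LinearMap.isNilpotent_trace_of_isNilpotent (hcomm.isNilpotent_mul_right hnil)).eq_zero

end Center

section Short

set_option linter.unusedSectionVars false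

variable {L : Type*} [LieRing L] [LieAlgebra ℂ L] [FiniteDimensional ℂ L]

open LieAlgebra

local notation "κ" => killingForm ℂ L
local notation "tr" => LinearMap.trace ℂ L

/-- An `sl₂`-triple whose neutral element has only the eigenvalues `-2, 0, 2`. -/
structure ShortTriple (h e f : L) : Prop extends IsSl2Triple h e f where
  dec : ∀ w : L, ∃ a b c, w = a + b + c ∧ ⁅h, a⁆ = (2 : ℂ) • a ∧ ⁅h, b⁆ = 0 ∧ ⁅h, c⁆ = (-2 : ℂ) • c
  top : ∀ v : L, ⁅h, v⁆ = (4 : ℂ) • v → v = 0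
  bot : ∀ v : L, ⁅h, v⁆ = (-4 : ℂ) • v → v = 0

namespace ShortTriple

variable {h e f : L} (t : ShortTriple h e f)
include t

theorem lie_h_e : ⁅h, e⁆ = (2 : ℂ) • e := t.lie_h_e_smul ℂ

theorem lie_h_f : ⁅h, f⁆ = (-2 : ℂ) • f := by rw [t.lie_lie_smul_f ℂ, neg_smul]

theorem lie_e_lie_f (v : L) : ⁅e, ⁅f, v⁆⁆ = ⁅f, ⁅e, v⁆⁆ + ⁅h, v⁆ :=
  t.slTwoRep.lie_e_f v

theorem lie_e_top {a : L} (ha : ⁅h, a⁆ = (2 : ℂ) • a) : ⁅e, a⁆ = 0 :=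
  t.top _ (by rw [eigenvalue_lie t.lie_h_e ha]; norm_num)

theorem lie_f_bot {c : L} (hc : ⁅h, c⁆ = (-2 : ℂ) • c) : ⁅f, c⁆ = 0 :=
  t.bot _ (by rw [eigenvalue_lie t.lie_h_f hc]; norm_num)

theorem lie_e_zero {b : L} (hb : ⁅h, b⁆ = 0) : ⁅h, ⁅e, b⁆⁆ = (2 : ℂ) • ⁅e, b⁆ := by
  rw [eigenvalue_lie (b := 0) t.lie_h_e (by simpa using hb), add_zero]

theorem lie_f_zero {b : L} (hb : ⁅h, b⁆ = 0) : ⁅h, ⁅f, b⁆⁆ = (-2 : ℂ) • ⁅f, b⁆ := by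
  rw [eigenvalue_lie (b := 0) t.lie_h_f (by simpa using hb), add_zero]

theorem lie_e_bot {c : L} (hc : ⁅h, c⁆ = (-2 : ℂ) • c) : ⁅h, ⁅e, c⁆⁆ = 0 := by
  rw [eigenvalue_lie t.lie_h_e hc]; norm_num

theorem lie_f_top {a : L} (ha : ⁅h, a⁆ = (2 : ℂ) • a) : ⁅h, ⁅f, a⁆⁆ = 0 := by
  rw [eigenvalue_lie t.lie_h_f ha]; norm_num

theorem eq_zero_of_lie_e {c : L} (hc : ⁅h, c⁆ = (-2 : ℂ) • c) (he : ⁅e, c⁆ = 0) : c = 0 :=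
  t.slTwoRep.e_injective (i := -2) (by norm_num) he (by rw [ad_apply, hc]; norm_num)

theorem exists_lie_e {a : L} (ha : ⁅h, a⁆ = (2 : ℂ) • a) : ∃ b, ⁅h, b⁆ = 0 ∧ ⁅e, b⁆ = a := by
  obtain ⟨u, hu, hu'⟩ := t.slTwoRep.e_surjective (i := 0) (w := a) (by norm_num)
    (by rw [ad_apply, ha]; norm_num)
  exact ⟨u, by simpa using hu, hu'⟩

theorem lie_f_ker {b : L} (hb : ⁅h, b⁆ = 0) (he : ⁅e, b⁆ = 0) : ⁅f, b⁆ = 0 :=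
  t.eq_zero_of_lie_e (t.lie_f_zero hb) (by rw [t.lie_e_lie_f, he, hb, lie_zero, add_zero])

theorem lie_e_lie_f_top {a : L} (ha : ⁅h, a⁆ = (2 : ℂ) • a) : ⁅e, ⁅f, a⁆⁆ = (2 : ℂ) • a := by
  rw [t.lie_e_lie_f, t.lie_e_top ha, lie_zero, zero_add, ha]

theorem lie_f_lie_e_bot {c : L} (hc : ⁅h, c⁆ = (-2 : ℂ) • c) : ⁅f, ⁅e, c⁆⁆ = (2 : ℂ) • c := by
  have := t.lie_e_lie_f c
  rw [t.lie_f_bot hc, lie_zero, hc] at this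
  rw [eq_neg_of_add_eq_zero_left this.symm]
  module

theorem exists_ker_add {b : L} (hb : ⁅h, b⁆ = 0) :
    ∃ q c, b = q + ⁅e, c⁆ ∧ ⁅h, q⁆ = 0 ∧ ⁅e, q⁆ = 0 ∧ ⁅h, c⁆ = (-2 : ℂ) • c := by
  set a := ⁅e, b⁆ with ha'
  have ha : ⁅h, a⁆ = (2 : ℂ) • a := t.lie_e_zero hb
  have hc : ⁅h, (1 / 4 : ℂ) • ⁅f, ⁅f, a⁆⁆⁆ = (-2 : ℂ) • ((1 / 4 : ℂ) • ⁅f, ⁅f, a⁆⁆) := by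
    rw [lie_smul, t.lie_f_zero (t.lie_f_top ha), smul_comm]
  have hee : ⁅e, ⁅e, (1 / 4 : ℂ) • ⁅f, ⁅f, a⁆⁆⁆⁆ = a := by
    rw [lie_smul, t.lie_e_lie_f, t.lie_f_top ha, add_zero, t.lie_e_lie_f_top ha, lie_smul,
      lie_smul, lie_smul, t.lie_e_lie_f_top ha]
    module
  refine ⟨b - ⁅e, (1 / 4 : ℂ) • ⁅f, ⁅f, a⁆⁆⁆, _, (sub_add_cancel _ _).symm, ?_, ?_, hc⟩
  · rw [lie_sub, hb, t.lie_e_bot hc, sub_zero]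
  · rw [lie_sub, hee, sub_self]

theorem mem_ker {x : L} (hx : ⁅e, x⁆ = 0) :
    ∃ a b, x = a + b ∧ ⁅h, a⁆ = (2 : ℂ) • a ∧ ⁅h, b⁆ = 0 ∧ ⁅e, b⁆ = 0 := by
  obtain ⟨a, b, c, rfl, ha, hb, hc⟩ := t.dec x
  rw [lie_add, lie_add, t.lie_e_top ha, zero_add] at hx
  have h1 := t.lie_e_zero hb
  have h2 := t.lie_e_bot hc
  have h3 : ⁅h, ⁅e, b⁆ + ⁅e, c⁆⁆ = 0 := by rw [hx, lie_zero]
  rw [lie_add, h1, h2, add_zero, smul_eq_zero] at h3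
  have h4 := h3.resolve_left two_ne_zero
  rw [h4, zero_add] at hx
  rw [t.eq_zero_of_lie_e hc hx, add_zero]
  exact ⟨a, b, rfl, ha, hb, h4⟩

omit t [FiniteDimensional ℂ L] in
theorem killing_ker_lie_e {q : L} (hq : ⁅e, q⁆ = 0) (c : L) : κ q ⁅e, c⁆ = 0 := by
  rw [killing_comm, killing_lie', hq, map_zero, neg_zero]

variable [IsKilling ℂ L]

theorem eq_zero_of_degree_zero {b : L} (hb : ⁅h, b⁆ = 0)
    (h0 : ∀ y, ⁅h, y⁆ = 0 → κ b y = 0) : b = 0 :=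
  killing_ext_eigenspace (a := 0) t.slTwoRep.iSup_eigenspace (by simpa using hb)
    fun y hy => h0 y (by simpa using hy)

theorem eq_zero_of_mem_ker {b : L} (hb : ⁅h, b⁆ = 0) (he : ⁅e, b⁆ = 0)
    (h0 : ∀ y, ⁅h, y⁆ = 0 → ⁅e, y⁆ = 0 → κ b y = 0) : b = 0 := by
  refine t.eq_zero_of_degree_zero hb fun y hy => ?_
  obtain ⟨q, c, rfl, hq, hq', -⟩ := t.exists_ker_add hy
  rw [map_add, h0 q hq hq', killing_ker_lie_e he, add_zero]

theorem killing_e_f : κ h h = 2 * κ e f := by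
  rw [← t.lie_e_f, killing_lie, t.lie_e_f, ← lie_skew f h, t.lie_h_f, map_neg, map_smul,
      smul_eq_mul]
  ring

end ShortTriple

end Short

section ShortQuartic

set_option linter.unusedSectionVars false

open LieAlgebra

variable {L : Type*} [LieRing L] [LieAlgebra ℂ L] [FiniteDimensional ℂ L] [IsKilling ℂ L]

local notation "κ" => killingForm ℂ L
local notation "tr" => LinearMap.trace ℂ L

theorem killing_eq_zero_of_quarticDefect {h z : L} (hQ : ∀ a b c d : L, quarticDefect a b c d = 0)
    (hB : κ h h = 216) (hz : ⁅h, z⁆ = 0) (hκ : κ h z = 0) {r : ℂ} (hr : 162 * r ≠ 216)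
    (hX : tr (ad ℂ L z * (ad ℂ L h * ad ℂ L h) * ad ℂ L z) = r * κ z z) : κ z z = 0 := by
  have hc : ad ℂ L h * ad ℂ L z = ad ℂ L z * ad ℂ L h := by
    have := ad_lie_eq h z
    rw [hz, map_zero] at this
    exact (sub_eq_zero.1 this.symm)
  have h1 := hQ h h z z
  rw [quarticDefect, hB, hκ] at h1
  have e1 : ad ℂ L h * ad ℂ L h * ad ℂ L z * ad ℂ L z
      = ad ℂ L z * (ad ℂ L h * ad ℂ L h) * ad ℂ L z := by
    rw [mul_assoc (ad ℂ L h), hc, ← mul_assoc (ad ℂ L h), hc, mul_assoc (ad ℂ L z)]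
  have e2 : ad ℂ L h * ad ℂ L z * ad ℂ L h * ad ℂ L z
      = ad ℂ L z * (ad ℂ L h * ad ℂ L h) * ad ℂ L z := by
    rw [hc, mul_assoc (ad ℂ L z)]
  have e3 : ad ℂ L h * ad ℂ L z * ad ℂ L z * ad ℂ L h
      = ad ℂ L z * (ad ℂ L h * ad ℂ L h) * ad ℂ L z := by
    rw [mul_assoc _ (ad ℂ L z) (ad ℂ L h), ← hc, ← mul_assoc, e2]
  rw [e1, e2, e3, hX] at h1
  have : (162 * r - 216) * κ z z = 0 := by linear_combination h1
  exact (mul_eq_zero.1 this).resolve_left (sub_ne_zero.2 hr)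

namespace ShortTriple

variable {h e f : L} (t : ShortTriple h e f)
include t

theorem exists_casimir (w : L) : ∃ q, ⁅h, q⁆ = 0 ∧ ⁅e, q⁆ = 0 ∧
    (1 / 2 : ℂ) • ⁅h, ⁅h, w⁆⁆ + ⁅e, ⁅f, w⁆⁆ + ⁅f, ⁅e, w⁆⁆ = (4 : ℂ) • (w - q) := by
  obtain ⟨a, b, c, rfl, ha, hb, hc⟩ := t.dec w
  obtain ⟨q, d, rfl, hq, hq', hd⟩ := t.exists_ker_add hb
  refine ⟨q, hq, hq', ?_⟩
  have h1 : ⁅f, ⁅e, ⁅e, d⁆⁆⁆ = (2 : ℂ) • ⁅e, d⁆ := by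
    have := t.lie_e_lie_f ⁅e, d⁆
    rw [t.lie_e_bot hd, add_zero, t.lie_f_lie_e_bot hd, lie_smul] at this
    exact this.symm
  simp only [lie_add, ha, hc, hq, hq', t.lie_e_bot hd, t.lie_f_ker hq hq', t.lie_f_lie_e_bot hd,
    t.lie_e_lie_f_top ha, t.lie_e_top ha, t.lie_f_lie_e_bot hc, t.lie_f_bot hc, h1, lie_smul,
    lie_zero]
  module

theorem eq_zero_of_central_ker (hQ : ∀ a b c d : L, quarticDefect a b c d = 0) (hB : κ h h = 216)
    {z : L} (hz : ⁅h, z⁆ = 0) (hz' : ⁅e, z⁆ = 0)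
    (hc : ∀ q : L, ⁅h, q⁆ = 0 → ⁅e, q⁆ = 0 → ⁅z, q⁆ = 0) : z = 0 := by
  have key : ∀ z : L, ⁅h, z⁆ = 0 → ⁅e, z⁆ = 0 →
      (∀ q : L, ⁅h, q⁆ = 0 → ⁅e, q⁆ = 0 → ⁅z, q⁆ = 0) → κ z z = 0 := by
    intro z hz hz' hc
    have hκ : κ h z = 0 := by
      rw [← t.lie_e_f, killing_lie, t.lie_f_ker hz hz', map_zero]
    refine killing_eq_zero_of_quarticDefect hQ hB hz hκ (r := 8 / 3) (by norm_num) ?_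
    have hcas : ad ℂ L z * ((1 / 2 : ℂ) • (ad ℂ L h * ad ℂ L h) + ad ℂ L e * ad ℂ L f
        + ad ℂ L f * ad ℂ L e) = (4 : ℂ) • ad ℂ L z := by
      refine LinearMap.ext fun w => ?_
      obtain ⟨q, hq, hq', hw⟩ := t.exists_casimir w
      simp only [Module.End.mul_apply, LinearMap.add_apply, LinearMap.smul_apply, ad_apply] at hw ⊢
      rw [hw, lie_smul, lie_sub, hc q hq hq', sub_zero]
    have hEF : ad ℂ L e * ad ℂ L f = ad ℂ L f * ad ℂ L e + ad ℂ L h := by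
      rw [← t.lie_e_f, ad_lie_eq]; abel
    have hHE : ad ℂ L h * ad ℂ L e - ad ℂ L e * ad ℂ L h = (2 : ℂ) • ad ℂ L e := by
      rw [← ad_lie_eq, t.lie_h_e, map_smul]
    have hEZ : ad ℂ L e * ad ℂ L z = ad ℂ L z * ad ℂ L e := by
      have := ad_lie_eq e z
      rw [hz', map_zero] at this
      exact (sub_eq_zero.1 this.symm)
    have h0 : tr (ad ℂ L z * ad ℂ L h * ad ℂ L z) = 0 := by
      have := trace_ad_rev₃ z h z
      linear_combination this / 2
    have h1 : tr (ad ℂ L z * (ad ℂ L e * ad ℂ L f) * ad ℂ L z)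
        = tr (ad ℂ L z * (ad ℂ L f * ad ℂ L e) * ad ℂ L z) := by
      rw [hEF, mul_add, add_mul, map_add, h0, add_zero]
    have h2 : tr (ad ℂ L z * (ad ℂ L h * ad ℂ L h) * ad ℂ L z)
        = 2 * tr (ad ℂ L z * (ad ℂ L e * ad ℂ L f) * ad ℂ L z) := by
      have e1 : ad ℂ L h = ad ℂ L e * ad ℂ L f - ad ℂ L f * ad ℂ L e := by rw [hEF]; abel
      have e2 : tr (ad ℂ L z * (ad ℂ L h * (ad ℂ L f * ad ℂ L e)) * ad ℂ L z)
          = tr (ad ℂ L z * (ad ℂ L e * ad ℂ L h * ad ℂ L f) * ad ℂ L z) := by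
        have e3 : ad ℂ L z * (ad ℂ L h * (ad ℂ L f * ad ℂ L e)) * ad ℂ L z
            = (ad ℂ L z * ad ℂ L h * ad ℂ L f * ad ℂ L z) * ad ℂ L e := by
          simp only [mul_assoc, hEZ]
        rw [e3, LinearMap.trace_mul_comm]
        simp only [← mul_assoc, hEZ]
      calc _ = tr (ad ℂ L z * (ad ℂ L h * (ad ℂ L e * ad ℂ L f)) * ad ℂ L z)
            - tr (ad ℂ L z * (ad ℂ L h * (ad ℂ L f * ad ℂ L e)) * ad ℂ L z) := by
            rw [← map_sub]
            congr 1
            rw [← sub_mul, ← mul_sub, ← mul_sub, ← e1]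
        _ = tr (ad ℂ L z * ((ad ℂ L h * ad ℂ L e - ad ℂ L e * ad ℂ L h) * ad ℂ L f)
            * ad ℂ L z) := by
            rw [e2, ← map_sub]
            congr 1
            noncomm_ring
        _ = _ := by
            rw [hHE, smul_mul_assoc, mul_smul_comm, smul_mul_assoc, map_smul, smul_eq_mul]
    have h3 := congrArg (fun A => tr (A * ad ℂ L z)) hcas
    simp only [mul_add, add_mul, map_add, mul_smul_comm, smul_mul_assoc, map_smul, smul_eq_mul]
      at h3
    rw [killing_eq_trace]
    linear_combination (2 / 3 : ℂ) * h3 + (2 / 3 : ℂ) * h1 + (2 / 3 : ℂ) * h2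
  let k : Submodule ℂ L := LinearMap.ker (ad ℂ L h) ⊓ LinearMap.ker (ad ℂ L e)
  have hk : ∀ {x}, x ∈ k ↔ ⁅h, x⁆ = 0 ∧ ⁅e, x⁆ = 0 := fun {x} => Iff.rfl
  refine eq_zero_of_central_of_orthogonal k ?_ ?_ (hk.2 ⟨hz, hz'⟩)
    (fun x hx => hc x (hk.1 hx).1 (hk.1 hx).2) fun y hy hcy => ?_
  · intro x hx y hy
    rw [hk] at *
    rw [leibniz_lie, leibniz_lie e, hx.1, hx.2, hy.1, hy.2]
    simp
  · exact fun x hx hx' => t.eq_zero_of_mem_ker (hk.1 hx).1 (hk.1 hx).2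
      fun y hy hy' => hx' y (hk.2 ⟨hy, hy'⟩)
  · have h1 := key (z + y) (by rw [lie_add, hz, (hk.1 hy).1, add_zero])
      (by rw [lie_add, hz', (hk.1 hy).2, add_zero])
      fun q hq hq' => by rw [add_lie, hc q hq hq', hcy q (hk.2 ⟨hq, hq'⟩), add_zero]
    have h2 := key z hz hz' hc
    have h3 := key y (hk.1 hy).1 (hk.1 hy).2 fun q hq hq' => hcy q (hk.2 ⟨hq, hq'⟩)
    simp only [map_add, LinearMap.add_apply] at h1
    rw [killing_comm y z] at h1
    linear_combination h1 / 2 - h2 / 2 - h3 / 2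

theorem eq_smul_of_central (hQ : ∀ a b c d : L, quarticDefect a b c d = 0) (hB : κ h h = 216)
    {u : L} (hu : ⁅h, u⁆ = 0) (hc : ∀ x : L, ⁅h, x⁆ = 0 → ⁅u, x⁆ = 0) : ∃ μ : ℂ, u = μ • h := by
  have key : ∀ z : L, ⁅h, z⁆ = 0 → (∀ x : L, ⁅h, x⁆ = 0 → ⁅z, x⁆ = 0) → κ h z = 0 → κ z z = 0 := by
    intro z hz hc hκ
    refine killing_eq_zero_of_quarticDefect hQ hB hz hκ (r := 4) (by norm_num) ?_
    have : ad ℂ L z * (ad ℂ L h * ad ℂ L h) = (4 : ℂ) • ad ℂ L z := by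
      refine LinearMap.ext fun w => ?_
      obtain ⟨a, b, c, rfl, ha, hb, hc'⟩ := t.dec w
      simp only [Module.End.mul_apply, LinearMap.smul_apply, ad_apply, lie_add, ha, hb, hc',
        lie_smul, lie_zero, hc b hb]
      module
    rw [this, smul_mul_assoc, map_smul, smul_eq_mul, killing_eq_trace]
  have key' : ∀ y z : L, ⁅h, z⁆ = 0 → (∀ x : L, ⁅h, x⁆ = 0 → ⁅z, x⁆ = 0) → κ h z = 0 →
      ⁅h, y⁆ = 0 → (∀ x : L, ⁅h, x⁆ = 0 → ⁅y, x⁆ = 0) → κ h y = 0 → κ z y = 0 := by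
    intro y z hz hcz hκz hy hcy hκy
    have h1 := key (z + y) (by rw [lie_add, hz, hy, add_zero])
      (fun x hx => by rw [add_lie, hcz x hx, hcy x hx, add_zero])
      (by rw [map_add, hκz, hκy, add_zero])
    have h2 := key z hz hcz hκz
    have h3 := key y hy hcy hκy
    simp only [map_add, LinearMap.add_apply] at h1
    rw [killing_comm y z] at h1
    linear_combination h1 / 2 - h2 / 2 - h3 / 2
  have hadj : ∀ z : L, ⁅h, z⁆ = 0 → (∀ x : L, ⁅h, x⁆ = 0 → ⁅z, x⁆ = 0) →
      let y := z - (κ h z / 216) • h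
      ⁅h, y⁆ = 0 ∧ (∀ x : L, ⁅h, x⁆ = 0 → ⁅y, x⁆ = 0) ∧ κ h y = 0 := by
    intro z hz hcz
    refine ⟨by simp [hz], fun x hx => by simp [hcz x hx, hx], ?_⟩
    rw [map_sub, map_smul, hB, smul_eq_mul]
    ring
  obtain ⟨h1, h2, h3⟩ := hadj u hu hc
  refine ⟨κ h u / 216, sub_eq_zero.1 ?_⟩
  refine eq_zero_of_central_of_orthogonal (LinearMap.ker (ad ℂ L h)) ?_ ?_ h1 h2
    fun z hz hcz => ?_
  · intro x hx y hy
    simp only [LinearMap.mem_ker, ad_apply] at *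
    rw [leibniz_lie, hx, hy]
    simp
  · exact fun x hx hx' => t.eq_zero_of_degree_zero hx hx'
  · obtain ⟨g1, g2, g3⟩ := hadj z hz hcz
    have := key' _ _ h1 h2 h3 g1 g2 g3
    rw [map_sub, map_smul, killing_comm _ h, h3, smul_zero, sub_zero] at this
    exact this

theorem eq_smul_of_lie_ker (hQ : ∀ a b c d : L, quarticDefect a b c d = 0) (hB : κ h h = 216)
    {v : L} (hv : ⁅h, v⁆ = (-2 : ℂ) • v) (hc : ∀ q : L, ⁅h, q⁆ = 0 → ⁅e, q⁆ = 0 → ⁅q, v⁆ = 0) :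
    ∃ μ : ℂ, v = μ • f := by
  have hu : ⁅h, ⁅e, v⁆⁆ = 0 := t.lie_e_bot hv
  have huk : ∀ q : L, ⁅h, q⁆ = 0 → ⁅e, q⁆ = 0 → ⁅⁅e, v⁆, q⁆ = 0 := by
    intro q hq hq'
    rw [lie_lie, hq', ← lie_skew v, hc q hq hq']
    simp
  obtain ⟨μ, hμ⟩ := t.eq_smul_of_central hQ hB hu fun x hx => by
    obtain ⟨q, c, rfl, hq, hq', hcc⟩ := t.exists_ker_add hx
    rw [lie_add, huk q hq hq', zero_add]
    have hp : ⁅h, ⁅e, c⁆⁆ = 0 := t.lie_e_bot hcc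
    have hup : ⁅h, ⁅⁅e, v⁆, ⁅e, c⁆⁆⁆ = 0 := by rw [leibniz_lie, hu, hp]; simp
    have hfu : ⁅f, ⁅e, v⁆⁆ = (2 : ℂ) • v := t.lie_f_lie_e_bot hv
    have hfp : ⁅f, ⁅e, c⁆⁆ = (2 : ℂ) • c := t.lie_f_lie_e_bot hcc
    refine t.eq_zero_of_mem_ker hup ?_ fun y hy hy' => ?_
    · have heu : ⁅f, ⁅e, ⁅e, v⁆⁆⁆ = (2 : ℂ) • ⁅e, v⁆ := by
        have := t.lie_e_lie_f ⁅e, v⁆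
        rw [hu, hfu, add_zero, lie_smul] at this
        exact this.symm
      have hep : ⁅f, ⁅e, ⁅e, c⁆⁆⁆ = (2 : ℂ) • ⁅e, c⁆ := by
        have := t.lie_e_lie_f ⁅e, c⁆
        rw [hp, hfp, add_zero, lie_smul] at this
        exact this.symm
      have h4 : ⁅⁅e, ⁅e, v⁆⁆, ⁅e, ⁅e, c⁆⁆⁆ = 0 :=
        t.top _ (by rw [eigenvalue_lie (t.lie_e_zero hu) (t.lie_e_zero hp)]; norm_num)
      have h5 := congrArg (⁅f, ·⁆) h4
      simp only [lie_zero] at h5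
      rw [leibniz_lie, heu, hep, smul_lie, lie_smul, ← smul_add, smul_eq_zero] at h5
      rw [leibniz_lie, add_comm]
      exact h5.resolve_left two_ne_zero
    · rw [killing_lie', huk y hy hy', map_zero, neg_zero]
  refine ⟨μ, sub_eq_zero.1 (t.eq_zero_of_lie_e ?_ ?_)⟩
  · rw [lie_sub, lie_smul, hv, t.lie_h_f, smul_sub, smul_comm μ]
  · rw [lie_sub, lie_smul, t.lie_e_f, hμ, sub_self]

end ShortTriple

end ShortQuartic

section CentralizerDerived

set_option linter.unusedSectionVars false

open LieAlgebra

variable {L : Type*} [LieRing L] [LieAlgebra ℂ L] [FiniteDimensional ℂ L] [IsKilling ℂ L]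

local notation "κ" => killingForm ℂ L
local notation "tr" => LinearMap.trace ℂ L

/-- The span of the brackets of elements commuting with `e`. -/
def centralizerDerived (e : L) : Submodule ℂ L :=
  Submodule.span ℂ {z : L | ∃ x ∈ LinearMap.ker (ad ℂ L e), ∃ y ∈ LinearMap.ker (ad ℂ L e), ⁅x,
      y⁆ = z}

namespace ShortTriple

variable {h e f : L} (t : ShortTriple h e f)
include t

theorem killing_f_centralizerDerived {z : L} (hz : z ∈ centralizerDerived e) : κ f z = 0 := by
  induction hz using Submodule.span_induction with
  | mem z hz =>
    obtain ⟨x, hx, y, hy, rfl⟩ := hz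
    obtain ⟨a, b, rfl, ha, hb, hb'⟩ := t.mem_ker hx
    obtain ⟨a', b', rfl, ha', hb₁, hb₂⟩ := t.mem_ker hy
    rw [← killing_lie, lie_add, t.lie_f_ker hb hb', add_zero, map_add]
    rw [killing_eq_zero_of_eigenvalue (h := h) (a := 0) (b := 2) (by simpa using t.lie_f_top ha) ha'
      (by norm_num), zero_add, killing_lie', t.lie_f_ker hb₁ hb₂, map_zero, neg_zero]
  | zero => rw [map_zero]
  | add x y _ _ hx hy => rw [map_add, hx, hy, add_zero]
  | smul c x _ hx => rw [map_smul, hx, smul_zero]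

theorem mem_centralizerDerived (hQ : ∀ a b c d : L, quarticDefect a b c d = 0) (hB : κ h h = 216)
    {w : L} (hw : ⁅e, w⁆ = 0) (hfw : κ f w = 0) : w ∈ centralizerDerived e := by
  refine mem_of_killing _ _ fun z hz => ?_
  have hz' : ∀ x y : L, ⁅e, x⁆ = 0 → ⁅e, y⁆ = 0 → κ z ⁅x, y⁆ = 0 := fun x y hx hy =>
    hz _ (Submodule.subset_span ⟨x, hx, y, hy, rfl⟩)
  obtain ⟨a, b, c, rfl, ha, hb, hc⟩ := t.dec z
  obtain ⟨p, -, rfl⟩ := t.exists_lie_e ha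
  obtain ⟨q, d, rfl, hq, hq', hd⟩ := t.exists_ker_add hb
  have hab : ∀ x y : L, ⁅e, x⁆ = 0 → ⁅e, y⁆ = 0 → κ q ⁅x, y⁆ + κ c ⁅x, y⁆ = 0 := by
    intro x y hx hy
    have hxy : ⁅e, ⁅x, y⁆⁆ = 0 := by rw [leibniz_lie, hx, hy]; simp
    have := hz' x y hx hy
    simp only [map_add, LinearMap.add_apply] at this
    rw [killing_comm ⁅e, p⁆, killing_comm ⁅e, d⁆, killing_ker_lie_e hxy, killing_ker_lie_e hxy]
      at this
    linear_combination this
  have hq0 : q = 0 := by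
    refine t.eq_zero_of_central_ker hQ hB hq hq' fun x hx hx' => ?_
    refine t.eq_zero_of_mem_ker (by rw [leibniz_lie, hq, hx]; simp)
      (by rw [leibniz_lie, hq', hx']; simp) fun y hy hy' => ?_
    have h1 := hab x y hx' hy'
    rwa [killing_eq_zero_of_eigenvalue (x := c) (y := ⁅x, y⁆) (h := h) (a := -2) (b := 0) hc
      (by rw [leibniz_lie, hx, hy]; simp) (by norm_num), add_zero, ← killing_lie] at h1
  obtain ⟨μ, rfl⟩ := t.eq_smul_of_lie_ker hQ hB hc fun x hx hx' => by
    refine killing_ext_eigenspace (h := h) (a := -2) t.slTwoRep.iSup_eigenspace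
      (x := ⁅x, c⁆) ?_ fun y hy => ?_
    · rw [leibniz_lie, hx, hc, zero_lie, zero_add, lie_smul]; norm_num
    · have hy2 : ⁅h, y⁆ = (2 : ℂ) • y := by rw [hy]; norm_num
      have h1 := hab x y hx' (t.lie_e_top hy2)
      rw [hq0, map_zero, LinearMap.zero_apply, zero_add] at h1
      rw [killing_lie', h1, neg_zero]
  simp only [map_add, LinearMap.add_apply, hq0, map_smul,
    LinearMap.smul_apply, hfw, smul_zero, add_zero, zero_add]
  rw [killing_comm ⁅e, p⁆, killing_comm ⁅e, d⁆, killing_ker_lie_e hw, killing_ker_lie_e hw,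
    add_zero]

theorem finrank_centralizerDerived (hQ : ∀ a b c d : L, quarticDefect a b c d = 0)
    (hB : κ h h = 216) :
    finrank ℂ (centralizerDerived e) + 1 = finrank ℂ (LinearMap.ker (ad ℂ L e)) ∧
      e ∉ centralizerDerived e := by
  have hef : κ f e = 108 := by
    have := t.killing_e_f
    rw [hB, killing_comm] at this
    linear_combination -this / 2
  refine ⟨?_, fun he => ?_⟩
  · let φ : LinearMap.ker (ad ℂ L e) →ₗ[ℂ] ℂ := κ f ∘ₗ Submodule.subtype _
    have h1 : centralizerDerived e = (LinearMap.ker φ).map (Submodule.subtype _) := by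
      refine le_antisymm (fun z hz => ?_) ?_
      · have : centralizerDerived e ≤ LinearMap.ker (ad ℂ L e) := by
          refine Submodule.span_le.2 ?_
          rintro _ ⟨x, hx, y, hy, rfl⟩
          simp only [SetLike.mem_coe, LinearMap.mem_ker, ad_apply] at *
          rw [leibniz_lie, hx, hy]; simp
        exact ⟨⟨z, this hz⟩, t.killing_f_centralizerDerived hz, rfl⟩
      · rintro _ ⟨⟨z, hz⟩, hz', rfl⟩
        exact t.mem_centralizerDerived hQ hB hz hz'
    have h2 := LinearMap.finrank_range_add_finrank_ker φ
    have h3 : LinearMap.range φ = ⊤ := by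
      refine LinearMap.range_eq_top.2 fun c => ⟨⟨(c / 108) • e, by simp⟩, ?_⟩
      simp only [φ, LinearMap.comp_apply, Submodule.subtype_apply, map_smul, hef, smul_eq_mul]
      ring
    rw [h3, finrank_top, finrank_self] at h2
    rw [h1, LinearEquiv.finrank_eq (Submodule.equivMapOfInjective _ (Submodule.injective_subtype _)
      (LinearMap.ker φ)).symm]
    omega
  · have := t.killing_f_centralizerDerived he
    rw [hef] at this
    norm_num at this

end ShortTriple

theorem finrank_centralizerDerived (hdim : finrank ℂ L = 133)
    (hQ : ∀ a b c d : L, quarticDefect a b c d = 0) {e : L} (hnil : IsNilpotent (ad ℂ L e))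
    (hker : finrank ℂ (LinearMap.ker (ad ℂ L e)) = 79) :
    finrank ℂ (centralizerDerived e) = 78 ∧ e ∉ centralizerDerived e := by
  have he : e ≠ 0 := by
    rintro rfl
    rw [map_zero, LinearMap.ker_zero, finrank_top, hdim] at hker
    norm_num at hker
  obtain ⟨h, f, t⟩ := jacobson_morozov he hnil
  have hq : 54 * tr (ad ℂ L h ^ 4) = tr (ad ℂ L h ^ 2) ^ 2 := by
    have := hQ h h h h
    rw [quarticDefect, killing_eq_trace] at this
    simp only [pow_succ, pow_zero, one_mul] at *
    linear_combination this / 3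
  have htop := t.slTwoRep.iSup_eigenspace
  obtain ⟨-, h1, h2, hN⟩ | ⟨-, h1, h2, h3, hN⟩ := t.finrank_eigenspace hdim hker hq _ fun n => rfl
  · have hbound := eigenvalue_bound htop 2 hN
    have hone : ∀ i : ℤ, |i| = 1 → (ad ℂ L h).eigenspace (i : ℂ) = ⊥ := by
      intro i hi
      have h1' : finrank ℂ ((ad ℂ L h).eigenspace ((1 : ℤ) : ℂ)) = 0 := by exact_mod_cast h1
      rw [← Submodule.finrank_eq_zero (R := ℂ)]
      rcases (abs_eq one_pos.le).1 hi with rfl | rfl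
      · exact h1'
      · rw [finrank_eigenspace_neg htop, h1']
    have hfour : ∀ i : ℤ, 2 < |i| → ∀ v : L, ⁅h, v⁆ = (i : ℂ) • v → v = 0 := by
      intro i hi v hv
      by_contra hv0
      exact absurd (hbound i fun hbot => hv0 <| (Submodule.eq_bot_iff _).1 hbot v
        (End.mem_eigenspace_iff.2 hv)) (not_le.2 hi)
    have ht : ShortTriple h e f := by
      refine { t with dec := fun w => ?_, top := fun v hv => hfour 4 (by decide) v ?_,
                      bot := fun v hv => hfour (-4) (by decide) v ?_ }
      · have hw : w ∈ (ad ℂ L h).eigenspace 2 ⊔ (ad ℂ L h).eigenspace 0 ⊔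
            (ad ℂ L h).eigenspace (-2) := by
          have : (⊤ : Submodule ℂ L) ≤ (ad ℂ L h).eigenspace 2 ⊔ (ad ℂ L h).eigenspace 0 ⊔
            (ad ℂ L h).eigenspace (-2) := by
            rw [← htop]
            refine iSup_le fun i => ?_
            by_cases hi : (ad ℂ L h).eigenspace (i : ℂ) = ⊥
            · rw [hi]; exact bot_le
            have hi1 : |i| ≠ 1 := fun h' => hi (hone i h')
            obtain ⟨hl, hr⟩ := abs_le.1 (hbound i hi)
            have : i = 2 ∨ i = 0 ∨ i = -2 := by
              push_cast at hl hr
              interval_cases i <;> simp_all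
            rcases this with rfl | rfl | rfl
            · exact le_sup_of_le_left (le_sup_of_le_left (by norm_num))
            · exact le_sup_of_le_left (le_sup_of_le_right (by norm_num))
            · exact le_sup_of_le_right (by norm_num)
          exact this Submodule.mem_top
        obtain ⟨y, hy, c, hc, rfl⟩ := Submodule.mem_sup.1 hw
        obtain ⟨a, ha, b, hb, rfl⟩ := Submodule.mem_sup.1 hy
        exact ⟨a, b, c, rfl, End.mem_eigenspace_iff.1 ha,
          by simpa using End.mem_eigenspace_iff.1 hb, End.mem_eigenspace_iff.1 hc⟩
      · rw [hv]; norm_num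
      · rw [hv]; norm_num
    have hB : κ h h = 216 := by
      rw [t.killing_self 2 _ (fun n => rfl) hN, Finset.sum_range_succ, Finset.sum_range_one]
      simp only [h1, h2, Nat.reduceAdd]
      norm_num
    have := ht.finrank_centralizerDerived hQ hB
    rw [hker] at this
    exact ⟨by omega, this.2⟩
  · exact (t.not_finrank_eigenspace_three hQ _ (fun n => rfl) h1 h2 h3 hN).elim

end CentralizerDerived

section BasisIsKilling

open LieAlgebra

variable {ι L : Type*} [Fintype ι] [LieRing L] [LieAlgebra ℂ L]
  {H : LieSubalgebra ℂ L} (b : LieAlgebra.Basis ι H)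

/-- The sum of the eigenspaces of `ad h` with eigenvalues in `s * ℕ`, where `s = 2` or `s = -2`. -/
theorem lieSpan_le_iSup_eigenspace (h : L) (s : ℤ) (S : Set L)
    (hS : ∀ x ∈ S, ⁅h, x⁆ = (s : ℂ) • x) {x : L} (hx : x ∈ LieSubalgebra.lieSpan ℂ L S) :
    x ∈ ⨆ k : ℕ, (ad ℂ L h).eigenspace (((k + 1) * s : ℤ) : ℂ) := by
  induction hx using LieSubalgebra.lieSpan_induction with
  | mem x hx =>
    refine Submodule.mem_iSup_of_mem 0 (End.mem_eigenspace_iff.2 ?_)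
    simpa using hS x hx
  | zero => exact zero_mem _
  | add x y _ _ hx hy => exact add_mem hx hy
  | smul c x _ hx => exact Submodule.smul_mem _ _ hx
  | lie x y hx' hy' hx hy =>
    clear hx' hy'
    induction hx using Submodule.iSup_induction' with
    | mem i x hx =>
      induction hy using Submodule.iSup_induction' with
      | mem j y hy =>
        refine Submodule.mem_iSup_of_mem (i + j + 1) (End.mem_eigenspace_iff.2 ?_)
        rw [ad_apply, eigenvalue_lie (End.mem_eigenspace_iff.1 hx) (End.mem_eigenspace_iff.1 hy)]
        push_cast
        module
      | zero => rw [lie_zero]; exact zero_mem _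
      | add y y' _ _ hy hy' => rw [lie_add]; exact add_mem hy hy'
    | zero => rw [zero_lie]; exact zero_mem _
    | add x x' _ _ hx hx' => rw [add_lie]; exact add_mem hx hx'

theorem mem_iSup_ne_of_mem_iSup_comp {ι₁ ι₂ : Type*} {g : ι₂ → Submodule ℂ L} {ν : ι₁ → ι₂} {μ : ι₂}
    {x : L} (hx : x ∈ ⨆ k, g (ν k)) (h : ∀ k, ν k ≠ μ) : x ∈ ⨆ (i) (_ : i ≠ μ), g i :=
  (iSup_le fun k => le_iSup₂_of_le (ν k) (h k) le_rfl :
    ⨆ k, g (ν k) ≤ ⨆ (i) (_ : i ≠ μ), g i) hx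

namespace LieAlgebra.Basis

theorem exists_add_add (x : L) : ∃ x₀ ∈ H, ∃ x₁ ∈ LieSubalgebra.lieSpan ℂ L (Set.range b.f),
    ∃ x₂ ∈ LieSubalgebra.lieSpan ℂ L (Set.range b.e), x = x₀ + x₁ + x₂ := by
  have h1 : x ∈ H.toLieSubmodule ⊔ b.borelLower ⊔ b.borelUpper := by
    have := b.iSup_cartan_borelLower_borelUpper_eq_top
    have h2 : H.toLieSubmodule ⊔ b.borelLower ⊔ b.borelUpper = ⊤ := by simpa using this
    rw [h2]; exact LieSubmodule.mem_top _
  obtain ⟨y, hy, x₂, hx₂, rfl⟩ := (LieSubmodule.mem_sup _ _ _).1 h1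
  obtain ⟨x₀, hx₀, x₁, hx₁, rfl⟩ := (LieSubmodule.mem_sup _ _ _).1 hy
  exact ⟨x₀, hx₀, x₁, hx₁, x₂, hx₂, rfl⟩

theorem exists_lie_e_ne_zero [FiniteDimensional ℂ L] {x : L} (hx : x ∈ H) (h0 : x ≠ 0) :
    ∃ i, ∃ c : ℂ, c ≠ 0 ∧ ⁅x, b.e i⁆ = c • b.e i := by
  by_contra! hcon
  have h1 : ∀ i, b.baseSupp i ⟨x, hx⟩ = 0 := by
    intro i
    by_contra hi
    exact hcon i _ hi (by rw [b.baseSupp_apply_smul_e]; rfl)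
  have hfin : finrank ℂ H = Fintype.card ι := by
    have := finrank_span_eq_card b.linInd
    rw [← b.coe_cartan_eq_span] at this
    exact this
  have hspan := b.linearIndependent_baseSupp.span_eq_top_of_card_eq_finrank'
    (by rw [Subspace.dual_finrank_eq, hfin])
  refine h0 (congrArg Subtype.val ((Module.forall_dual_apply_eq_zero_iff ℂ (⟨x, hx⟩ : H)).1
    fun φ => ?_))
  have hφ : φ ∈ Submodule.span ℂ (Set.range b.baseSupp) := by rw [hspan]; trivial
  induction hφ using Submodule.span_induction with
  | mem φ hφ => obtain ⟨i, rfl⟩ := hφ; exact h1 i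
  | zero => rfl
  | add φ ψ _ _ hφ hψ => rw [LinearMap.add_apply, hφ, hψ, add_zero]
  | smul c φ _ hφ => rw [LinearMap.smul_apply, hφ, smul_zero]

theorem isKilling [FiniteDimensional ℂ L] [Nonempty ι] (c : ι → ℤ)
    (hc : ∀ i, ∑ j, b.A i j * c j = 2) : IsKilling ℂ L := by
  classical
  set h := ∑ j, c j • b.h j with hh
  set e := ∑ j, b.e j with he
  set f := ∑ j, c j • b.f j with hf
  have hhe : ∀ i, ⁅h, b.e i⁆ = (2 : ℂ) • b.e i := by
    intro i
    have : (2 : ℂ) • b.e i = (2 : ℤ) • b.e i := by rw [two_smul, two_smul]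
    rw [this, ← hc i, hh, sum_lie, Finset.sum_smul]
    refine Finset.sum_congr rfl fun j _ => ?_
    rw [zsmul_lie, b.lie_h_e, smul_smul, mul_comm]
  have hhf : ∀ i, ⁅h, b.f i⁆ = (-2 : ℂ) • b.f i := by
    intro i
    have : (-2 : ℂ) • b.f i = -((2 : ℤ) • b.f i) := by rw [neg_smul, two_smul, two_smul]
    rw [this, ← hc i, hh, sum_lie, Finset.sum_smul, ← Finset.sum_neg_distrib]
    refine Finset.sum_congr rfl fun j _ => ?_
    rw [zsmul_lie, b.lie_h_f, smul_smul, mul_neg, neg_smul, mul_comm]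
  have t : IsSl2Triple h e f := by
    refine ⟨fun h0 => ?_, ?_, ?_, ?_⟩
    · obtain ⟨i⟩ := ‹Nonempty ι›
      have := hhe i
      rw [h0, zero_lie, eq_comm, smul_eq_zero] at this
      exact (b.sl2 i).e_ne_zero (this.resolve_left two_ne_zero)
    · rw [he, hf, sum_lie, hh]
      refine Finset.sum_congr rfl fun i _ => ?_
      rw [lie_sum, Finset.sum_eq_single i]
      · rw [lie_zsmul, (b.sl2 i).lie_e_f]
      · intro j _ hj
        rw [lie_zsmul, b.lie_e_f_ne _ _ hj.symm, smul_zero]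
      · simp
    · rw [he, lie_sum, Finset.smul_sum]
      refine Finset.sum_congr rfl fun i _ => ?_
      rw [hhe, two_smul, two_smul]
    · rw [hf, lie_sum, Finset.smul_sum, ← Finset.sum_neg_distrib]
      refine Finset.sum_congr rfl fun i _ => ?_
      rw [lie_zsmul, hhf, neg_smul, two_smul, two_smul, smul_neg, smul_add]
  have hupper : ∀ x ∈ LieSubalgebra.lieSpan ℂ L (Set.range b.e),
      x ∈ ⨆ k : ℕ, (ad ℂ L h).eigenspace (((k + 1) * 2 : ℤ) : ℂ) := fun x hx =>
    lieSpan_le_iSup_eigenspace h 2 _ (by rintro _ ⟨i, rfl⟩; simpa using hhe i) hx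
  have hlower : ∀ x ∈ LieSubalgebra.lieSpan ℂ L (Set.range b.f),
      x ∈ ⨆ k : ℕ, (ad ℂ L h).eigenspace (((k + 1) * (-2) : ℤ) : ℂ) := fun x hx =>
    lieSpan_le_iSup_eigenspace h (-2) _ (by rintro _ ⟨i, rfl⟩; simpa using hhf i) hx
  have hcartan : ∀ x ∈ H, ⁅h, x⁆ = 0 := by
    have hab := b.isLieAbelian_cartan
    have hhH : h ∈ H := sum_mem fun i _ => zsmul_mem (b.h' i).2 _
    intro x hx
    exact congrArg Subtype.val (hab.trivial ⟨h, hhH⟩ ⟨x, hx⟩)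
  have hindep := (ad ℂ L h).eigenspaces_iSupIndep
  have hbot : ∀ μ : ℂ, (∀ k : ℤ, μ ≠ (k * 2 : ℤ)) → (ad ℂ L h).eigenspace μ = ⊥ := by
    intro μ hμ
    have h1 : (⊤ : Submodule ℂ L) ≤ ⨆ (ν : ℂ) (_ : ν ≠ μ), (ad ℂ L h).eigenspace ν := by
      intro x _
      obtain ⟨x₀, hx₀, x₁, hx₁, x₂, hx₂, rfl⟩ := b.exists_add_add x
      refine add_mem (add_mem ?_ ?_) ?_
      · refine Submodule.mem_iSup_of_mem 0 (Submodule.mem_iSup_of_mem ?_ ?_)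
        · simpa using (hμ 0).symm
        · exact End.mem_eigenspace_iff.2 (by rw [ad_apply, hcartan _ hx₀, zero_smul])
      · exact mem_iSup_ne_of_mem_iSup_comp (hlower _ hx₁) 
          fun k => by rw [← neg_mul_comm]; exact (hμ _).symm
      · exact mem_iSup_ne_of_mem_iSup_comp (hupper _ hx₂) fun k => (hμ _).symm
    have := hindep μ
    rw [top_le_iff.1 h1, disjoint_top] at this
    exact this
  have hzero : ∀ x, ⁅h, x⁆ = 0 → x ∈ H := by
    intro x hx
    obtain ⟨x₀, hx₀, x₁, hx₁, x₂, hx₂, rfl⟩ := b.exists_add_add x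
    have h1 : x₁ + x₂ ∈ ⨆ (ν : ℂ) (_ : ν ≠ 0), (ad ℂ L h).eigenspace ν := by
      refine add_mem ?_ ?_
      · exact mem_iSup_ne_of_mem_iSup_comp (hlower _ hx₁) fun k => by norm_cast; omega
      · exact mem_iSup_ne_of_mem_iSup_comp (hupper _ hx₂) fun k => by norm_cast
    have h2 : x₁ + x₂ ∈ (ad ℂ L h).eigenspace 0 := by
      rw [End.mem_eigenspace_iff, ad_apply, zero_smul]
      rw [add_assoc, lie_add, hcartan _ hx₀, zero_add] at hx
      exact hx
    have h3 : x₁ + x₂ = 0 := Submodule.disjoint_def.1 (hindep 0) _ h2 h1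
    rw [add_assoc, h3, add_zero]
    exact hx₀
  suffices HasTrivialRadical ℂ L from inferInstance
  refine (hasTrivialRadical_iff_no_abelian_ideals ℂ L).2 fun I hI => ?_
  have hI0 : ∀ x ∈ I, ⁅h, x⁆ = 0 → x = 0 := by
    intro x hx hhx
    by_contra h0
    obtain ⟨i, r, hr, hi⟩ := b.exists_lie_e_ne_zero (hzero x hhx) h0
    have hei : b.e i ∈ I := by
      have : r • b.e i ∈ I := hi ▸ lie_mem_left ℂ L I x _ hx
      exact (I.toSubmodule.smul_mem_iff hr).1 this
    have hhi : b.h i ∈ I := (b.sl2 i).lie_e_f ▸ lie_mem_left ℂ L I _ _ hei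
    have h2 := congrArg Subtype.val (hI.trivial ⟨_, hhi⟩ ⟨_, hei⟩)
    have h3 := (b.sl2 i).lie_h_e_smul ℂ
    rw [show ⁅b.h i, b.e i⁆ = 0 from h2, eq_comm, smul_eq_zero] at h3
    exact (b.sl2 i).e_ne_zero (h3.resolve_left two_ne_zero)
  have hneg : ∀ (k : ℕ) (x : L), x ∈ I → ⁅h, x⁆ = ((-(k * 2 : ℤ) : ℤ) : ℂ) • x → x = 0 := by
    intro k
    induction k with
    | zero => exact fun x hx hhx => hI0 x hx (by simpa using hhx)
    | succ k ih =>
      intro x hx hhx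
      refine t.slTwoRep.e_injective (i := -((k + 1 : ℕ) * 2 : ℤ)) (by push_cast; omega) ?_ hhx
      refine ih _ (lie_mem_right ℂ L I _ _ hx) ?_
      rw [ad_apply, eigenvalue_lie (t.lie_h_e_smul ℂ) hhx]
      push_cast; module
  have hpos : ∀ (k : ℕ) (x : L), x ∈ I → ⁅h, x⁆ = ((k * 2 : ℤ) : ℂ) • x → x = 0 := by
    intro k
    induction k with
    | zero => exact fun x hx hhx => hI0 x hx (by simpa using hhx)
    | succ k ih =>
      intro x hx hhx
      refine t.symm.slTwoRep.e_injective (i := -((k + 1 : ℕ) * 2 : ℤ)) (by push_cast; omega) ?_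
        (by rw [ad_apply, neg_lie, hhx]; push_cast; module)
      refine ih _ (lie_mem_right ℂ L I _ _ hx) ?_
      rw [ad_apply, eigenvalue_lie (a := -2) (by rw [t.lie_lie_smul_f ℂ, neg_smul]) hhx]
      push_cast; module
  rw [← LieSubmodule.toSubmodule_eq_bot]
  have htop : ⨆ μ : ℂ, (ad ℂ L h).genEigenspace μ 1 = ⊤ := t.slTwoRep.iSup_eigenspace_complex
  rw [Submodule.eq_iSup_inf_genEigenspace (f := ad ℂ L h) 1
    (fun x hx => lie_mem_right ℂ L I h x hx) htop, iSup_eq_bot]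
  intro μ
  rw [Submodule.eq_bot_iff]
  rintro x ⟨hxI, hx⟩
  have hx' : x ∈ (ad ℂ L h).eigenspace μ := hx
  by_cases hμ : ∃ k : ℤ, μ = (k * 2 : ℤ)
  · obtain ⟨k, rfl⟩ := hμ
    obtain ⟨n, rfl | rfl⟩ := k.eq_nat_or_neg
    · exact hpos n x hxI (End.mem_eigenspace_iff.1 hx')
    · exact hneg n x hxI (by rw [← neg_mul]; exact End.mem_eigenspace_iff.1 hx')
  · push Not at hμ
    rw [hbot μ hμ] at hx'
    exact hx'

end LieAlgebra.Basis

end BasisIsKilling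

section QuarticInvariance

open LieAlgebra

variable {L : Type*} [LieRing L] [LieAlgebra ℂ L]

local notation "κ" => killingForm ℂ L
local notation "tr" => LinearMap.trace ℂ L

theorem trace_cycle₄ (A B C D : End ℂ L) : tr (A * B * C * D) = tr (B * C * D * A) := by
  rw [mul_assoc, mul_assoc, LinearMap.trace_mul_comm]
  simp only [mul_assoc]

theorem trace_lie_invariant (y a b c d : L) :
    tr (ad ℂ L ⁅y, a⁆ * ad ℂ L b * ad ℂ L c * ad ℂ L d) +
    tr (ad ℂ L a * ad ℂ L ⁅y, b⁆ * ad ℂ L c * ad ℂ L d) +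
    tr (ad ℂ L a * ad ℂ L b * ad ℂ L ⁅y, c⁆ * ad ℂ L d) +
    tr (ad ℂ L a * ad ℂ L b * ad ℂ L c * ad ℂ L ⁅y, d⁆) = 0 := by
  simp only [ad_lie_eq, mul_sub, sub_mul, map_sub]
  have := LinearMap.trace_mul_comm ℂ (ad ℂ L y) (ad ℂ L a * ad ℂ L b * ad ℂ L c * ad ℂ L d)
  simp only [← mul_assoc] at this ⊢
  linear_combination this

theorem killing_lie_invariant (y a b : L) : κ ⁅y, a⁆ b + κ a ⁅y, b⁆ = 0 := by
  rw [killing_lie']; ring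

theorem quarticDefect_lie (y a b c d : L) : quarticDefect ⁅y, a⁆ b c d + quarticDefect a ⁅y, b⁆ c
    d +
    quarticDefect a b ⁅y, c⁆ d + quarticDefect a b c ⁅y, d⁆ = 0 := by
  simp only [quarticDefect]
  linear_combination 27 * (trace_lie_invariant y a b c d + trace_lie_invariant y a b d c +
    trace_lie_invariant y a c b d + trace_lie_invariant y a c d b + trace_lie_invariant y a d b c +
    trace_lie_invariant y a d c b) - κ c d * killing_lie_invariant y a b -
    κ a b * killing_lie_invariant y c d - κ b d * killing_lie_invariant y a c -
    κ a c * killing_lie_invariant y b d - κ b c * killing_lie_invariant y a d -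
    κ a d * killing_lie_invariant y b c

theorem quarticDefect_swap_left (a b c d : L) : quarticDefect a b c d = quarticDefect b a c d := by
  simp only [quarticDefect]
  have h (a b c d : L) : tr (ad ℂ L a * ad ℂ L b * ad ℂ L c * ad ℂ L d) =
      tr (ad ℂ L c * ad ℂ L d * ad ℂ L a * ad ℂ L b) := by
    rw [trace_cycle₄, trace_cycle₄]
  have h' := trace_cycle₄ (L := L)
  rw [killing_comm b a]
  linear_combination 27 * (h a b c d + h a b d c + h c d b a + h d c b a +
    h' (ad ℂ L a) (ad ℂ L c) (ad ℂ L b) (ad ℂ L d) + h' (ad ℂ L c) (ad ℂ L b) (ad ℂ L d) (ad ℂ L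
        a) +
    h' (ad ℂ L a) (ad ℂ L d) (ad ℂ L b) (ad ℂ L c) + h' (ad ℂ L d) (ad ℂ L b) (ad ℂ L c) (ad ℂ L
        a) +
    h' (ad ℂ L a) (ad ℂ L c) (ad ℂ L d) (ad ℂ L b) + h' (ad ℂ L a) (ad ℂ L d) (ad ℂ L c) (ad ℂ L
        b) -
    h' (ad ℂ L b) (ad ℂ L c) (ad ℂ L d) (ad ℂ L a) - h' (ad ℂ L b) (ad ℂ L d) (ad ℂ L c) (ad ℂ L a))

theorem quarticDefect_swap (a b c d : L) : quarticDefect a b c d = quarticDefect a c b d := by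
  simp only [quarticDefect]
  rw [killing_comm b c]
  ring

theorem quarticDefect_swap_right (a b c d : L) : quarticDefect a b c d = quarticDefect a b d c := by
  simp only [quarticDefect]
  rw [killing_comm c d]
  ring

theorem quarticDefect_add (a b c x y : L) :
    quarticDefect a b c (x + y) = quarticDefect a b c x + quarticDefect a b c y := by
  simp only [quarticDefect, map_add, mul_add, add_mul]
  ring

theorem quarticDefect_smul (a b c x : L) (r : ℂ) :
    quarticDefect a b c (r • x) = r * quarticDefect a b c x := by
  simp only [quarticDefect, map_smul, mul_smul_comm, smul_mul_assoc, smul_eq_mul]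
  ring

theorem quarticDefect_rotate (a b c d : L) : quarticDefect a b c d = quarticDefect b c d a := by
  rw [quarticDefect_swap_left, quarticDefect_swap, quarticDefect_swap_right]

/-- An invariant symmetric quartic form vanishes if it vanishes on a Cartan subalgebra. -/
theorem quarticDefect_eq_zero (H : Submodule ℂ L) (hab : ∀ x ∈ H, ∀ y ∈ H, ⁅x, y⁆ = 0)
    (hspan : Submodule.span ℂ ((H : Set L) ∪ {e | ∃ α : L → ℂ, (∀ x ∈ H, ⁅x, e⁆ = α x • e) ∧
      ∃ t ∈ H, α t = 1}) = ⊤)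
    (h0 : ∀ a ∈ H, ∀ b ∈ H, ∀ c ∈ H, ∀ d ∈ H, quarticDefect a b c d = 0) (a b c d : L) :
    quarticDefect a b c d = 0 := by
  have hind : ∀ a b c : L, (∀ x ∈ H, quarticDefect a b c x = 0) →
      (∀ (e : L) (α : L → ℂ), (∀ x ∈ H, ⁅x, e⁆ = α x • e) → ∀ t ∈ H, α t = 1 →
        quarticDefect a b c e = 0) → ∀ x, quarticDefect a b c x = 0 := by
    intro a b c h1 h2 x
    have hx : x ∈ Submodule.span ℂ ((H : Set L) ∪ {e | ∃ α : L → ℂ,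
      (∀ x ∈ H, ⁅x, e⁆ = α x • e) ∧ ∃ t ∈ H, α t = 1}) := hspan ▸ Submodule.mem_top
    induction hx using Submodule.span_induction with
    | mem x hx =>
      rcases hx with hx | ⟨α, hα, t, ht, hαt⟩
      · exact h1 x hx
      · exact h2 x α hα t ht hαt
    | zero => simpa using quarticDefect_smul a b c 0 0
    | add x y _ _ hx hy => rw [quarticDefect_add, hx, hy, add_zero]
    | smul r x _ hx => rw [quarticDefect_smul, hx, mul_zero]
  have hsw : ∀ {e : L} {α : L → ℂ}, (∀ x ∈ H, ⁅x, e⁆ = α x • e) → ∀ x ∈ H, ⁅e, x⁆ = (-α x) • e :=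
    fun {e α} hα x hx => by rw [← lie_skew, hα x hx, neg_smul]
  have hz : ∀ a b c : L, quarticDefect a b c 0 = 0 := fun a b c => by
    simpa using quarticDefect_smul a b c 0 0
  have hz₁ : ∀ a b c : L, quarticDefect 0 a b c = 0 := fun a b c => by
    rw [quarticDefect_rotate, hz]
  have hz₂ : ∀ a b c : L, quarticDefect a 0 b c = 0 := fun a b c => by
    rw [quarticDefect_rotate, hz₁]
  have hz₃ : ∀ a b c : L, quarticDefect a b 0 c = 0 := fun a b c => by
    rw [quarticDefect_rotate, hz₂]
  have hm₁ : ∀ (r : ℂ) (a b c x : L), quarticDefect (r • x) a b c = r * quarticDefect a b c x :=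
    fun r a b c x => by rw [quarticDefect_rotate, quarticDefect_smul]
  have hm₂ : ∀ (r : ℂ) (a b c x : L), quarticDefect a (r • x) b c = r * quarticDefect a b c x :=
    fun r a b c x => by
      rw [quarticDefect_swap_left, hm₁]
  have hm₃ : ∀ (r : ℂ) (a b c x : L), quarticDefect a b (r • x) c = r * quarticDefect a b c x :=
    fun r a b c x => by
      rw [quarticDefect_swap_right, quarticDefect_smul]
  have s1 : ∀ a ∈ H, ∀ b ∈ H, ∀ c ∈ H, ∀ x, quarticDefect a b c x = 0 := by
    intro a ha b hb c hc
    refine hind a b c (h0 a ha b hb c hc) fun e α hα t ht hαt => ?_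
    have := quarticDefect_lie t a b c e
    rwa [hab t ht a ha, hab t ht b hb, hab t ht c hc, hα t ht, hαt, one_smul, hz₁, hz₂, hz₃,
      zero_add, zero_add, zero_add] at this
  have s2 : ∀ a ∈ H, ∀ b ∈ H, ∀ x y, quarticDefect a b x y = 0 := by
    intro a ha b hb x
    refine fun y => (quarticDefect_swap_right a b x y).trans (hind a b y (fun x hx => ?_) ?_ x)
    · rw [quarticDefect_swap_right, s1 a ha b hb x hx]
    intro e α hα t ht hαt
    have key : ∀ p ∈ H, ∀ q ∈ H, ∀ r ∈ H, α p * quarticDefect q r y e + α q * quarticDefect p r y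
        e +
        α r * quarticDefect p q y e = 0 := by
      intro p hp q hq r hr
      have := quarticDefect_lie e p q r y
      rw [hsw hα p hp, hsw hα q hq, hsw hα r hr, hm₁, hm₂, hm₃, s1 p hp q hq r hr] at this
      linear_combination -this
    have h1 : quarticDefect t t y e = 0 := by
      have := key t ht t ht t ht
      rw [hαt] at this
      linear_combination this / 3
    have h2 : ∀ p ∈ H, quarticDefect p t y e = 0 := by
      intro p hp
      have := key p hp t ht t ht
      rw [hαt, h1] at this
      linear_combination this / 2
    have := key a ha b hb t ht
    rwa [hαt, h2 a ha, h2 b hb, mul_zero, mul_zero, zero_add, zero_add, one_mul] at this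
  have s3 : ∀ a ∈ H, ∀ x y z, quarticDefect a x y z = 0 := by
    intro a ha x y z
    rw [quarticDefect_swap, quarticDefect_swap_right]
    refine hind a y z (fun x hx => ?_) ?_ x
    · rw [quarticDefect_swap_right, quarticDefect_swap, s2 a ha x hx]
    intro e α hα t ht hαt
    have key : ∀ p ∈ H, ∀ q ∈ H, α p * quarticDefect q y z e + α q * quarticDefect p y z e = 0 := by
      intro p hp q hq
      have := quarticDefect_lie e p q y z
      rw [hsw hα p hp, hsw hα q hq, hm₁, hm₂, s2 p hp q hq, s2 p hp q hq] at this
      linear_combination -this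
    have h1 : quarticDefect t y z e = 0 := by
      have := key t ht t ht
      rw [hαt] at this
      linear_combination this / 2
    have := key a ha t ht
    rwa [hαt, h1, mul_zero, zero_add, one_mul] at this
  refine hind a b c (fun x hx => ?_) (fun e α hα t ht hαt => ?_) d
  · rw [← quarticDefect_rotate, s3 x hx]
  · have := quarticDefect_lie e t a b c
    rw [hsw hα t ht, hαt, hm₁, s3 t ht, s3 t ht, s3 t ht] at this
    linear_combination -this

end QuarticInvariance

section RootsE₇

/-- The coefficients of the positive roots of `E₇` with respect to the simple roots. -/
def posRootsE₇ : List (Fin 7 → ℤ) :=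
   [![0, 0, 0, 0, 0, 0, 1], ![0, 0, 0, 0, 0, 1, 0], ![0, 0, 0, 0, 1, 0, 0],
    ![0, 0, 0, 1, 0, 0, 0], ![0, 0, 1, 0, 0, 0, 0], ![0, 1, 0, 0, 0, 0, 0],
    ![1, 0, 0, 0, 0, 0, 0], ![0, 0, 0, 0, 0, 1, 1], ![0, 0, 0, 0, 1, 1, 0],
    ![0, 0, 0, 1, 1, 0, 0], ![0, 0, 1, 1, 0, 0, 0], ![0, 1, 0, 1, 0, 0, 0],
    ![1, 0, 1, 0, 0, 0, 0], ![0, 0, 0, 0, 1, 1, 1], ![0, 0, 0, 1, 1, 1, 0],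
    ![0, 0, 1, 1, 1, 0, 0], ![0, 1, 0, 1, 1, 0, 0], ![0, 1, 1, 1, 0, 0, 0],
    ![1, 0, 1, 1, 0, 0, 0], ![0, 0, 0, 1, 1, 1, 1], ![0, 0, 1, 1, 1, 1, 0],
    ![0, 1, 0, 1, 1, 1, 0], ![0, 1, 1, 1, 1, 0, 0], ![1, 0, 1, 1, 1, 0, 0],
    ![1, 1, 1, 1, 0, 0, 0], ![0, 0, 1, 1, 1, 1, 1], ![0, 1, 0, 1, 1, 1, 1],
    ![0, 1, 1, 1, 1, 1, 0], ![0, 1, 1, 2, 1, 0, 0], ![1, 0, 1, 1, 1, 1, 0],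
    ![1, 1, 1, 1, 1, 0, 0], ![0, 1, 1, 1, 1, 1, 1], ![0, 1, 1, 2, 1, 1, 0],
    ![1, 0, 1, 1, 1, 1, 1], ![1, 1, 1, 1, 1, 1, 0], ![1, 1, 1, 2, 1, 0, 0],
    ![0, 1, 1, 2, 1, 1, 1], ![0, 1, 1, 2, 2, 1, 0], ![1, 1, 1, 1, 1, 1, 1],
    ![1, 1, 1, 2, 1, 1, 0], ![1, 1, 2, 2, 1, 0, 0], ![0, 1, 1, 2, 2, 1, 1],
    ![1, 1, 1, 2, 1, 1, 1], ![1, 1, 1, 2, 2, 1, 0], ![1, 1, 2, 2, 1, 1, 0],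
    ![0, 1, 1, 2, 2, 2, 1], ![1, 1, 1, 2, 2, 1, 1], ![1, 1, 2, 2, 1, 1, 1],
    ![1, 1, 2, 2, 2, 1, 0], ![1, 1, 1, 2, 2, 2, 1], ![1, 1, 2, 2, 2, 1, 1],
    ![1, 1, 2, 3, 2, 1, 0], ![1, 1, 2, 2, 2, 2, 1], ![1, 1, 2, 3, 2, 1, 1],
    ![1, 2, 2, 3, 2, 1, 0], ![1, 1, 2, 3, 2, 2, 1], ![1, 2, 2, 3, 2, 1, 1],
    ![1, 1, 2, 3, 3, 2, 1], ![1, 2, 2, 3, 2, 2, 1], ![1, 2, 2, 3, 3, 2, 1],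
    ![1, 2, 2, 4, 3, 2, 1], ![1, 2, 3, 4, 3, 2, 1], ![2, 2, 3, 4, 3, 2, 1]]

/-- The simple reflections of `E₇`, in coordinates with respect to the simple roots. -/
def reflectE₇ (i : Fin 7) (n : Fin 7 → ℤ) : Fin 7 → ℤ :=
  n - (∑ j, n j * CartanMatrix.E₇ j i) • Pi.single i 1

theorem length_posRootsE₇ : posRootsE₇.length = 63 := by decide +kernel

theorem nodup_posRootsE₇ : posRootsE₇.Nodup := by decide +kernel

theorem nonneg_of_mem_posRootsE₇ : ∀ n ∈ posRootsE₇, ∀ i, 0 ≤ n i := by decide +kernel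

theorem ne_zero_of_mem_posRootsE₇ : ∀ n ∈ posRootsE₇, n ≠ 0 := by decide +kernel

theorem reflectE₇_mem : ∀ n ∈ posRootsE₇, ∀ i, n = Pi.single i 1 ∨ reflectE₇ i n ∈ posRootsE₇ := by
  decide +kernel

theorem single_mem_posRootsE₇ : ∀ i, Pi.single i 1 ∈ posRootsE₇ := by decide +kernel

theorem exists_reflectE₇_lt : ∀ n ∈ posRootsE₇, (∃ i, n = Pi.single i 1) ∨
    ∃ i, reflectE₇ i n ∈ posRootsE₇ ∧ ∑ j, reflectE₇ i n j < ∑ j, n j := by decide +kernel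

theorem posRootsE₇_quartic_of_le : ∀ i j k l : Fin 7, i ≤ j → j ≤ k → k ≤ l →
    81 * (posRootsE₇.map fun n => n i * n j * n k * n l).sum =
      (posRootsE₇.map fun n => n i * n j).sum * (posRootsE₇.map fun n => n k * n l).sum +
      (posRootsE₇.map fun n => n i * n k).sum * (posRootsE₇.map fun n => n j * n l).sum +
      (posRootsE₇.map fun n => n i * n l).sum * (posRootsE₇.map fun n => n j * n k).sum := by
  decide +kernel

theorem of_sorted_of_swap {ι : Type*} [LinearOrder ι] (P : ι → ι → ι → ι → Prop)
    (h₁ : ∀ i j k l, P i j k l → P j i k l) (h₂ : ∀ i j k l, P i j k l → P i k j l)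
    (h₃ : ∀ i j k l, P i j k l → P i j l k) (h : ∀ i j k l, i ≤ j → j ≤ k → k ≤ l → P i j k l)
    (i j k l : ι) : P i j k l := by
  have key : ∀ i j k l, i ≤ j → j ≤ k → P i j k l := by
    intro i j k l hij hjk
    rcases le_total k l with hl | hl
    · exact h i j k l hij hjk hl
    apply h₃
    rcases le_total j l with hl' | hl'
    · exact h i j l k hij hl' hl
    apply h₂
    rcases le_total i l with hl'' | hl''
    · exact h i l j k hl'' hl' hjk
    · exact h₁ _ _ _ _ (h l i j k hl'' hij hjk)
  have key' : ∀ i j k l, i ≤ j → P i j k l := by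
    intro i j k l hij
    rcases le_total j k with hl | hl
    · exact key i j k l hij hl
    apply h₂
    rcases le_total i k with hl' | hl'
    · exact key i k j l hl' hl
    · exact h₁ _ _ _ _ (key k i j l hl' hij)
  rcases le_total i j with hl | hl
  · exact key' i j k l hl
  · exact h₁ _ _ _ _ (key' j i k l hl)

theorem posRootsE₇_quartic (i j k l : Fin 7) :
    81 * (posRootsE₇.map fun n => n i * n j * n k * n l).sum =
      (posRootsE₇.map fun n => n i * n j).sum * (posRootsE₇.map fun n => n k * n l).sum +
      (posRootsE₇.map fun n => n i * n k).sum * (posRootsE₇.map fun n => n j * n l).sum +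
      (posRootsE₇.map fun n => n i * n l).sum * (posRootsE₇.map fun n => n j * n k).sum := by
  have h₂ (i j : Fin 7) : (posRootsE₇.map fun n => n i * n j) = posRootsE₇.map fun n => n j * n i :=
    List.map_congr_left fun n _ => mul_comm _ _
  refine of_sorted_of_swap (fun i j k l => 81 * (posRootsE₇.map fun n => n i * n j * n k * n
      l).sum =
      (posRootsE₇.map fun n => n i * n j).sum * (posRootsE₇.map fun n => n k * n l).sum +
      (posRootsE₇.map fun n => n i * n k).sum * (posRootsE₇.map fun n => n j * n l).sum +
      (posRootsE₇.map fun n => n i * n l).sum * (posRootsE₇.map fun n => n j * n k).sum)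
    (fun i j k l h => ?_) (fun i j k l h => ?_) (fun i j k l h => ?_) posRootsE₇_quartic_of_le i
        j k l
  · have h₄ : (posRootsE₇.map fun n => n j * n i * n k * n l) =
        posRootsE₇.map fun n => n i * n j * n k * n l := List.map_congr_left fun n _ => by ring
    rw [h₄, h, h₂ j i]
    ring
  · have h₄ : (posRootsE₇.map fun n => n i * n k * n j * n l) =
        posRootsE₇.map fun n => n i * n j * n k * n l := List.map_congr_left fun n _ => by ring
    rw [h₄, h, h₂ k j]
    ring
  · have h₄ : (posRootsE₇.map fun n => n i * n j * n l * n k) =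
        posRootsE₇.map fun n => n i * n j * n k * n l := List.map_congr_left fun n _ => by ring
    rw [h₄, h, h₂ l k]
    ring

end RootsE₇

section RootCoefficients

set_option linter.unusedSectionVars false

open LieAlgebra LieAlgebra.IsKilling LieModule

variable {L : Type*} [LieRing L] [LieAlgebra ℂ L] [FiniteDimensional ℂ L] [IsKilling ℂ L]
  {H : LieSubalgebra ℂ L} [H.IsCartanSubalgebra] {ι : Type*} [Fintype ι] [DecidableEq ι]
  (b : LieAlgebra.Basis ι H)

/-- The linear form with the given integral coefficients with respect to the simple roots. -/
noncomputable def LieAlgebra.Basis.form : (ι → ℤ) →+ Dual ℂ H where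
  toFun n := ∑ i, n i • b.baseSupp i
  map_zero' := by simp
  map_add' m n := by simp [add_smul, Finset.sum_add_distrib]

theorem LieAlgebra.Basis.form_apply (n : ι → ℤ) : b.form n = ∑ i, n i • b.baseSupp i := rfl

theorem LieAlgebra.Basis.form_single (i : ι) (c : ℤ) :
    b.form (Pi.single i c) = c • b.baseSupp i := by
  rw [b.form_apply, Finset.sum_eq_single i]
  · simp
  · intro j _ hj
    simp [hj]
  · simp

theorem LieAlgebra.Basis.form_injective : Function.Injective b.form := by
  rw [injective_iff_map_eq_zero]
  intro n hn
  have h := Fintype.linearIndependent_iff.mp b.linearIndependent_baseSupp (fun i => (n i : ℂ))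
    (by simpa [b.form_apply, Int.cast_smul_eq_zsmul] using hn)
  ext i
  exact_mod_cast h i

/-- The integral coefficient vectors of the roots with respect to the simple roots. -/
def LieAlgebra.Basis.IsRootCoeff (n : ι → ℤ) : Prop :=
  ∃ α : Weight ℂ H L, α.IsNonZero ∧ α.toLinear = b.form n

variable {b}

theorem LieAlgebra.Basis.isRootCoeff_single (i : ι) : b.IsRootCoeff (Pi.single i 1) := by
  refine ⟨(b.baseSupp' i).1, ?_, ?_⟩
  · exact (Finset.mem_filter.mp (b.baseSupp' i).2).2
  · rw [b.form_single, one_smul]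
    exact b.coe_linearMap_baseSupp' i

theorem LieAlgebra.Basis.IsRootCoeff.neg {n : ι → ℤ} (h : b.IsRootCoeff n) :
    b.IsRootCoeff (-n) := by
  obtain ⟨α, h₁, h₂⟩ := h
  refine ⟨-α, h₁.neg, ?_⟩
  rw [map_neg, ← h₂]
  ext x
  simp

theorem LieAlgebra.Basis.IsRootCoeff.reflect {n : ι → ℤ} (h : b.IsRootCoeff n) (i : ι) :
    b.IsRootCoeff (n - (∑ j, n j * b.A j i) • Pi.single i 1) := by
  obtain ⟨α, h₁, h₂⟩ := h
  refine ⟨reflectRoot (b.baseSupp' i).1 α, reflectRoot_isNonZero _ _ h₁, ?_⟩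
  have h₃ : coroot (b.baseSupp' i).1 = b.h' i := b.coroot_eq_h' i
  have h₄ : α (b.h' i) = ((∑ j, n j * b.A j i : ℤ) : ℂ) := by
    rw [← Weight.toLinear_apply, h₂, b.form_apply]
    simp
  have h₅ : ((b.baseSupp' i).1 : H → ℂ) = b.baseSupp i := 
    congrArg DFunLike.coe (b.coe_linearMap_baseSupp' i)
  rw [map_sub, ← h₂, map_zsmul, b.form_single, one_smul]
  ext x
  change α x - (α (coroot (b.baseSupp' i).1) • ((b.baseSupp' i).1 : H → ℂ)) x = _
  rw [h₃, h₄, h₅]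
  simp

theorem LieAlgebra.Basis.exists_form_eq (α : Weight ℂ H L) (hα : α.IsNonZero) :
    ∃ n : ι → ℤ, α.toLinear = b.form n ∧ ((∀ i, 0 ≤ n i) ∨ ∀ i, n i ≤ 0) := by
  have key : ∀ f ∈ AddSubmonoid.closure ((rootSystem H).root '' Set.range b.baseSupp'),
      ∃ n : ι → ℤ, f = b.form n ∧ ∀ i, 0 ≤ n i := by
    intro f hf
    induction hf using AddSubmonoid.closure_induction with
    | mem f hf =>
      obtain ⟨_, ⟨i, rfl⟩, rfl⟩ := hf
      refine ⟨Pi.single i 1, ?_, fun j => ?_⟩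
      · rw [b.form_single, one_smul]
        exact b.coe_linearMap_baseSupp' i
      · by_cases h : j = i
        · subst h; simp
        · simp [h]
    | zero => exact ⟨0, by simp, by simp⟩
    | add f g _ _ hf hg =>
      obtain ⟨m, rfl, hm⟩ := hf
      obtain ⟨n, rfl, hn⟩ := hg
      exact ⟨m + n, by simp, fun i => add_nonneg (hm i) (hn i)⟩
  rcases b.root_mem_or_mem_neg ⟨α, by simpa using hα⟩ with h | h
  · obtain ⟨n, h₁, h₂⟩ := key _ h
    exact ⟨n, h₁, .inl h₂⟩
  · obtain ⟨n, h₁, h₂⟩ := key _ h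
    exact ⟨-n, by rw [map_neg, ← h₁, neg_neg]; rfl, .inr fun i => by simpa using h₂ i⟩

theorem LieAlgebra.Basis.IsRootCoeff.nonneg_or_nonpos {n : ι → ℤ} (h : b.IsRootCoeff n) :
    (∀ i, 0 ≤ n i) ∨ ∀ i, n i ≤ 0 := by
  obtain ⟨α, h₁, h₂⟩ := h
  obtain ⟨m, h₃, h₄⟩ := LieAlgebra.Basis.exists_form_eq (b := b) α h₁
  rwa [b.form_injective (h₂.symm.trans h₃)]

theorem LieAlgebra.Basis.IsRootCoeff.ne_zero {n : ι → ℤ} (h : b.IsRootCoeff n) : n ≠ 0 := by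
  rintro rfl
  obtain ⟨α, h₁, h₂⟩ := h
  rw [map_zero, Weight.coe_toLinear_eq_zero_iff] at h₂
  exact h₁ h₂

theorem LieAlgebra.Basis.IsRootCoeff.eq_single {i : ι} {c : ℤ}
    (h : b.IsRootCoeff (Pi.single i c)) (hc : 0 ≤ c) : c = 1 := by
  obtain ⟨α, h₁, h₂⟩ := id h
  obtain ⟨β, h₃, h₄⟩ := LieAlgebra.Basis.isRootCoeff_single (b := b) i
  have h₅ := eq_neg_or_eq_of_eq_smul β α h₁ c (by
    change ⇑(α.toLinear) = (c : ℂ) • ⇑(β.toLinear)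
    rw [h₂, h₄, b.form_single, b.form_single]
    ext
    simp)
  rw [b.form_single] at h₂
  rcases h₅ with rfl | rfl
  · have : b.form (Pi.single i c) = b.form (-Pi.single i 1) := by
      rw [b.form_single, map_neg, ← h₄, ← h₂]; ext; simp
    have := congrFun (b.form_injective this) i
    simp at this
    omega
  · have := congrFun (b.form_injective (by
      rw [b.form_single, ← h₂, h₄] : b.form (Pi.single i c) = b.form (Pi.single i 1))) i
    simpa using this

end RootCoefficients

section RootsOfTypeE₇

open LieAlgebra LieAlgebra.IsKilling LieModule

variable {L : Type*} [LieRing L] [LieAlgebra ℂ L] [FiniteDimensional ℂ L] [IsKilling ℂ L]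
  {H : LieSubalgebra ℂ L} [H.IsCartanSubalgebra] (b : LieAlgebra.Basis (Fin 7) H)

theorem exists_pos_sum_mul_E₇ (n : Fin 7 → ℤ) (h₀ : ∀ i, 0 ≤ n i) (h : n ≠ 0) :
    ∃ i, 0 < ∑ j, n j * CartanMatrix.E₇ j i := by
  by_contra! hle
  refine h (funext fun i => ?_)
  have h0 := hle 0
  have h1 := hle 1
  have h2 := hle 2
  have h3 := hle 3
  have h4 := hle 4
  have h5 := hle 5
  have h6 := hle 6
  simp [Fin.sum_univ_succ, CartanMatrix.E₇] at h0 h1 h2 h3 h4 h5 h6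
  have k0 := h₀ 0
  have k1 := h₀ 1
  have k2 := h₀ 2
  have k3 := h₀ 3
  have k4 := h₀ 4
  have k5 := h₀ 5
  have k6 := h₀ 6
  fin_cases i <;> simp <;> omega

variable {b}

theorem sum_reflectE₇_mul (n : Fin 7 → ℤ) (i : Fin 7) :
    ∑ j, reflectE₇ i n j * CartanMatrix.E₇ j i = -∑ j, n j * CartanMatrix.E₇ j i := by
  have h : ∑ j, (Pi.single i 1 : Fin 7 → ℤ) j * CartanMatrix.E₇ j i = 2 := by
    rw [Finset.sum_eq_single i (fun j _ hj => by simp [hj]) (by simp)]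
    simp [CartanMatrix.E₇_diag]
  simp only [reflectE₇, Pi.sub_apply, Pi.smul_apply, smul_eq_mul, sub_mul, Finset.sum_sub_distrib,
    mul_assoc, ← Finset.mul_sum, h]
  ring

theorem reflectE₇_reflectE₇ (n : Fin 7 → ℤ) (i : Fin 7) : reflectE₇ i (reflectE₇ i n) = n := by
  rw [reflectE₇, sum_reflectE₇_mul, reflectE₇]
  module

theorem sum_reflectE₇ (n : Fin 7 → ℤ) (i : Fin 7) :
    ∑ j, reflectE₇ i n j = ∑ j, n j - ∑ j, n j * CartanMatrix.E₇ j i := by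
  simp [reflectE₇, Finset.sum_sub_distrib, ← Finset.mul_sum]

theorem LieAlgebra.Basis.IsRootCoeff.reflectE₇ (hA : b.A = CartanMatrix.E₇) {n : Fin 7 → ℤ}
    (h : b.IsRootCoeff n) (i : Fin 7) : b.IsRootCoeff (reflectE₇ i n) := by
  have := h.reflect i
  rwa [hA] at this

theorem mem_posRootsE₇ (hA : b.A = CartanMatrix.E₇) {n : Fin 7 → ℤ} (h : b.IsRootCoeff n)
    (h₀ : ∀ i, 0 ≤ n i) : n ∈ posRootsE₇ := by
  obtain ⟨N, hN⟩ : ∃ N : ℕ, ∑ i, n i ≤ N := ⟨(∑ i, n i).toNat, Int.self_le_toNat _⟩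
  induction N generalizing n with
  | zero =>
    exfalso
    refine h.ne_zero (funext fun i => ?_)
    have := Finset.single_le_sum (f := n) (fun i _ => h₀ i) (Finset.mem_univ i)
    exact le_antisymm (this.trans (by simpa using hN)) (h₀ i)
  | succ N ih =>
    obtain ⟨i, hi⟩ := exists_pos_sum_mul_E₇ n h₀ h.ne_zero
    have hr := h.reflectE₇ hA i
    have hj : ∀ j, j ≠ i → reflectE₇ i n j = n j := fun j hj => by
      simp [_root_.reflectE₇, hj]
    rcases hr.nonneg_or_nonpos with hp | hp
    · have hmem : reflectE₇ i n ∈ posRootsE₇ := by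
        refine ih hr hp ?_
        rw [sum_reflectE₇]
        push_cast at hN
        omega
      rcases reflectE₇_mem _ hmem i with h₁ | h₁
      · exfalso
        have h₂ := sum_reflectE₇_mul n i
        rw [h₁, Finset.sum_eq_single i (fun j _ hj => by simp [hj]) (by simp)] at h₂
        simp only [Pi.single_eq_same, CartanMatrix.E₇_diag] at h₂
        omega
      · rwa [reflectE₇_reflectE₇] at h₁
    · have hn : n = Pi.single i (n i) := by
        ext j
        by_cases hji : j = i
        · subst hji; simp
        · have := hp j
          rw [hj j hji] at this
          simpa [hji] using le_antisymm this (h₀ j)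
      have h' : b.IsRootCoeff (Pi.single i (n i)) := hn ▸ h
      rw [hn, h'.eq_single (h₀ i)]
      exact single_mem_posRootsE₇ i

theorem isRootCoeff_of_mem_posRootsE₇ (hA : b.A = CartanMatrix.E₇) {n : Fin 7 → ℤ}
    (h : n ∈ posRootsE₇) : b.IsRootCoeff n := by
  obtain ⟨N, hN⟩ : ∃ N : ℕ, ∑ i, n i ≤ N := ⟨(∑ i, n i).toNat, Int.self_le_toNat _⟩
  induction N generalizing n with
  | zero =>
    refine absurd (funext fun i => ?_) (ne_zero_of_mem_posRootsE₇ n h)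
    have h₀ := nonneg_of_mem_posRootsE₇ n h
    have := Finset.single_le_sum (f := n) (fun i _ => h₀ i) (Finset.mem_univ i)
    exact le_antisymm (this.trans (by simpa using hN)) (h₀ i)
  | succ N ih =>
    rcases exists_reflectE₇_lt n h with ⟨i, rfl⟩ | ⟨i, h₁, h₂⟩
    · exact LieAlgebra.Basis.isRootCoeff_single i
    · have := (ih h₁ (by push_cast at hN; omega)).reflectE₇ hA i
      rwa [reflectE₇_reflectE₇] at this

theorem isRootCoeff_iff (hA : b.A = CartanMatrix.E₇) {n : Fin 7 → ℤ} :
    b.IsRootCoeff n ↔ n ∈ posRootsE₇ ∨ -n ∈ posRootsE₇ := by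
  refine ⟨fun h => h.nonneg_or_nonpos.imp (mem_posRootsE₇ hA h) fun h' =>
    mem_posRootsE₇ hA h.neg fun i => neg_nonneg.mpr (h' i), ?_⟩
  rintro (h | h)
  · exact isRootCoeff_of_mem_posRootsE₇ hA h
  · simpa using (isRootCoeff_of_mem_posRootsE₇ hA h).neg

end RootsOfTypeE₇

section TraceWeights

set_option linter.unusedSectionVars false

open LieAlgebra LieAlgebra.IsKilling LieModule

variable {L : Type*} [LieRing L] [LieAlgebra ℂ L] [FiniteDimensional ℂ L] [IsKilling ℂ L]
  {H : LieSubalgebra ℂ L} [H.IsCartanSubalgebra]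

theorem trace_eq_sum_weight (T : End ℂ L) (c : Weight ℂ H L → ℂ)
    (h : ∀ χ : Weight ℂ H L, ∀ x ∈ rootSpace H χ, T x = c χ • x) :
    LinearMap.trace ℂ L T = ∑ χ : Weight ℂ H L, finrank ℂ (rootSpace H χ) * c χ := by
  classical
  have hT : ∀ χ : Weight ℂ H L, Set.MapsTo T (rootSpace H χ) (rootSpace H χ) := fun χ x hx => by
    rw [h χ x hx]
    exact (rootSpace H χ).smul_mem _ hx
  have hds := DirectSum.isInternal_submodule_of_iSupIndep_of_iSup_eq_top
    (LieSubmodule.iSupIndep_toSubmodule.mpr <| iSupIndep_genWeightSpace' ℂ H L)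
    (LieSubmodule.iSup_toSubmodule_eq_top.mpr <| iSup_genWeightSpace_eq_top' ℂ H L)
  rw [LinearMap.trace_eq_sum_trace_restrict hds hT]
  refine Finset.sum_congr rfl fun χ _ => ?_
  have : T.restrict (hT χ) = c χ • (1 : End ℂ (rootSpace H χ).toSubmodule) := by
    ext x
    exact h χ x x.2
  erw [this, map_smul, LinearMap.trace_one, smul_eq_mul, mul_comm]
  rfl

theorem trace_eq_sum_root [Nontrivial L] (T : End ℂ L) (c : Weight ℂ H L → ℂ)
    (h : ∀ χ : Weight ℂ H L, ∀ x ∈ rootSpace H χ, T x = c χ • x) :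
    LinearMap.trace ℂ L T = finrank ℂ H * c 0 + ∑ χ ∈ H.root, c χ := by
  classical
  rw [trace_eq_sum_weight T c h, ← Finset.add_sum_erase _ _ (Finset.mem_univ (0 : Weight ℂ H L))]
  congr 1
  · have : finrank ℂ (rootSpace H ((0 : Weight ℂ H L) : H → ℂ)) = finrank ℂ H := by
      rw [FunLike.coe_zero, rootSpace_zero_eq]
      rfl
    rw [this]
  · refine Finset.sum_congr (Finset.ext fun χ => ?_) fun χ hχ => ?_
    · simp [LieSubalgebra.root, Weight.IsNonZero, Weight.isZero_iff_eq_zero]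
    · have hχ : χ.IsNonZero := (Finset.mem_filter.mp hχ).2
      rw [finrank_rootSpace_eq_one χ hχ, Nat.cast_one, one_mul]

end TraceWeights

section DimensionOfTypeE₇

set_option linter.unusedSectionVars false

open LieAlgebra LieAlgebra.IsKilling LieModule

variable {L : Type*} [LieRing L] [LieAlgebra ℂ L] [FiniteDimensional ℂ L] [IsKilling ℂ L]
  {H : LieSubalgebra ℂ L} [H.IsCartanSubalgebra] (b : LieAlgebra.Basis (Fin 7) H)

theorem sum_root_eq (hA : b.A = CartanMatrix.E₇) (F : Dual ℂ H → ℂ) (hF : ∀ f, F (-f) = F f) :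
    ∑ χ ∈ H.root, F χ.toLinear = 2 * (posRootsE₇.map fun n => F (b.form n)).sum := by
  classical
  have hdisj : Disjoint posRootsE₇.toFinset (posRootsE₇.toFinset.image (- ·)) := by
    rw [Finset.disjoint_left]
    intro n hn hn'
    obtain ⟨m, hm, rfl⟩ := Finset.mem_image.mp hn'
    rw [List.mem_toFinset] at hn hm
    refine ne_zero_of_mem_posRootsE₇ m hm (funext fun i => ?_)
    have h₁ := nonneg_of_mem_posRootsE₇ m hm i
    have h₂ := nonneg_of_mem_posRootsE₇ _ hn i
    simp only [Pi.neg_apply] at h₂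
    simp only [Pi.zero_apply]
    omega
  have himage : H.root.image (fun χ => χ.toLinear) =
      (posRootsE₇.toFinset ∪ posRootsE₇.toFinset.image (- ·)).image b.form := by
    ext f
    simp only [Finset.mem_image, Finset.mem_union, List.mem_toFinset]
    constructor
    · rintro ⟨χ, hχ, rfl⟩
      have hχ : χ.IsNonZero := (Finset.mem_filter.mp hχ).2
      obtain ⟨n, hn, -⟩ := LieAlgebra.Basis.exists_form_eq (b := b) χ hχ
      refine ⟨n, ?_, hn.symm⟩
      rcases (isRootCoeff_iff hA).mp ⟨χ, hχ, hn⟩ with h | h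
      · exact .inl h
      · exact .inr ⟨-n, h, neg_neg n⟩
    · rintro ⟨n, hn, rfl⟩
      obtain ⟨χ, h₁, h₂⟩ : b.IsRootCoeff n := by
        rcases hn with h | ⟨m, hm, rfl⟩
        · exact (isRootCoeff_iff hA).mpr (.inl h)
        · exact (isRootCoeff_iff hA).mpr (.inr (by rwa [neg_neg]))
      exact ⟨χ, by simpa [LieSubalgebra.root] using h₁, h₂⟩
  have hinj : Set.InjOn (fun χ : Weight ℂ H L => χ.toLinear) H.root := fun χ _ ψ _ h => by
    ext x
    exact LinearMap.congr_fun h x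
  rw [← Finset.sum_image (f := F) hinj, himage, Finset.sum_image b.form_injective.injOn,
    Finset.sum_union hdisj, Finset.sum_image neg_injective.injOn]
  simp only [map_neg, hF]
  rw [← two_mul, List.sum_toFinset _ nodup_posRootsE₇]

theorem finrank_cartan (b : LieAlgebra.Basis (Fin 7) H) : finrank ℂ H = 7 := by
  have h : finrank ℂ H.toSubmodule = 7 := by
    rw [b.coe_cartan_eq_span, finrank_span_eq_card b.linInd, Fintype.card_fin]
  exact h

theorem finrank_eq_133 [Nontrivial L] (hA : b.A = CartanMatrix.E₇) : finrank ℂ L = 133 := by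
  have h := trace_eq_sum_root (H := H) (1 : End ℂ L) (fun _ => 1) (fun _ x _ => by simp)
  rw [LinearMap.trace_one, finrank_cartan b, sum_root_eq b hA (fun _ => 1) (fun _ => rfl)] at h
  simp [length_posRootsE₇] at h
  norm_num at h
  exact_mod_cast h

theorem sum_mul_sum_mul_sum_mul_sum {ι R : Type*} [Fintype ι] [CommRing R] (a b c d : ι → R) :
    (∑ i, a i) * (∑ i, b i) * (∑ i, c i) * (∑ i, d i) =
      ∑ i, ∑ j, ∑ k, ∑ l, a i * b j * c k * d l := by
  rw [Finset.sum_mul_sum]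
  simp only [Finset.sum_mul]
  refine Finset.sum_congr rfl fun i _ => Finset.sum_congr rfl fun j _ => ?_
  rw [mul_assoc, Finset.sum_mul_sum]
  simp only [Finset.mul_sum, mul_assoc]

theorem sum_posRootsE₇_quartic (x y z w : Fin 7 → ℂ) :
    81 * ∑ n ∈ posRootsE₇.toFinset,
        (∑ i, n i * x i) * (∑ i, n i * y i) * (∑ i, n i * z i) * (∑ i, n i * w i) =
      (∑ n ∈ posRootsE₇.toFinset, (∑ i, n i * x i) * (∑ i, n i * y i)) *
        (∑ n ∈ posRootsE₇.toFinset, (∑ i, n i * z i) * (∑ i, n i * w i)) +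
      (∑ n ∈ posRootsE₇.toFinset, (∑ i, n i * x i) * (∑ i, n i * z i)) *
        (∑ n ∈ posRootsE₇.toFinset, (∑ i, n i * y i) * (∑ i, n i * w i)) +
      (∑ n ∈ posRootsE₇.toFinset, (∑ i, n i * x i) * (∑ i, n i * w i)) *
        (∑ n ∈ posRootsE₇.toFinset, (∑ i, n i * y i) * (∑ i, n i * z i)) := by
  have h₂ (x y : Fin 7 → ℂ) : ∑ n ∈ posRootsE₇.toFinset, (∑ i, n i * x i) * (∑ i, n i * y i) =
      ∑ i, ∑ j, x i * y j * ((posRootsE₇.map fun n => n i * n j).sum : ℤ) := by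
    simp only [Finset.sum_mul_sum]
    rw [Finset.sum_comm]
    refine Finset.sum_congr rfl fun i _ => ?_
    rw [Finset.sum_comm]
    refine Finset.sum_congr rfl fun j _ => ?_
    rw [← List.sum_toFinset _ nodup_posRootsE₇, Int.cast_sum, Finset.mul_sum]
    refine Finset.sum_congr rfl fun n _ => ?_
    push_cast
    ring
  have h₄ : ∑ n ∈ posRootsE₇.toFinset,
        (∑ i, n i * x i) * (∑ i, n i * y i) * (∑ i, n i * z i) * (∑ i, n i * w i) =
      ∑ i, ∑ j, ∑ k, ∑ l, x i * y j * z k * w l *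
        ((posRootsE₇.map fun n => n i * n j * n k * n l).sum : ℤ) := by
    simp only [sum_mul_sum_mul_sum_mul_sum]
    rw [Finset.sum_comm]
    refine Finset.sum_congr rfl fun i _ => ?_
    rw [Finset.sum_comm]
    refine Finset.sum_congr rfl fun j _ => ?_
    rw [Finset.sum_comm]
    refine Finset.sum_congr rfl fun k _ => ?_
    rw [Finset.sum_comm]
    refine Finset.sum_congr rfl fun l _ => ?_
    rw [← List.sum_toFinset _ nodup_posRootsE₇, Int.cast_sum, Finset.mul_sum]
    refine Finset.sum_congr rfl fun n _ => ?_
    push_cast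
    ring
  have h₅ (f g : Fin 7 → Fin 7 → ℂ) : (∑ i, ∑ j, f i j) * (∑ k, ∑ l, g k l) =
      ∑ i, ∑ j, ∑ k, ∑ l, f i j * g k l := by
    simp only [Finset.sum_mul]
    refine Finset.sum_congr rfl fun i _ => Finset.sum_congr rfl fun j _ => ?_
    simp only [Finset.mul_sum]
  have h₆ (f : Fin 7 → Fin 7 → Fin 7 → Fin 7 → ℂ) :
      ∑ i, ∑ k, ∑ j, ∑ l, f i k j l = ∑ i, ∑ j, ∑ k, ∑ l, f i k j l :=
    Finset.sum_congr rfl fun i _ => Finset.sum_comm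
  have h₇ (f : Fin 7 → Fin 7 → Fin 7 → Fin 7 → ℂ) :
      ∑ i, ∑ l, ∑ j, ∑ k, f i l j k = ∑ i, ∑ j, ∑ k, ∑ l, f i l j k := by
    refine Finset.sum_congr rfl fun i _ => ?_
    rw [Finset.sum_comm]
    exact Finset.sum_congr rfl fun j _ => Finset.sum_comm
  rw [h₄, h₂, h₂, h₂, h₂, h₂, h₂, h₅, h₅, h₅,
    h₆ (fun i k j l => x i * z k * _ * (y j * w l * _)),
    h₇ (fun i l j k => x i * w l * _ * (y j * z k * _))]
  simp only [Finset.mul_sum, ← Finset.sum_add_distrib]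
  refine Finset.sum_congr rfl fun i _ => Finset.sum_congr rfl fun j _ =>
    Finset.sum_congr rfl fun k _ => Finset.sum_congr rfl fun l _ => ?_
  have h := congrArg (Int.cast : ℤ → ℂ) (posRootsE₇_quartic i j k l)
  simp only [Int.cast_mul, Int.cast_add, Int.cast_ofNat] at h
  linear_combination x i * y j * z k * w l * h

theorem sum_root_apply_eq (hA : b.A = CartanMatrix.E₇) (P : Dual ℂ H → ℂ)
    (hP : ∀ f, P (-f) = P f) (T : End ℂ L)
    (hT : ∀ χ : Weight ℂ H L, ∀ x ∈ rootSpace H χ, T x = P χ.toLinear • x) (h0 : P 0 = 0)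
    [Nontrivial L] :
    LinearMap.trace ℂ L T = 2 * ∑ n ∈ posRootsE₇.toFinset, P (b.form n) := by
  have h0' : (0 : Weight ℂ H L).toLinear = 0 := by
    ext x
    simp
  rw [trace_eq_sum_root (H := H) T (fun χ => P χ.toLinear) hT, sum_root_eq b hA P hP,
    List.sum_toFinset _ nodup_posRootsE₇, h0', h0, mul_zero, zero_add]

theorem form_apply_apply (n : Fin 7 → ℤ) (a : H) : b.form n a = ∑ i, n i * b.baseSupp i a := by
  simp [b.form_apply]

theorem trace_ad_cartan₂ [Nontrivial L] (hA : b.A = CartanMatrix.E₇) (x y : H) :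
    killingForm ℂ L (x : L) y =
      2 * ∑ n ∈ posRootsE₇.toFinset, b.form n x * b.form n y := by
  rw [killing_eq_trace]
  refine sum_root_apply_eq b hA (fun f => f x * f y) (fun f => ?_) _ (fun χ v hv => ?_) ?_
  · simp only [LinearMap.neg_apply, neg_mul_neg]
  · have hlie (a : H) : ad ℂ L (a : L) v = χ a • v := lie_eq_smul_of_mem_rootSpace hv a
    simp only [Module.End.mul_apply, hlie, map_smul, smul_smul, Weight.toLinear_apply,
      mul_comm (χ y)]
  · simp

theorem trace_ad_cartan₄ [Nontrivial L] (hA : b.A = CartanMatrix.E₇) (x y z w : H) :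
    LinearMap.trace ℂ L (ad ℂ L (x : L) * ad ℂ L y * ad ℂ L z * ad ℂ L w) =
      2 * ∑ n ∈ posRootsE₇.toFinset, b.form n x * b.form n y * b.form n z * b.form n w := by
  refine sum_root_apply_eq b hA (fun f => f x * f y * f z * f w) (fun f => ?_) _
    (fun χ v hv => ?_) ?_
  · simp only [LinearMap.neg_apply, mul_neg, neg_mul, neg_neg]
  · have hlie (a : H) : ad ℂ L (a : L) v = χ a • v := lie_eq_smul_of_mem_rootSpace hv a
    simp only [Module.End.mul_apply, hlie, map_smul, smul_smul, Weight.toLinear_apply]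
    congr 1
    ring
  · simp

theorem sum_form_quartic (x y z w : H) :
    81 * ∑ n ∈ posRootsE₇.toFinset, b.form n x * b.form n y * b.form n z * b.form n w =
      (∑ n ∈ posRootsE₇.toFinset, b.form n x * b.form n y) *
        (∑ n ∈ posRootsE₇.toFinset, b.form n z * b.form n w) +
      (∑ n ∈ posRootsE₇.toFinset, b.form n x * b.form n z) *
        (∑ n ∈ posRootsE₇.toFinset, b.form n y * b.form n w) +
      (∑ n ∈ posRootsE₇.toFinset, b.form n x * b.form n w) *
        (∑ n ∈ posRootsE₇.toFinset, b.form n y * b.form n z) := by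
  simp only [form_apply_apply]
  exact sum_posRootsE₇_quartic (b.baseSupp · x) (b.baseSupp · y) (b.baseSupp · z)
    (b.baseSupp · w)

theorem quarticDefect_cartan [Nontrivial L] (hA : b.A = CartanMatrix.E₇) (h₁ h₂ h₃ h₄ : H) :
    quarticDefect (h₁ : L) h₂ h₃ h₄ = 0 := by
  have hc (x y : H) : ad ℂ L (x : L) * ad ℂ L y = ad ℂ L y * ad ℂ L x := by
    have h : ⁅(x : L), (y : L)⁆ = 0 := by
      have h := congrArg (Subtype.val : H → L) (trivial_lie_zero H H x y)
      simpa using h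
    ext v
    simp only [Module.End.mul_apply, ad_apply]
    rw [leibniz_lie, h, zero_lie, zero_add]
  have hcomm (x y z w : H) : ad ℂ L (x : L) * ad ℂ L y * ad ℂ L w * ad ℂ L z =
      ad ℂ L (x : L) * ad ℂ L y * ad ℂ L z * ad ℂ L w := by
    rw [mul_assoc, mul_assoc _ (ad ℂ L (z : L)), hc w z]
  have hcomm' (x y z w : H) : ad ℂ L (x : L) * ad ℂ L z * ad ℂ L y * ad ℂ L w =
      ad ℂ L (x : L) * ad ℂ L y * ad ℂ L z * ad ℂ L w := by
    rw [mul_assoc _ (ad ℂ L (z : L)), mul_assoc _ (ad ℂ L (y : L)) (ad ℂ L (z : L)), hc y z]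
  have key := sum_form_quartic b h₁ h₂ h₃ h₄
  rw [quarticDefect, hcomm h₁ h₂ h₃ h₄, hcomm' h₁ h₂ h₃ h₄, hcomm h₁ h₃ h₂ h₄, hcomm h₁ h₄ h₂ h₃,
    hcomm' h₁ h₂ h₃ h₄, hcomm' h₁ h₂ h₄ h₃, hcomm h₁ h₂ h₃ h₄, trace_ad_cartan₄ b hA]
  simp only [trace_ad_cartan₂ b hA]
  linear_combination 4 * key

end DimensionOfTypeE₇

section QuarticIdentity

set_option linter.unusedSectionVars false

open LieAlgebra LieAlgebra.IsKilling LieModule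

variable {L : Type*} [LieRing L] [LieAlgebra ℂ L] [FiniteDimensional ℂ L] [IsKilling ℂ L]
  {H : LieSubalgebra ℂ L} [H.IsCartanSubalgebra]

theorem span_cartan_union_rootVectors : Submodule.span ℂ ((H.toSubmodule : Set L) ∪
    {e | ∃ α : L → ℂ, (∀ x ∈ H.toSubmodule, ⁅x, e⁆ = α x • e) ∧ ∃ t ∈ H.toSubmodule, α t = 1}) =
      ⊤ := by
  classical
  rw [← LieSubmodule.iSup_toSubmodule_eq_top.mpr <| iSup_genWeightSpace_eq_top' ℂ H L]
  apply le_antisymm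
  · rw [LieSubmodule.iSup_toSubmodule_eq_top.mpr <| iSup_genWeightSpace_eq_top' ℂ H L]
    exact le_top
  refine iSup_le fun χ x hx => Submodule.subset_span ?_
  by_cases hχ : χ.IsZero
  · left
    have : x ∈ rootSpace H (0 : H → ℂ) := by
      rw [← hχ.eq]
      exact hx
    rw [rootSpace_zero_eq] at this
    simpa using this
  · right
    obtain ⟨t, ht⟩ : ∃ t : H, χ t ≠ 0 := by
      by_contra! h
      exact hχ (funext h)
    refine ⟨fun y => if hy : y ∈ H then χ ⟨y, hy⟩ else 0, fun y hy => ?_,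
      (χ t)⁻¹ • t, H.smul_mem _ t.2, ?_⟩
    · have hy' : y ∈ H := hy
      simp only [hy', dite_true]
      exact lie_eq_smul_of_mem_rootSpace (α := χ) hx ⟨y, hy'⟩
    · have hy' : (χ t)⁻¹ • (t : L) ∈ H := H.smul_mem _ t.2
      simp only [hy', dite_true]
      have : (⟨(χ t)⁻¹ • (t : L), hy'⟩ : H) = (χ t)⁻¹ • t := rfl
      rw [this]
      have h := χ.toLinear.map_smul (χ t)⁻¹ t
      simp only [Weight.toLinear_apply, smul_eq_mul] at h
      rw [h, inv_mul_cancel₀ ht]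

theorem quarticDefect_typeE₇ [Nontrivial L] (b : LieAlgebra.Basis (Fin 7) H)
    (hA : b.A = CartanMatrix.E₇) (x y z w : L) : quarticDefect x y z w = 0 := by
  refine quarticDefect_eq_zero H.toSubmodule (fun x hx y hy => ?_) span_cartan_union_rootVectors
    (fun x hx y hy z hz w hw => quarticDefect_cartan b hA ⟨x, hx⟩ ⟨y, hy⟩ ⟨z, hz⟩ ⟨w, hw⟩) x y z w
  have h := congrArg (Subtype.val : H → L) (trivial_lie_zero H H ⟨x, hx⟩ ⟨y, hy⟩)
  simpa using h

end QuarticIdentity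

section TypeE₇

open LieAlgebra

variable {L : Type*} [LieRing L] [LieAlgebra ℂ L] {H : LieSubalgebra ℂ L}

theorem LieAlgebra.Basis.isKilling_typeE₇ [FiniteDimensional ℂ L]
    (b : LieAlgebra.Basis (Fin 7) H) (hA : b.A = CartanMatrix.E₇) : IsKilling ℂ L :=
  b.isKilling ![34, 49, 66, 96, 75, 52, 27] fun i => by
    rw [hA]
    revert i
    decide

theorem finrank_centralizerDerived_typeE₇ [FiniteDimensional ℂ L] [Nontrivial L]
    (b : LieAlgebra.Basis (Fin 7) H) (hA : b.A = CartanMatrix.E₇) {e : L}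
    (hnil : IsNilpotent (ad ℂ L e)) (hker : finrank ℂ (LinearMap.ker (ad ℂ L e)) = 79) :
    finrank ℂ (centralizerDerived e) = 78 ∧ e ∉ centralizerDerived e := by
  have := b.isKilling_typeE₇ hA
  have := b.isCartanSubalgebra
  exact finrank_centralizerDerived (finrank_eq_133 b hA) (quarticDefect_typeE₇ b hA) hnil hker

end TypeE₇

section FiniteDimensionality

variable {K V : Type*} [Field K] [AddCommGroup V] [Module K V]

theorem finiteDimensional_of_isNilpotent {T : End K V} (hT : IsNilpotent T)
    [FiniteDimensional K (LinearMap.ker T)] : FiniteDimensional K V := by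
  obtain ⟨n, hn⟩ := hT
  have key (m : ℕ) : FiniteDimensional K (LinearMap.ker (T ^ m)) := by
    induction m with
    | zero =>
      have h : LinearMap.ker (T ^ 0) = ⊥ := by
        rw [pow_zero]
        exact LinearMap.ker_id
      rw [h]
      infer_instance
    | succ m ih =>
      rw [pow_succ, Module.End.mul_eq_comp, LinearMap.ker_comp]
      have hmaps : ∀ v ∈ (LinearMap.ker (T ^ m)).comap T, T v ∈ LinearMap.ker (T ^ m) :=
        fun v hv => hv
      let S := T.restrict hmaps
      have hS : FiniteDimensional K (LinearMap.ker S) := by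
        let ι : LinearMap.ker S →ₗ[K] LinearMap.ker T :=
          LinearMap.codRestrict _ ((Submodule.subtype _).comp (Submodule.subtype _)) fun v => by
            exact congrArg Subtype.val v.2
        refine FiniteDimensional.of_injective ι fun v w h => ?_
        exact Subtype.ext (Subtype.ext (congrArg (Subtype.val : LinearMap.ker T → V) h))
      have : FiniteDimensional K (LinearMap.range S) := inferInstance
      exact Module.Finite.of_submodule_quotient (LinearMap.ker S)
  have h := key n
  rw [hn, LinearMap.ker_zero] at h
  exact Module.Finite.equiv (Submodule.topEquiv (R := K) (M := V))

end FiniteDimensionality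

section SerreConstruction

open LieAlgebra CartanMatrix

variable (R : Type*) [CommRing R] {B : Type*} [DecidableEq B] (C : Matrix B B ℤ)

/-- The projection from the free Lie algebra onto the Lie algebra of a Cartan matrix. -/
noncomputable def Matrix.ToLieAlgebra.proj :
    FreeLieAlgebra R (Generators B) →ₗ⁅R⁆ Matrix.ToLieAlgebra R C :=
  { LieSubmodule.Quotient.mk' (Relations.toIdeal R C) with
    map_lie' := fun {_ _} => rfl }

theorem Matrix.ToLieAlgebra.proj_surjective : Function.Surjective (proj R C) :=
  LieSubmodule.Quotient.surjective_mk' (Relations.toIdeal R C)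

theorem Matrix.ToLieAlgebra.proj_eq_zero {x : FreeLieAlgebra R (Generators B)}
    (hx : x ∈ Relations.toSet R C) : proj R C x = 0 :=
  (LieSubmodule.Quotient.mk_eq_zero' (N := Relations.toIdeal R C)).mpr
    (LieSubmodule.subset_lieSpan hx)

/-- The generator `h i` of the Lie algebra of a Cartan matrix. -/
noncomputable def Matrix.ToLieAlgebra.genH (i : B) : Matrix.ToLieAlgebra R C :=
  proj R C (FreeLieAlgebra.of R (Generators.H i))

/-- The generator `e i` of the Lie algebra of a Cartan matrix. -/
noncomputable def Matrix.ToLieAlgebra.genE (i : B) : Matrix.ToLieAlgebra R C :=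
  proj R C (FreeLieAlgebra.of R (Generators.E i))

/-- The generator `f i` of the Lie algebra of a Cartan matrix. -/
noncomputable def Matrix.ToLieAlgebra.genF (i : B) : Matrix.ToLieAlgebra R C :=
  proj R C (FreeLieAlgebra.of R (Generators.F i))

namespace Matrix.ToLieAlgebra

theorem lie_genH_genH (i j : B) : ⁅genH R C i, genH R C j⁆ = 0 := by
  have h := proj_eq_zero R C (x := Relations.HH R (i, j)) (by simp [Relations.toSet])
  simpa [genH, genE, genF, Relations.HH] using h

theorem lie_genE_genF_self (i : B) : ⁅genE R C i, genF R C i⁆ = genH R C i := by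
  have h := proj_eq_zero R C (x := Relations.EF R (i, i))
    (by simp only [Relations.toSet, Set.mem_union, Set.mem_range_self, true_or, or_true])
  simpa [genH, genE, genF, Relations.EF, sub_eq_zero] using h

theorem lie_genE_genF_of_ne {i j : B} (hij : i ≠ j) : ⁅genE R C i, genF R C j⁆ = 0 := by
  have h := proj_eq_zero R C (x := Relations.EF R (i, j))
    (by simp only [Relations.toSet, Set.mem_union, Set.mem_range_self, true_or, or_true])
  simpa [genH, genE, genF, Relations.EF, hij] using h

theorem lie_genH_genE (i j : B) : ⁅genH R C i, genE R C j⁆ = C i j • genE R C j := by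
  have h := proj_eq_zero R C (x := Relations.HE R C (i, j))
    (by simp only [Relations.toSet, Set.mem_union, Set.mem_range_self, true_or, or_true])
  simpa [genH, genE, genF, Relations.HE, sub_eq_zero] using h

theorem lie_genH_genF (i j : B) : ⁅genH R C i, genF R C j⁆ = -C i j • genF R C j := by
  have h := proj_eq_zero R C (x := Relations.HF R C (i, j))
    (by simp only [Relations.toSet, Set.mem_union, Set.mem_range_self, true_or, or_true])
  simpa [genH, genE, genF, Relations.HF, add_eq_zero_iff_eq_neg] using h

theorem mem_of_gen_mem (S : LieSubalgebra R (Matrix.ToLieAlgebra R C))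
    (hE : ∀ i, genE R C i ∈ S) (hF : ∀ i, genF R C i ∈ S) (x : Matrix.ToLieAlgebra R C) :
    x ∈ S := by
  have hH (i : B) : genH R C i ∈ S := by
    rw [← lie_genE_genF_self]
    exact S.lie_mem (hE i) (hF i)
  let φ : FreeLieAlgebra R (Generators B) →ₗ⁅R⁆ S := FreeLieAlgebra.lift R fun g =>
    ⟨proj R C (FreeLieAlgebra.of R g), by
      cases g with
      | H i => exact hH i
      | E i => exact hE i
      | F i => exact hF i⟩
  have hφ : S.incl.comp φ = proj R C := by
    refine FreeLieAlgebra.hom_ext fun g => ?_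
    simp [φ]
  obtain ⟨y, rfl⟩ := proj_surjective R C x
  rw [← hφ]
  exact (φ y).2

end Matrix.ToLieAlgebra

end SerreConstruction

section SerreBasis

open LieAlgebra CartanMatrix Matrix.ToLieAlgebra

theorem Matrix.ToLieAlgebra.genH_eq_zero_of {B : Type*} [DecidableEq B] {C : Matrix B B ℤ}
    {i j : B} (hij : C i j ≠ 0) (h : genH ℂ C i = 0) : genH ℂ C j = 0 := by
  have h' := lie_genH_genE ℂ C i j
  rw [h, zero_lie, eq_comm, ← Int.cast_smul_eq_zsmul ℂ, smul_eq_zero] at h'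
  rw [← lie_genE_genF_self, h'.resolve_left (by exact_mod_cast hij), zero_lie]

theorem Matrix.ToLieAlgebra.genH_E₇_ne_zero [Nontrivial (e₇ ℂ)] (i : Fin 7) :
    genH ℂ E₇ i ≠ 0 := by
  intro hi
  have hconn (i j : Fin 7) (h : genH ℂ E₇ i = 0) : genH ℂ E₇ j = 0 := by
    have step (i j : Fin 7) (hij : E₇ i j ≠ 0 ∧ E₇ j i ≠ 0) :
        genH ℂ E₇ i = 0 ↔ genH ℂ E₇ j = 0 := ⟨genH_eq_zero_of hij.1, genH_eq_zero_of hij.2⟩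
    have h₁ := step 0 2 (by decide)
    have h₂ := step 1 3 (by decide)
    have h₃ := step 2 3 (by decide)
    have h₄ := step 3 4 (by decide)
    have h₅ := step 4 5 (by decide)
    have h₆ := step 5 6 (by decide)
    have hall (k : Fin 7) : genH ℂ E₇ k = 0 ↔ genH ℂ E₇ 3 = 0 := by
      fin_cases k
      · exact h₁.trans h₃
      · exact h₂
      · exact h₃
      · exact Iff.rfl
      · exact h₄.symm
      · exact (h₄.trans h₅).symm
      · exact ((h₄.trans h₅).trans h₆).symm
    exact (hall j).mpr ((hall i).mp h)
  have hE (j : Fin 7) : genE ℂ E₇ j = 0 := by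
    have h := lie_genH_genE ℂ E₇ j j
    rw [hconn i j hi, zero_lie, E₇_diag, eq_comm, ← Int.cast_smul_eq_zsmul ℂ, smul_eq_zero] at h
    exact h.resolve_left (by norm_num)
  have hF (j : Fin 7) : genF ℂ E₇ j = 0 := by
    have h := lie_genH_genF ℂ E₇ j j
    rw [hconn i j hi, zero_lie, E₇_diag, eq_comm, ← Int.cast_smul_eq_zsmul ℂ, smul_eq_zero] at h
    exact h.resolve_left (by norm_num)
  obtain ⟨x, hx⟩ := exists_ne (0 : e₇ ℂ)
  have h := mem_of_gen_mem ℂ E₇ ⊥ (fun j => by rw [hE]; exact zero_mem _)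
    (fun j => by rw [hF]; exact zero_mem _) x
  exact hx (by simpa using h)

theorem Matrix.ToLieAlgebra.genE_E₇_ne_zero [Nontrivial (e₇ ℂ)] (i : Fin 7) :
    genE ℂ E₇ i ≠ 0 := fun h =>
  genH_E₇_ne_zero i (by rw [← lie_genE_genF_self, h, zero_lie])

theorem Matrix.ToLieAlgebra.linearIndependent_genH_E₇ [Nontrivial (e₇ ℂ)] :
    LinearIndependent ℂ (genH ℂ E₇) := by
  rw [Fintype.linearIndependent_iff]
  intro c hc
  have hA : ((E₇.map (Int.cast : ℤ → ℂ))).det ≠ 0 := by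
    have h := (Int.castRingHom ℂ).map_det E₇
    rw [E₇_det] at h
    have h' : (E₇.map (Int.cast : ℤ → ℂ)).det = 2 := by
      simpa using h.symm
    rw [h']
    norm_num
  refine congrFun (Matrix.eq_zero_of_vecMul_eq_zero hA (funext fun j => ?_))
  have h : ⁅∑ i, c i • genH ℂ E₇ i, genE ℂ E₇ j⁆ = 0 := by rw [hc, zero_lie]
  simp only [sum_lie, smul_lie, lie_genH_genE, ← Int.cast_smul_eq_zsmul ℂ, smul_smul,
    ← Finset.sum_smul] at h
  exact (smul_eq_zero.mp h).resolve_right (genE_E₇_ne_zero j)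

/-- The Chevalley generators of the Lie algebra of type `E₇` form a basis in the sense of
`LieAlgebra.Basis`. -/
noncomputable def basisE₇ [Nontrivial (e₇ ℂ)] :
    LieAlgebra.Basis (Fin 7) (LieSubalgebra.lieSpan ℂ (e₇ ℂ) (Set.range (genH ℂ E₇))) where
  A := E₇
  h := genH ℂ E₇
  e := genE ℂ E₇
  f := genF ℂ E₇
  cartan_eq_lieSpan := rfl
  span_ef := by
    refine eq_top_iff.mpr fun x _ => mem_of_gen_mem ℂ E₇ _ (fun i => ?_) (fun i => ?_) x
    · exact LieSubalgebra.subset_lieSpan (Or.inl ⟨i, rfl⟩)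
    · exact LieSubalgebra.subset_lieSpan (Or.inr ⟨i, rfl⟩)
  linInd := linearIndependent_genH_E₇
  nondegen := Matrix.nondegenerate_of_det_ne_zero (by rw [E₇_det]; norm_num)
  sl2 i :=
    { h_ne_zero := genH_E₇_ne_zero i
      lie_e_f := lie_genE_genF_self ℂ E₇ i
      lie_h_e_nsmul := by
        rw [lie_genH_genE, E₇_diag]
        exact ofNat_zsmul _ 2
      lie_h_f_nsmul := by
        rw [lie_genH_genF, E₇_diag, neg_smul]
        exact congrArg _ (ofNat_zsmul _ 2) }
  lie_h_h := lie_genH_genH ℂ E₇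
  lie_h_e i j := by rw [lie_genH_genE, E₇_isSymm.apply]
  lie_h_f i j := by rw [lie_genH_genF, E₇_isSymm.apply]
  lie_e_f_ne _ _ := lie_genE_genF_of_ne ℂ E₇

end SerreBasis

end TypeE₇Structure

/-- In type E₇, for nilpotent `e` with `dim g_e = 79` one has `dim [g_e,g_e] = 78`
and `e ∉ [g_e,g_e]`. -/
theorem dim79_E7 (e : LieAlgebra.e₇ ℂ)
    (hnil : IsNilpotent (LieAlgebra.ad ℂ (LieAlgebra.e₇ ℂ) e))
    (hdim : Module.finrank ℂ ↥(centralizer e) = 79) :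
    Module.finrank ℂ ↥(derived e) = 78 ∧ e ∉ derived e := by
  have : Module.Finite ℂ (LinearMap.ker (LieAlgebra.ad ℂ (LieAlgebra.e₇ ℂ) e)) :=
    Module.finite_of_finrank_pos (by
      change 0 < Module.finrank ℂ (centralizer e)
      omega)
  have := finiteDimensional_of_isNilpotent hnil
  have : Nontrivial (LieAlgebra.e₇ ℂ) := by
    by_contra h
    rw [not_nontrivial_iff_subsingleton] at h
    rw [Module.finrank_zero_of_subsingleton] at hdim
    omega
  exact finrank_centralizerDerived_typeE₇ basisE₇ rfl hnil hdim
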